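/- Let n ≥ 3 and d be integers, let 𝓔 be a direct sum of three invertible sheaves on ℙ^{n−1} over ℂ, and let X be a very general member of |2D + dF| on ℙ_{ℙ^{n−1}}(𝓔) (D the tautological divisor, F the pullback of a hyperplane) such that the projection π : X → ℙ^{n−1} is a conic bundle with X nonsingular. Let Δ ⊂ ℙ^{n−1} be the discriminant divisor of π. If the complete linear system |3K_{ℙ^{n−1}} + Δ| is nonempty, then X is not stably rational. -/

import Mathlib

/-!
Formalization framework for "Stable rationality of higher dimensional conic bundles"
(Ahmadinezhad–Okada).

We model a weighted-projective-space bundle `P` over `ℙ^{n-1}` (in particular the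
`ℙ²`-bundle `P_n(k,l,m) = ℙ(𝒪(-k) ⊕ 𝒪(-l) ⊕ 𝒪(-m))`, and the `ℙ(1,1,2)`-bundle `R`)
through its Cox ring `K[u_0,…,u_{n-1}, x_0,…,x_{m-1}]`, bigraded by
`deg u_i = (1,0)`, `deg x_j = (w j, a j)`, together with the action of the
two-dimensional torus on the affine cone.  A member `X` of the complete linear
system `|𝒪_P(α,β)| = |α F + β D|` (`F` the pullback of the hyperplane class of
`ℙ^{n-1}`, `D` the tautological class) is recorded by a bihomogeneous polynomial
`g` of bidegree `(α,β)`, and the projection `π : X → ℙ^{n-1}` is induced by the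
coordinates `u_0,…,u_{n-1}`.

Geometric notions are rendered as follows (all are genuine definitions):

* a *general* (resp. *very general*) member of a linear system: the property holds
  on a nonempty principal Zariski-open subset of the parameter space (resp. away
  from countably many proper closed subsets);
* smoothness of `X`: the Jacobian criterion on the punctured affine cone (where the
  torus acts freely the quotient map is a torsor, so this is smoothness of `X`);
* the function field `K(X)`: the degree-`(0,0)` part of the fraction field of the
  homogeneous coordinate ring `Cox/(g)`, i.e. the subalgebra generated by ratios of
  bihomogeneous elements of equal bidegree;
* rationality: `K(X)` is `K`-isomorphic to a purely transcendental extension of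
  `K` (i.e. `X` is birational to a projective space);
* stable rationality: `K(X)(x_1,…,x_r) ≅_K K(y_1,…,y_s)` for some `r,s`
  (i.e. `X × ℙ^r` is birational to a projective space);
* normality: the local rings of the relevant locus of the affine cone are
  integrally closed (the punctured cone is a smooth torsor over `X`);
* terminal singularities: rendered as `X` normal with singular locus of
  codimension at least 3, which is the form terminality takes for the general
  members appearing in the paper;
* ℚ-factoriality together with `ρ(X) = 2` (i.e. the divisor class group of `X` is
  spanned up to torsion by the fibre class `F` and the tautological class `D`):
  rendered by requiring every relevant bihomogeneous height-one prime `P` of the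
  coordinate ring of `X` to contain a bihomogeneous element lying in no other such
  prime (so that `div(f) = k·P` and `[P] ∈ ℚ⟨F, D⟩`);
* ampleness of `𝒪_X(α,β)`: some multiple is very ample, rendered by requiring the
  bihomogeneous sections of that multiple to be base point free, to separate
  points, and to separate tangent vectors (modulo the torus directions) on the
  cone over `X`;
* `π`-ampleness of `-K_X`: by adjunction `-K_X = 𝒪_X(e,1)` with
  `e = n + Σ w - deg g`, and relative ampleness over the projective base means
  some twist `𝒪_X(e+N,1)` by pullback classes from `ℙ^{n-1}` is ample;
* connectedness of the fibres of `π : X → ℙ^{n-1}`: no fibre admits a disjoint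
  covering by two zero sets of families of weighted-homogeneous polynomials, each
  meeting the fibre (i.e. Zariski-connectedness of the fibres), and all fibres are
  nonempty;
* a conic bundle (Mori fibre space of relative dimension one, Definition 2.5 of
  the paper): `X` is irreducible (the ideal of `g` is prime), normal, has only
  terminal singularities, `π` has connected fibres, `-K_X` is `π`-ample, and
  `ρ(X) = 2`; all in the above renderings.
-/

open MvPolynomial

set_option maxHeartbeats 1600000
set_option synthInstance.maxHeartbeats 400000

namespace ConicBundleFormalization

noncomputable section

variable (K : Type) [Field K]

/-! ### The Cox ring and bihomogeneity -/

/-- The Cox ring of an `(m-1)`-dimensional weighted-projective-space bundle over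
`ℙ^{n-1}`: variables `u_i` (`i : Fin n`) of bidegree `(1,0)` and fibre variables
`x_j` (`j : Fin m`) of bidegree `(w j, a j)`. -/
abbrev Cox (n m : ℕ) : Type := MvPolynomial (Fin n ⊕ Fin m) K

/-- `p` is bihomogeneous of bidegree `(α, β)` for the grading `deg u_i = (1,0)`,
`deg x_j = (w j, a j)`. -/
def IsBihom (n m : ℕ) (w : Fin m → ℤ) (a : Fin m → ℕ) (α : ℤ) (β : ℕ)
    (p : Cox K n m) : Prop :=
  ∀ e ∈ p.support,
    ((∑ i : Fin n, (e (Sum.inl i) : ℤ)) + ∑ j : Fin m, (e (Sum.inr j) : ℤ) * w j = α) ∧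
    ((∑ j : Fin m, e (Sum.inr j) * a j) = β)

/-- A polynomial in `u_0, …, u_{n-1}` is homogeneous of degree `d ∈ ℤ`
(for `d < 0` this forces `p = 0`). -/
def IsHomogZ (n : ℕ) (d : ℤ) (p : MvPolynomial (Fin n) K) : Prop :=
  ∀ e ∈ p.support, (∑ i : Fin n, (e i : ℤ)) = d

/-- A polynomial in the fibre variables is weighted-homogeneous of degree `e` for
the weights `a`. -/
def IsWHom (m : ℕ) (a : Fin m → ℕ) (e : ℕ) (q : MvPolynomial (Fin m) K) : Prop :=
  ∀ ex ∈ q.support, (∑ j : Fin m, ex j * a j) = e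

/-! ### Genericity: general and very general members of a linear system -/

/-- Evaluation of a polynomial `D` in the coefficients of `p`; such `D` are the
polynomial functions on the parameter space of the linear system. -/
def evalCoeff {n m : ℕ} (p : Cox K n m)
    (D : MvPolynomial ((Fin n ⊕ Fin m) →₀ ℕ) K) : K :=
  MvPolynomial.eval (fun e => p.coeff e) D

/-- `Pred` holds for a *general* member of the complete linear system of
bihomogeneous polynomials of bidegree `(α,β)`: it holds on a nonempty principal
Zariski-open subset of the parameter space. -/
def GenerallyHolds (n m : ℕ) (w : Fin m → ℤ) (a : Fin m → ℕ) (α : ℤ) (β : ℕ)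
    (Pred : Cox K n m → Prop) : Prop :=
  ∃ D : MvPolynomial ((Fin n ⊕ Fin m) →₀ ℕ) K,
    (∃ p₀, IsBihom K n m w a α β p₀ ∧ evalCoeff K p₀ D ≠ 0) ∧
    ∀ p, IsBihom K n m w a α β p → evalCoeff K p D ≠ 0 → Pred p

/-- `Pred` holds for a *very general* member of the complete linear system of
bihomogeneous polynomials of bidegree `(α,β)`: it holds away from countably many
proper Zariski-closed subsets of the parameter space. -/
def VeryGenerallyHolds (n m : ℕ) (w : Fin m → ℤ) (a : Fin m → ℕ) (α : ℤ) (β : ℕ)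
    (Pred : Cox K n m → Prop) : Prop :=
  ∃ D : ℕ → MvPolynomial ((Fin n ⊕ Fin m) →₀ ℕ) K,
    (∀ i, ∃ p₀, IsBihom K n m w a α β p₀ ∧ evalCoeff K p₀ (D i) ≠ 0) ∧
    ∀ p, IsBihom K n m w a α β p → (∀ i, evalCoeff K p (D i) ≠ 0) → Pred p

/-- Evaluation of a polynomial `D` in the coefficients of a quadruple
`(a,b,c,f)` of polynomials in `u_0,…,u_{n-1}`. -/
def evalCoeff4 {n : ℕ} (abcf : Fin 4 → MvPolynomial (Fin n) K)
    (D : MvPolynomial (Fin 4 × (Fin n →₀ ℕ)) K) : K :=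
  MvPolynomial.eval (fun q => (abcf q.1).coeff q.2) D

/-- `Pred` holds for a *general* quadruple `(a,b,c,f)` of homogeneous polynomials
in `u_0,…,u_{n-1}` of respective degrees `degs 0, …, degs 3`. -/
def GenerallyHolds4 (n : ℕ) (degs : Fin 4 → ℤ)
    (Pred : (Fin 4 → MvPolynomial (Fin n) K) → Prop) : Prop :=
  ∃ D : MvPolynomial (Fin 4 × (Fin n →₀ ℕ)) K,
    (∃ abcf : Fin 4 → MvPolynomial (Fin n) K,
      (∀ i, IsHomogZ K n (degs i) (abcf i)) ∧ evalCoeff4 K abcf D ≠ 0) ∧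
    ∀ abcf : Fin 4 → MvPolynomial (Fin n) K,
      (∀ i, IsHomogZ K n (degs i) (abcf i)) → evalCoeff4 K abcf D ≠ 0 → Pred abcf

/-! ### Points of the bundle: the punctured affine cone and the torus action -/

/-- A point of the affine cone `𝔸^n × 𝔸^m` over the bundle. -/
abbrev Pt (n m : ℕ) : Type := (Fin n → K) × (Fin m → K)

/-- Evaluation of a Cox ring element at a point of the affine cone. -/
def evalPt {n m : ℕ} (p : Pt K n m) (f : Cox K n m) : K :=
  MvPolynomial.eval (Sum.elim p.1 p.2) f

/-- Membership in the complement of the irrelevant locus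
`V(u_0,…,u_{n-1}) ∪ V(x_0,…,x_{m-1})`. -/
def InCone {n m : ℕ} (p : Pt K n m) : Prop := p.1 ≠ 0 ∧ p.2 ≠ 0

/-- Equivalence of two cone points under the action of the torus `𝔾_m²`:
`(s,t)·(u,x) = (s·u_i, s^{w j} t^{a j}·x_j)`.  The points of the bundle are the
equivalence classes of points of the punctured cone. -/
def ToricEq {n m : ℕ} (w : Fin m → ℤ) (a : Fin m → ℕ) (p q : Pt K n m) : Prop :=
  ∃ s t : Kˣ, (∀ i, q.1 i = (s : K) * p.1 i) ∧
    (∀ j, q.2 j = ((s ^ (w j) : Kˣ) : K) * (t : K) ^ (a j) * p.2 j)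

/-- The punctured affine cone over the member `X = {g = 0}`. -/
def XCone {n m : ℕ} (g : Cox K n m) : Set (Pt K n m) :=
  {p | InCone K p ∧ evalPt K p g = 0}

/-! ### Smoothness via the Jacobian criterion on the cone -/

/-- The hypersurface `{g = 0}` is smooth along (the image of) `S ⊆ 𝔸^n × 𝔸^m`: at
every point of `S` lying on the cone over `X` some partial derivative of `g` is
nonzero.  On loci where the torus acts freely this is the Jacobian criterion for
smoothness of `X` itself. -/
def JacobiSmoothOn {n m : ℕ} (g : Cox K n m) (S : Set (Pt K n m)) : Prop :=
  ∀ p ∈ S, evalPt K p g = 0 → ∃ v : Fin n ⊕ Fin m, evalPt K p (pderiv v g) ≠ 0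

/-- The member `X = {g = 0}` of the linear system is smooth (nonsingular). -/
def IsSmoothModel {n m : ℕ} (g : Cox K n m) : Prop :=
  JacobiSmoothOn K g {p | InCone K p}

/-! ### The function field, rationality, and stable rationality -/

/-- The homogeneous coordinate ring `Cox/(g)` of the member `X = {g = 0}`,
i.e. the coordinate ring of the affine cone over `X`. -/
abbrev coneRing {n m : ℕ} (g : Cox K n m) : Type :=
  Cox K n m ⧸ Ideal.span {g}

/-- The total fraction ring of the affine cone over `X`; the function field of the
cone when `g` is prime. -/
def FracCone {n m : ℕ} (g : Cox K n m) : Type := FractionRing (coneRing K g)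

instance {n m : ℕ} (g : Cox K n m) : CommRing (FracCone K g) :=
  inferInstanceAs (CommRing (FractionRing (coneRing K g)))

instance {n m : ℕ} (g : Cox K n m) : Algebra K (FracCone K g) :=
  inferInstanceAs (Algebra K (FractionRing (coneRing K g)))

instance {n m : ℕ} (g : Cox K n m) : Algebra (coneRing K g) (FracCone K g) :=
  inferInstanceAs (Algebra (coneRing K g) (FractionRing (coneRing K g)))

/-- The canonical map from the Cox ring to the fraction ring of the cone over `X`. -/
def toFrac {n m : ℕ} (g : Cox K n m) : Cox K n m →+* FracCone K g :=
  (algebraMap (coneRing K g) (FracCone K g)).comp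
    (Ideal.Quotient.mk (Ideal.span {g}))

/-- The set of degree-`(0,0)` fractions on the cone over `X`: ratios `p/q` of
bihomogeneous elements of equal bidegree (phrased multiplicatively, avoiding
inverses). -/
def ratioSet {n m : ℕ} (w : Fin m → ℤ) (a : Fin m → ℕ) (g : Cox K n m) :
    Set (FracCone K g) :=
  {φ | ∃ (α : ℤ) (β : ℕ) (p q : Cox K n m),
    IsBihom K n m w a α β p ∧ IsBihom K n m w a α β q ∧
    toFrac K g q ≠ 0 ∧ φ * toFrac K g q = toFrac K g p}

/-- The `K`-algebra of rational functions on `X = {g = 0}`: the fractions of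
degree `(0,0)`.  When `g` is prime this is the function field `K(X)`. -/
def functionFieldModel {n m : ℕ} (w : Fin m → ℤ) (a : Fin m → ℕ) (g : Cox K n m) :
    Subalgebra K (FracCone K g) :=
  Algebra.adjoin K (ratioSet K w a g)

/-- `X = {g = 0}` is rational: its function field is `K`-isomorphic to a purely
transcendental extension `K(y_1,…,y_N)` of `K`, i.e. `X` is birational to a
projective space. -/
def IsRationalModel {n m : ℕ} (w : Fin m → ℤ) (a : Fin m → ℕ) (g : Cox K n m) :
    Prop :=
  ∃ N : ℕ, Nonempty
    (functionFieldModel K w a g ≃ₐ[K] FractionRing (MvPolynomial (Fin N) K))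

/-- `X = {g = 0}` is stably rational: `X × ℙ^r` is birational to a projective
space for some `r`, i.e. `K(X)(x_1,…,x_r) ≅_K K(y_1,…,y_s)` for some `r, s`. -/
def IsStablyRationalModel {n m : ℕ} (w : Fin m → ℤ) (a : Fin m → ℕ)
    (g : Cox K n m) : Prop :=
  ∃ r s : ℕ, Nonempty
    ((FractionRing (MvPolynomial (Fin r) (functionFieldModel K w a g)))
      ≃ₐ[K] FractionRing (MvPolynomial (Fin s) K))

/-! ### Normality, terminal singularities, class group, ampleness, fibres -/

/-- A prime of the Cox ring is *relevant* if it does not contain either component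
of the irrelevant ideal `(u_0,…,u_{n-1}) ∩ (x_0,…,x_{m-1})`. -/
def RelevantPrime {n m : ℕ} (P : Ideal (Cox K n m)) : Prop :=
  (∃ i, X (Sum.inl i) ∉ P) ∧ (∃ j, X (Sum.inr j) ∉ P)

/-- `X = {g = 0}` is normal: the local rings of the relevant locus of its affine
cone are integrally closed (the punctured cone is a smooth torsor over `X`, so
this is normality of `X`). -/
def IsNormalModel {n m : ℕ} (g : Cox K n m) : Prop :=
  ∀ P : PrimeSpectrum (coneRing K g),
    ((∃ i, Ideal.Quotient.mk (Ideal.span {g}) (X (Sum.inl i)) ∉ P.asIdeal) ∧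
     (∃ j, Ideal.Quotient.mk (Ideal.span {g}) (X (Sum.inr j)) ∉ P.asIdeal)) →
    IsIntegrallyClosed (Localization.AtPrime P.asIdeal)

/-- The singular locus of `X = {g = 0}` has codimension at least `c`: every
relevant prime of the Cox ring containing `g` and all its partial derivatives has
height at least `c + 1` (the height in the cone exceeds the codimension in `X`
by one). -/
def SingularLocusCodimAtLeast {n m : ℕ} (g : Cox K n m) (c : ℕ) : Prop :=
  ∀ P : PrimeSpectrum (Cox K n m), RelevantPrime K P.asIdeal →
    g ∈ P.asIdeal → (∀ v : Fin n ⊕ Fin m, pderiv v g ∈ P.asIdeal) →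
    ((c + 1 : ℕ) : WithBot (WithTop ℕ)) ≤ ringKrullDim (Localization.AtPrime P.asIdeal)

/-- Rendering of "`X` has only terminal singularities" for the members considered
in the paper: `X` is normal and its singular locus has codimension at least 3
(cf. the proof of Lemma 2.8, where the general members with `2m > d > l+m` have
ordinary double points along a nonsingular center of codimension 3). -/
def HasOnlyTerminalSingularitiesModel {n m : ℕ} (g : Cox K n m) : Prop :=
  IsNormalModel K g ∧ SingularLocusCodimAtLeast K g 3

/-- An ideal of the Cox ring is bihomogeneous if it is generated by its
bihomogeneous elements. -/
def IsBihomIdeal {n m : ℕ} (w : Fin m → ℤ) (a : Fin m → ℕ)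
    (P : Ideal (Cox K n m)) : Prop :=
  P ≤ Ideal.span {f | f ∈ P ∧ ∃ α β, IsBihom K n m w a α β f}

/-- A prime divisor of `X = {g = 0}`: a relevant bihomogeneous prime of the Cox
ring containing `g` of height 2 (height 1 over `(g)`). -/
def IsPrimeDivisorOn {n m : ℕ} (w : Fin m → ℤ) (a : Fin m → ℕ) (g : Cox K n m)
    (P : PrimeSpectrum (Cox K n m)) : Prop :=
  g ∈ P.asIdeal ∧ RelevantPrime K P.asIdeal ∧ IsBihomIdeal K w a P.asIdeal ∧
    ringKrullDim (Localization.AtPrime P.asIdeal) = (2 : WithBot (WithTop ℕ))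

/-- Rendering of "`X` is ℚ-factorial with `ρ(X) = 2`", i.e. the divisor class
group of `X` is spanned up to torsion by the pullback `F` of the hyperplane class
and the tautological class `D`: every prime divisor `P` of `X` carries a
bihomogeneous form `f` vanishing on `P` and on no other prime divisor, so that
`div(f) = k·P` for some `k ≥ 1` and hence `[P] ∈ ℚ⟨F,D⟩` in `Cl(X) ⊗ ℚ`. -/
def ClassGroupSpannedByFD {n m : ℕ} (w : Fin m → ℤ) (a : Fin m → ℕ)
    (g : Cox K n m) : Prop :=
  ∀ P : PrimeSpectrum (Cox K n m), IsPrimeDivisorOn K w a g P →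
    ∃ (α : ℤ) (β : ℕ) (f : Cox K n m),
      f ∉ Ideal.span {g} ∧ IsBihom K n m w a α β f ∧ f ∈ P.asIdeal ∧
      ∀ Q : PrimeSpectrum (Cox K n m), IsPrimeDivisorOn K w a g Q → Q ≠ P →
        f ∉ Q.asIdeal

/-- Rendering of "`ρ(X) ≥ 3`": the divisor class group of `X` is not spanned up to
torsion by the fibre class `F` and the tautological class `D`. -/
def PicardRankAtLeastThree {n m : ℕ} (w : Fin m → ℤ) (a : Fin m → ℕ)
    (g : Cox K n m) : Prop :=
  ¬ ClassGroupSpannedByFD K w a g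

/-- The cone over the fibre of `π : X → ℙ^{n-1}` over the point `[u] ∈ ℙ^{n-1}`. -/
def fibreCone {n m : ℕ} (g : Cox K n m) (u : Fin n → K) : Set (Fin m → K) :=
  {v | v ≠ 0 ∧ evalPt K (u, v) g = 0}

/-- The fibres of `π : X → ℙ^{n-1}` are nonempty and connected: no fibre can be
covered by two disjoint nonempty closed subsets, closed subsets of the fibre
being cut out by weighted-homogeneous polynomials in the fibre variables. -/
def FibresNonemptyAndConnected {n m : ℕ} (a : Fin m → ℕ) (g : Cox K n m) : Prop :=
  ∀ u : Fin n → K, u ≠ 0 →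
    (fibreCone K g u).Nonempty ∧
    ∀ A B : Set (MvPolynomial (Fin m) K),
      (∀ q ∈ A ∪ B, ∃ e, IsWHom K m a e q) →
      (∀ v ∈ fibreCone K g u,
        (∀ q ∈ A, MvPolynomial.eval v q = 0) ∨ (∀ q ∈ B, MvPolynomial.eval v q = 0)) →
      (∀ v ∈ fibreCone K g u,
        ¬ ((∀ q ∈ A, MvPolynomial.eval v q = 0) ∧ (∀ q ∈ B, MvPolynomial.eval v q = 0))) →
      ¬ ((∃ v ∈ fibreCone K g u, ∀ q ∈ A, MvPolynomial.eval v q = 0) ∧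
         (∃ v ∈ fibreCone K g u, ∀ q ∈ B, MvPolynomial.eval v q = 0))

/-- The infinitesimal generator of the first torus factor at a cone point. -/
def orbitVec₁ {n m : ℕ} (w : Fin m → ℤ) (p : Pt K n m) : (Fin n ⊕ Fin m) → K :=
  Sum.elim (fun i => p.1 i) (fun j => (w j : K) * p.2 j)

/-- The infinitesimal generator of the second torus factor at a cone point. -/
def orbitVec₂ {n m : ℕ} (a : Fin m → ℕ) (p : Pt K n m) : (Fin n ⊕ Fin m) → K :=
  Sum.elim (fun _ => 0) (fun j => (a j : K) * p.2 j)

/-- The bihomogeneous forms of bidegree `(α,β)` have no base point on `X`. -/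
def BasePointFreeOnX {n m : ℕ} (w : Fin m → ℤ) (a : Fin m → ℕ) (g : Cox K n m)
    (α : ℤ) (β : ℕ) : Prop :=
  ∀ p ∈ XCone K g, ∃ s, IsBihom K n m w a α β s ∧ evalPt K p s ≠ 0

/-- The bihomogeneous forms of bidegree `(α,β)` separate the points of `X`. -/
def SeparatesPointsOnX {n m : ℕ} (w : Fin m → ℤ) (a : Fin m → ℕ) (g : Cox K n m)
    (α : ℤ) (β : ℕ) : Prop :=
  ∀ p ∈ XCone K g, ∀ q ∈ XCone K g, ¬ ToricEq K w a p q →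
    ∃ s₁ s₂, IsBihom K n m w a α β s₁ ∧ IsBihom K n m w a α β s₂ ∧
      evalPt K p s₁ * evalPt K q s₂ ≠ evalPt K q s₁ * evalPt K p s₂

/-- The bihomogeneous forms of bidegree `(α,β)` separate the tangent vectors of
`X`: for every cone point `p` of `X` and every tangent vector `t` of the cone over
`X` at `p` not tangent to the torus orbit, some form vanishing at `p` has nonzero
derivative along `t`. -/
def SeparatesTangentsOnX {n m : ℕ} (w : Fin m → ℤ) (a : Fin m → ℕ) (g : Cox K n m)
    (α : ℤ) (β : ℕ) : Prop :=
  ∀ p ∈ XCone K g, ∀ t : (Fin n ⊕ Fin m) → K,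
    (∑ v : Fin n ⊕ Fin m, t v * evalPt K p (pderiv v g)) = 0 →
    t ∉ Submodule.span K {orbitVec₁ K w p, orbitVec₂ K a p} →
    ∃ s, IsBihom K n m w a α β s ∧ evalPt K p s = 0 ∧
      (∑ v : Fin n ⊕ Fin m, t v * evalPt K p (pderiv v s)) ≠ 0

/-- The class `𝒪_X(α,β)` is ample on `X = {g = 0}`: some positive multiple is very
ample, i.e. its forms are base point free on `X` and separate points and tangent
vectors. -/
def IsAmpleClassOnX {n m : ℕ} (w : Fin m → ℤ) (a : Fin m → ℕ) (g : Cox K n m)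
    (α : ℤ) (β : ℕ) : Prop :=
  ∃ t : ℕ, 0 < t ∧
    BasePointFreeOnX K w a g (t * α) (t * β) ∧
    SeparatesPointsOnX K w a g (t * α) (t * β) ∧
    SeparatesTangentsOnX K w a g (t * α) (t * β)

/-- The canonical class of the ambient bundle `P`, by the toric formula
`K_P = -Σ deg(variables)`. -/
def ambientCanonicalClass (n m : ℕ) (w : Fin m → ℤ) : ℤ × ℤ :=
  (-(n : ℤ) - ∑ j : Fin m, w j, -(m : ℤ))

/-- The anticanonical class `-K_X = -(K_P + X)|_X` of a member `X ∈ |𝒪_P(α,β)|`,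
by adjunction. -/
def memberAntiCanonicalClass (n m : ℕ) (w : Fin m → ℤ) (α : ℤ) (β : ℕ) : ℤ × ℤ :=
  (-((ambientCanonicalClass n m w).1 + α), -((ambientCanonicalClass n m w).2 + β))

/-- `-K_X` is `π`-ample for the projection `π : X → ℙ^{n-1}`: some twist of `-K_X`
by the pullback of a (sufficiently ample) divisor on the base is ample. -/
def AntiCanonicalIsRelativelyAmple {n m : ℕ} (w : Fin m → ℤ) (a : Fin m → ℕ)
    (g : Cox K n m) (α : ℤ) (β : ℕ) : Prop :=
  ∃ N : ℤ,
    IsAmpleClassOnX K w a g ((memberAntiCanonicalClass n m w α β).1 + N)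
      (memberAntiCanonicalClass n m w α β).2.toNat

/-- Rendering of Definition 2.5 of the paper: the projection
`π : X → ℙ^{n-1}` of the member `X = {g = 0} ∈ |𝒪_P(d,2)|` of the `ℙ²`-bundle
`P = P_n(w 0, w 1, w 2)` over `ℙ^{n-1}` is a *conic bundle*, i.e. a Mori fibre
space of relative dimension one: `X` is an (irreducible, normal, projective)
variety with only terminal singularities, `π` has connected fibres, `-K_X` is
`π`-ample, and `X` is ℚ-factorial of Picard rank `ρ(X) = 2`.  (Being embedded in
`|𝒪_P(d,2)|` of a projectivized split rank-3 bundle, this is an *embedded* conic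
bundle in the sense of Definition 2.6.) -/
structure IsConicBundleModel (n : ℕ) (w : Fin 3 → ℤ) (d : ℤ) (g : Cox K n 3) :
    Prop where
  bihom : IsBihom K n 3 w (fun _ => 1) d 2 g
  integral : (Ideal.span {g} : Ideal (Cox K n 3)).IsPrime
  normal : IsNormalModel K g
  terminal : HasOnlyTerminalSingularitiesModel K g
  connectedFibres : FibresNonemptyAndConnected K (fun _ => 1) g
  antiCanonicalRelAmple :
    AntiCanonicalIsRelativelyAmple K w (fun _ => 1) g d 2
  picardRankTwo : ClassGroupSpannedByFD K w (fun _ => 1) g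

/-! ### The discriminant of a conic bundle -/

/-- The coefficient of the monomial `x^e` (in the fibre variables) of `g`, as a
polynomial on the base. -/
def fibreCoeff {n m : ℕ} (g : Cox K n m) (e : Fin m →₀ ℕ) :
    MvPolynomial (Fin n) K :=
  ((MvPolynomial.sumAlgEquiv K (Fin m) (Fin n))
    (MvPolynomial.rename Sum.swap g)).coeff e

/-- The symmetric matrix of the fibrewise quadratic form of a member
`X = {g = 0} ∈ |𝒪_P(d,2)|` (over a field of characteristic zero). -/
def quadraticMatrix {n : ℕ} (g : Cox K n 3) :
    Matrix (Fin 3) (Fin 3) (MvPolynomial (Fin n) K) :=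
  fun i j =>
    if i = j then fibreCoeff K g (Finsupp.single i 2)
    else MvPolynomial.C ((2 : K)⁻¹) *
      fibreCoeff K g (Finsupp.single i 1 + Finsupp.single j 1)

/-- The equation of the discriminant divisor `Δ ⊂ ℙ^{n-1}` of the conic bundle
`π : X → ℙ^{n-1}`, `X = {g = 0}`: the determinant of the associated symmetric
matrix. -/
def discriminantPoly {n : ℕ} (g : Cox K n 3) : MvPolynomial (Fin n) K :=
  (quadraticMatrix K g).det

/-- The complete linear system `|k·K_{ℙ^{n-1}} + Δ|` is nonempty, where `Δ` is the
discriminant divisor of the conic bundle `X = {g = 0}`: the divisor class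
`𝒪(deg Δ - k·n)` on `ℙ^{n-1}` contains an effective divisor. -/
def KMultipleplusDiscriminantEffective {n : ℕ} (g : Cox K n 3) (k : ℕ) : Prop :=
  discriminantPoly K g ≠ 0 ∧
    ∃ h : MvPolynomial (Fin n) K, h ≠ 0 ∧
      IsHomogZ K n (((discriminantPoly K g).totalDegree : ℤ) - k * n) h

/-- `π : X → ℙ^{n-1}` is flat, i.e. no fibre is two-dimensional: `g` does not
vanish identically on any fibre of the ambient bundle.  Together with smoothness
of `X` this renders a *standard* conic bundle. -/
def ProjectionIsFlat {n m : ℕ} (g : Cox K n m) : Prop :=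
  ∀ u : Fin n → K, u ≠ 0 → ∃ v : Fin m → K, evalPt K (u, v) g ≠ 0

end

end ConicBundleFormalization

namespace ConicBundleFormalization

noncomputable section

variable (K : Type) [Field K]

/-! ### The special members `a x² + b y² + c z² + f x y` and the associated double
cover data in characteristic 2 -/

/-- The special member `X = {a x² + b y² + c z² + f x y = 0}` of
`|𝒪_P(λ+μ+ν, 2)|`, `P = P_n(λ,μ,ν)`, built from a quadruple `(a,b,c,f)` of
polynomials on the base (equation (3.1) of the paper). -/
def specialMemberX {n : ℕ} (abcf : Fin 4 → MvPolynomial (Fin n) K) : Cox K n 3 :=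
  rename Sum.inl (abcf 0) * X (Sum.inr 0) ^ 2 +
  rename Sum.inl (abcf 1) * X (Sum.inr 1) ^ 2 +
  rename Sum.inl (abcf 2) * X (Sum.inr 2) ^ 2 +
  rename Sum.inl (abcf 3) * X (Sum.inr 0) * X (Sum.inr 1)

/-- The hypersurface `Z = {a x² + b y² + c z̄ + f x y = 0}` in the
`ℙ(1,1,2)`-bundle `R` over `ℙ^{n-1}` (with `z̄` the third fibre variable, of
weight 2), the image of `X` under the purely inseparable double cover `P → R` in
characteristic 2. -/
def specialMemberZ {n : ℕ} (abcf : Fin 4 → MvPolynomial (Fin n) K) : Cox K n 3 :=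
  rename Sum.inl (abcf 0) * X (Sum.inr 0) ^ 2 +
  rename Sum.inl (abcf 1) * X (Sum.inr 1) ^ 2 +
  rename Sum.inl (abcf 2) * X (Sum.inr 2) +
  rename Sum.inl (abcf 3) * X (Sum.inr 0) * X (Sum.inr 1)

/-! ### Admissible critical points (Definition 3.5 of the paper) -/

/-- A polynomial `F` in `N` variables over a field of characteristic 2 is in
*admissible normal form* at the origin: its linear part vanishes (a critical
point) and, up to an additive constant and higher-order terms,
`F = α + x₀x₁ + x₂x₃ + ⋯ + x_{N-2}x_{N-1}` if `N` is even, and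
`F = α + βx₀² + x₁x₂ + ⋯ + x_{N-2}x_{N-1} + (nonzero)·x₀³ + ⋯` if `N` is odd. -/
def AdmissibleNormalForm {N : ℕ} (F : MvPolynomial (Fin N) K) : Prop :=
  (∀ i, F.coeff (Finsupp.single i 1) = 0) ∧
  (N % 2 = 0 →
    (∀ i, F.coeff (Finsupp.single i 2) = 0) ∧
    (∀ i j : Fin N, (i : ℕ) < (j : ℕ) →
      F.coeff (Finsupp.single i 1 + Finsupp.single j 1) =
        (if (i : ℕ) % 2 = 0 ∧ (j : ℕ) = (i : ℕ) + 1 then 1 else 0))) ∧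
  (N % 2 = 1 →
    (∀ i : Fin N, (i : ℕ) ≠ 0 → F.coeff (Finsupp.single i 2) = 0) ∧
    (∀ i j : Fin N, (i : ℕ) < (j : ℕ) →
      F.coeff (Finsupp.single i 1 + Finsupp.single j 1) =
        (if (i : ℕ) % 2 = 1 ∧ (j : ℕ) = (i : ℕ) + 1 then 1 else 0)) ∧
    (∀ h0 : 0 < N, F.coeff (Finsupp.single (⟨0, h0⟩ : Fin N) 3) ≠ 0))

/-- A local function `F` (a polynomial in the local coordinates indexed by `ι`,
centred at the origin) has an *admissible critical point* at the origin: after a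
suitable (linear) change of coordinates it is in admissible normal form. -/
def AdmissibleLocalFunction {ι : Type} [Fintype ι] (F : MvPolynomial ι K) : Prop :=
  ∃ (N : ℕ) (e : ι ≃ Fin N) (T : Matrix (Fin N) (Fin N) K), IsUnit T.det ∧
    AdmissibleNormalForm K
      ((aeval (fun i : ι => ∑ j : Fin N, MvPolynomial.C (T (e i) j) * X j)) F)

/-- The local expression of the section `z̄` of `𝓛²` on the chart `x = 1` of `Z`
(multiplied by the square unit `c̃²`, i.e. computed with respect to the local
generator `c̃·ξ` of `𝓛`): the polynomial `c·(a + b·y² + f·y)` in the base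
variables and the remaining fibre variable `y`. -/
def chartPolyX {n : ℕ} (abcf : Fin 4 → MvPolynomial (Fin n) K) :
    MvPolynomial (Fin n ⊕ Fin 1) K :=
  rename Sum.inl (abcf 2) *
    (rename Sum.inl (abcf 0) + rename Sum.inl (abcf 1) * X (Sum.inr 0) ^ 2 +
      rename Sum.inl (abcf 3) * X (Sum.inr 0))

/-- The local expression of the section `z̄` on the chart `y = 1` of `Z`:
the polynomial `c·(a·x² + b + f·x)`. -/
def chartPolyY {n : ℕ} (abcf : Fin 4 → MvPolynomial (Fin n) K) :
    MvPolynomial (Fin n ⊕ Fin 1) K :=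
  rename Sum.inl (abcf 2) *
    (rename Sum.inl (abcf 0) * X (Sum.inr 0) ^ 2 + rename Sum.inl (abcf 1) +
      rename Sum.inl (abcf 3) * X (Sum.inr 0))

/-- Translation of a chart polynomial to local coordinates centred at the point
with base coordinates `u0` (normalized by `u0 i0 = 1`) and fibre coordinate `y0`:
substitute `u_{i0} ↦ 1`, `u_j ↦ u_j + u0 j` and `y ↦ y + y0`.  The variables are
the genuine local coordinates `{u_j : j ≠ i0} ∪ {y}` of `Z` at that point. -/
def localAt {n : ℕ} (i0 : Fin n) (u0 : Fin n → K) (y0 : K)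
    (G : MvPolynomial (Fin n ⊕ Fin 1) K) :
    MvPolynomial ({ j : Fin n // j ≠ i0 } ⊕ Fin 1) K :=
  aeval (Sum.elim
    (fun j => if h : j = i0 then 1 else X (Sum.inl ⟨j, h⟩) + MvPolynomial.C (u0 j))
    (fun _ => X (Sum.inr 0) + MvPolynomial.C y0)) G

/-- The section `z̄` of `𝓛²` on `Z = {gZ = 0}` has a *critical point* at the point
below the normalized cone point `p` (with `u_{i0} = 1` and the fibre coordinate
`jfix ∈ {x, y}` normalized to 1): the differential of `z̄` vanishes on the tangent
space of `Z` at that point, i.e. every chart tangent vector `t` of `Z` has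
vanishing `z̄`-component. -/
def CriticalPointOfZbar {n : ℕ} (gZ : Cox K n 3) (i0 : Fin n) (jfix : Fin 3)
    (p : Pt K n 3) : Prop :=
  ∀ t : (Fin n ⊕ Fin 3) → K, t (Sum.inl i0) = 0 → t (Sum.inr jfix) = 0 →
    (∑ v : Fin n ⊕ Fin 3, t v * evalPt K p (pderiv v gZ)) = 0 →
    t (Sum.inr 2) = 0

/-- `p` is a singular point of the cone over `X = {g = 0}`. -/
def SingularConePoint {n m : ℕ} (g : Cox K n m) (p : Pt K n m) : Prop :=
  p ∈ XCone K g ∧ ∀ v : Fin n ⊕ Fin m, evalPt K p (pderiv v g) = 0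

end

end ConicBundleFormalization

namespace CBProof

section PartI
set_option linter.unusedSectionVars false
variable {R : Type*} [CommRing R] [IsDomain R] {n : ℕ}

theorem wr_abstract {p : R} (hp : p ≠ 0) (N M : Matrix (Fin n) (Fin n) R) (m : Fin n → ℕ)
    (c δ : Fin n → R) (h : ∀ i j, p * N i j = p ^ m i * (p * M i j + c i * δ j)) :
    p ^ (∑ i, m i) ∣ p * N.det := by
  set A : Matrix (Fin n) (Fin n) R := Matrix.of fun i j => p * M i j + c i * δ j with hA
  have h1 : p ^ n * N.det = p ^ (∑ i, m i) * A.det := by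
    have e1 : (Matrix.of fun i j => p * N i j).det = p ^ n * N.det := by
      have := Matrix.det_mul_column (fun _ : Fin n => p) N
      simpa using this
    have e2 : (Matrix.of fun i j => p ^ m i * A i j).det = p ^ (∑ i, m i) * A.det := by
      have := Matrix.det_mul_column (fun i : Fin n => p ^ m i) A
      rw [Finset.prod_pow_eq_pow_sum] at this
      simpa using this
    rw [← e1, ← e2]
    congr 1
    ext i j
    simp [hA, h]
  set Z : Matrix (Fin n ⊕ Unit) (Fin n ⊕ Unit) R :=
    Matrix.fromBlocks M (Matrix.of fun i _ => c i) (Matrix.of fun _ j => - δ j)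
      (Matrix.of fun _ _ => p) with hZ
  set Y : Matrix (Fin n ⊕ Unit) (Fin n ⊕ Unit) R :=
    Matrix.fromBlocks (p • 1) 0 (Matrix.of fun _ j => δ j) 1 with hY
  have h2 : Z * Y = Matrix.fromBlocks A (Matrix.of fun i _ => c i) 0 (Matrix.of fun _ _ => p) := by
    rw [hZ, hY, Matrix.fromBlocks_multiply]
    congr 1
    · ext i j
      simp [hA, Matrix.mul_apply]
    · simp
    · ext i j
      simp [Matrix.mul_apply]
    · simp
  have h3 : Z.det * p ^ n = A.det * p := by
    have := congrArg Matrix.det h2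
    rw [Matrix.det_mul, hY, Matrix.det_fromBlocks_zero₁₂, Matrix.det_fromBlocks_zero₂₁] at this
    simpa using this
  refine ⟨Z.det, mul_left_cancel₀ (pow_ne_zero n hp) ?_⟩
  calc p ^ n * (p * N.det) = p * (p ^ n * N.det) := by ring
    _ = p ^ (∑ i, m i) * (A.det * p) := by rw [h1]; ring
    _ = _ := by rw [← h3]; ring

/-- The condition linking the extra exponent and the derivations. -/
def LOK (D : Fin n → Derivation ℤ R R) (p : R) (l : ℕ) : Prop :=
  l = 0 ∨ (l = 1 ∧ ∀ j, D j p = 0)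

theorem wr_rows {p : R} (hp : p ≠ 0) (D : Fin n → Derivation ℤ R R) (ε : Fin n → R) (l : ℕ)
    (hl : LOK D p l) (ρ : Fin n → R) (h : Fin n → R) (m : Fin n → ℕ)
    (hm : ∀ i, p ^ m i ∣ h i) :
    p ^ (∑ i, m i + l) ∣ p * (Matrix.of fun i j => D j (h i) + ρ i * ε j * h i).det := by
  choose h' hh' using hm
  rcases hl with rfl | ⟨rfl, hD⟩
  · refine wr_abstract hp _ (Matrix.of fun i j => D j (h' i) + ρ i * ε j * h' i) m
      (fun i => m i * h' i) (fun j => D j p) ?_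
    intro i j
    simp only [Matrix.of_apply]
    rw [hh' i, Derivation.leibniz, Derivation.leibniz_pow]
    simp only [smul_eq_mul, nsmul_eq_mul]
    rcases Nat.eq_zero_or_pos (m i) with h0 | h0
    · simp [h0]
    · obtain ⟨k, hk⟩ : ∃ k, m i = k + 1 := ⟨m i - 1, by omega⟩
      rw [hk]; simp only [Nat.add_sub_cancel]; push_cast; ring
  · have e : (Matrix.of fun i j => D j (h i) + ρ i * ε j * h i).det =
        p ^ (∑ i, m i) * (Matrix.of fun i j => D j (h' i) + ρ i * ε j * h' i).det := by
      have := Matrix.det_mul_column (fun i : Fin n => p ^ m i)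
        (Matrix.of fun i j => D j (h' i) + ρ i * ε j * h' i)
      rw [Finset.prod_pow_eq_pow_sum] at this
      rw [← this]
      congr 1
      ext i j
      simp only [Matrix.of_apply]
      rw [hh' i, Derivation.leibniz, Derivation.leibniz_pow, hD]
      simp only [smul_eq_mul, nsmul_eq_mul, mul_zero, add_zero]
      ring
    rw [e, pow_succ]
    exact ⟨(Matrix.of fun i j => D j (h' i) + ρ i * ε j * h' i).det, by ring⟩

/-- The Wronskian-like determinant. -/
def Wmat (D : Fin n → Derivation ℤ R R) (ε : Fin n → R) (u : Fin n → R) :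
    Matrix (Fin n) (Fin n) R := Matrix.of fun i j => D j (u i) + ε j * u i

/-- The term property. -/
def HT (D : Fin n → Derivation ℤ R R) (ε : Fin n → R) (u : Fin n → R) (h : R) (w : Fin n → R)
    : Prop :=
  ∃ C : Fin n → R, (∀ i, u i * C i = w i * h) ∧
    ∀ j, D j h + (∑ i, w i) * ε j * h = ∑ i, C i * Wmat D ε u i j

variable {D : Fin n → Derivation ℤ R R} {ε u : Fin n → R}

theorem HT.mul {h h' : R} {w w' : Fin n → R} (H : HT D ε u h w) (H' : HT D ε u h' w') :
    HT D ε u (h * h') (w + w') := by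
  obtain ⟨C, hC, hD⟩ := H
  obtain ⟨C', hC', hD'⟩ := H'
  refine ⟨fun i => h' * C i + h * C' i, fun i => ?_, fun j => ?_⟩
  · simp only [Pi.add_apply]; linear_combination h' * hC i + h * hC' i
  · simp only [Pi.add_apply, Finset.sum_add_distrib, add_mul, Derivation.leibniz, smul_eq_mul]
    have : ∑ x, h' * C x * Wmat D ε u x j + ∑ x, h * C' x * Wmat D ε u x j =
       h' * ∑ x, C x * Wmat D ε u x j + h * ∑ x, C' x * Wmat D ε u x j := by
      simp only [Finset.mul_sum, mul_assoc]
    rw [this, ← hD, ← hD']; ring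

theorem HT.var (k : Fin n) : HT D ε u (u k) (Pi.single k 1) := by
  refine ⟨Pi.single k 1, fun i => ?_, fun j => ?_⟩
  · rcases eq_or_ne i k with rfl | h <;> simp [*]
  · simp [Pi.single_apply, Wmat]

theorem HT.sq [CharP R 2] (A : R) : HT D ε u (A ^ 2) 0 := by
  refine ⟨0, fun i => by simp, fun j => ?_⟩
  have : (2 : R) = 0 := by exact_mod_cast CharP.cast_eq_zero R 2
  simp [Derivation.leibniz_pow, this]

theorem HT.one : HT D ε u 1 0 :=
  ⟨0, fun i => by simp, fun j => by simp⟩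

theorem HT.pow {h : R} {w : Fin n → R} (H : HT D ε u h w) (k : ℕ) :
    HT D ε u (h ^ k) (fun i => k * w i) := by
  induction k with
  | zero => convert HT.one (D := D) (ε := ε) (u := u) using 1 <;> first | (ext i; simp) | simp
  | succ k ih =>
    rw [pow_succ]
    convert ih.mul H using 1
    ext i; simp; ring

theorem HT.prod (s : Finset (Fin n)) (E : Fin n → ℕ) :
    HT D ε u (∏ i ∈ s, u i ^ E i) (fun i => if i ∈ s then (E i : R) else 0) := by
  classical
  induction s using Finset.induction_on with
  | empty => convert HT.one (D := D) (ε := ε) (u := u) using 1 <;> first | (ext i; simp) | simp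
  | insert a s ha ih =>
    rw [Finset.prod_insert ha]
    convert ((HT.var (D := D) (ε := ε) (u := u) a).pow (E a)).mul ih using 1
    ext i
    rcases eq_or_ne i a with rfl | h <;> simp [*]

theorem HT.term [CharP R 2] (E : Fin n → ℕ) (A : R) :
    HT D ε u ((∏ i, u i ^ E i) * A ^ 2) (fun i => (E i : R)) := by
  convert (HT.prod Finset.univ E).mul (HT.sq (D := D) (ε := ε) (u := u) A) using 1
  ext i; simp

theorem ind_lemma [CharP R 2] {p : R} (hp : Prime p) {m : Fin n → ℕ} {l : ℕ} (hl : LOK D p l)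
    (hm : ∀ i, emultiplicity p (u i) = m i)
    (hW : ¬ p ^ (∑ i, m i + l) ∣ (Wmat D ε u).det) {ι : Type*} (E : ι → Fin n → ℕ) (A : ι → R)
    (ρ : R) :
    ∀ (k : ℕ) (S : Finset ι), S.card = k →
    (∀ I ∈ S, ∀ J ∈ S, I ≠ J → ∃ i, E I i % 2 ≠ E J i % 2) →
    (∀ I ∈ S, ∑ i, (E I i : R) = ρ) → 
    ∀ K ∈ S, emultiplicity p (∑ I ∈ S, (∏ i, u i ^ E I i) * A I ^ 2) ≤
      emultiplicity p ((∏ i, u i ^ E K i) * A K ^ 2) := by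
  classical
  intro k
  induction k using Nat.strong_induction_on with
  | _ k IH =>
  intro S hS hdist hpar
  set f : ι → R := fun I => (∏ i, u i ^ E I i) * A I ^ 2 with hf
  change ∀ K ∈ S, emultiplicity p (∑ I ∈ S, f I) ≤ emultiplicity p (f K)
  by_contra hcon
  push Not at hcon
  obtain ⟨K0, hK0, hlt0⟩ := hcon
  obtain ⟨K, hK, hKmin⟩ := Finset.exists_min_image S (fun I => emultiplicity p (f I)) ⟨K0, hK0⟩
  have hlt : emultiplicity p (f K) < emultiplicity p (∑ I ∈ S, f I) :=
    lt_of_le_of_lt (hKmin K0 hK0) hlt0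
  have hfin : emultiplicity p (f K) ≠ ⊤ := ne_top_of_lt hlt
  obtain ⟨Λ, hΛ⟩ : ∃ Λ : ℕ, emultiplicity p (f K) = Λ :=
    ⟨(emultiplicity p (f K)).toNat, by rw [ENat.natCast_toNat hfin]⟩
  set S' := S.filter (fun I => emultiplicity p (f I) = Λ) with hS'
  have hsumdvd : p ^ (Λ + 1) ∣ ∑ I ∈ S, f I := by
    apply pow_dvd_of_le_emultiplicity
    rw [hΛ] at hlt
    exact_mod_cast Order.add_one_le_of_lt hlt
  have hrest : p ^ (Λ + 1) ∣ ∑ I ∈ S.filter (fun I => ¬ emultiplicity p (f I) = Λ), f I := by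
    apply Finset.dvd_sum
    intro I hI
    rw [Finset.mem_filter] at hI
    apply pow_dvd_of_le_emultiplicity
    have h1 : (Λ : ℕ∞) < emultiplicity p (f I) :=
      lt_of_le_of_ne (hΛ ▸ hKmin I hI.1) (Ne.symm hI.2)
    exact_mod_cast Order.add_one_le_of_lt h1
  have hS'dvd : p ^ (Λ + 1) ∣ ∑ I ∈ S', f I := by
    rw [← Finset.sum_filter_add_sum_filter_not S (fun I => emultiplicity p (f I) = Λ)] at hsumdvd
    exact (dvd_add_left hrest).1 hsumdvd
  have hKS' : K ∈ S' := by simp [hS', hK, hΛ]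
  have key : ¬ p ^ (Λ + 1) ∣ f K := by
    intro h
    have := le_emultiplicity_of_pow_dvd h
    rw [hΛ] at this
    norm_cast at this
    omega
  have hSS : S' = S := by
    by_contra hne
    have hss : S' ⊂ S := lt_of_le_of_ne (Finset.filter_subset _ _) hne
    have := IH S'.card (hS ▸ Finset.card_lt_card hss) S' rfl
      (fun I hI J hJ => hdist I (hss.1 hI) J (hss.1 hJ)) (fun I hI => hpar I (hss.1 hI)) K hKS'
    exact key (pow_dvd_of_le_emultiplicity ((le_emultiplicity_of_pow_dvd hS'dvd).trans this))
  have hall : ∀ I ∈ S, emultiplicity p (f I) = Λ := by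
    intro I hI
    rw [← hSS, hS', Finset.mem_filter] at hI
    exact hI.2
  -- a second element
  obtain ⟨J, hJ, hJK⟩ : ∃ J ∈ S, J ≠ K := by
    by_contra hno
    push Not at hno
    have : S = {K} := by ext I; constructor
                         · intro h; simp [hno I h]
                         · intro h; simp at h; rw [h]; exact hK
    rw [this] at hsumdvd
    simp at hsumdvd
    exact key hsumdvd
  obtain ⟨i0, hi0⟩ := hdist J hJ K hK hJK
  set T := S.filter (fun I => E I i0 % 2 = 1) with hT
  have hTS : T ⊂ S := by
    refine lt_of_le_of_ne (Finset.filter_subset _ _) ?_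
    intro h
    have h1 : J ∈ T := h ▸ hJ
    have h2 : K ∈ T := h ▸ hK
    rw [hT, Finset.mem_filter] at h1 h2
    omega
  obtain ⟨I1, hI1⟩ : T.Nonempty := by
    rcases Nat.mod_two_eq_zero_or_one (E J i0) with h | h
    · exact ⟨K, by rw [hT, Finset.mem_filter]; exact ⟨hK, by omega⟩⟩
    · exact ⟨J, by rw [hT, Finset.mem_filter]; exact ⟨hJ, by omega⟩⟩
  have hTle := IH T.card (hS ▸ Finset.card_lt_card hTS) T rfl
      (fun I hI J hJ => hdist I (hTS.1 hI) J (hTS.1 hJ)) (fun I hI => hpar I (hTS.1 hI)) I1 hI1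
  change emultiplicity p (∑ I ∈ T, f I) ≤ emultiplicity p (f I1) at hTle
  rw [hall I1 (hTS.1 hI1)] at hTle
  -- assemble
  choose C hC hDC using fun I => HT.term (D := D) (ε := ε) (u := u) (E I) (A I)
  set B := ∑ I ∈ S, f I with hB
  set CC : Fin n → R := fun i => ∑ I ∈ S, C I i with hCC
  have hrow : ∀ j, D j B + ρ * ε j * B = ∑ i, CC i * Wmat D ε u i j := by
    intro j
    have : ∀ I ∈ S, D j (f I) + ρ * ε j * f I = ∑ i, C I i * Wmat D ε u i j := by
      intro I hI
      rw [← hDC I j, hpar I hI]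
    rw [hB, map_sum, Finset.mul_sum, ← Finset.sum_add_distrib, Finset.sum_congr rfl this,
      Finset.sum_comm]
    simp [hCC, Finset.sum_mul]
  have h2 : (2 : R) = 0 := by exact_mod_cast CharP.cast_eq_zero R 2
  have hCi : u i0 * CC i0 = ∑ I ∈ T, f I := by
    rw [hCC, Finset.mul_sum, hT, Finset.sum_filter]
    refine Finset.sum_congr rfl fun I _ => ?_
    rw [hC I i0]
    rcases Nat.mod_two_eq_zero_or_one (E I i0) with h | h
    · have : (E I i0 : R) = 0 := by
        rw [← Nat.div_add_mod (E I i0) 2, h]; push_cast; rw [h2]; ring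
      simp [h, this]
    · have : (E I i0 : R) = 1 := by
        rw [← Nat.div_add_mod (E I i0) 2, h]; push_cast; rw [h2]; ring
      simp [h, this, hf]
  set h : Fin n → R := Function.update u i0 B with hh
  set ρ' : Fin n → R := Function.update 1 i0 ρ with hρ'
  set m' : Fin n → ℕ := Function.update m i0 (Λ + 1) with hm'
  have hdet : (Matrix.of fun i j => D j (h i) + ρ' i * ε j * h i).det =
      CC i0 * (Wmat D ε u).det := by
    have e := Matrix.det_updateRow_sum (Wmat D ε u) i0 CC
    rw [smul_eq_mul] at e
    rw [← e]
    congr 1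
    ext i j
    rcases eq_or_ne i i0 with rfl | hne
    · simp [hh, hρ', hrow, Matrix.updateRow_self, Finset.sum_apply]
    · simp [hh, hρ', hne, Wmat]
  have hwr := wr_rows hp.ne_zero D ε l hl ρ' h m' (by
    intro i
    rcases eq_or_ne i i0 with rfl | hne
    · simpa [hh, hm'] using hsumdvd
    · simp only [hh, hm', Function.update_of_ne hne]
      exact pow_dvd_of_le_emultiplicity (hm i).ge)
  rw [hdet] at hwr
  -- multiply by u i0
  have hsum : ∑ i, m' i + m i0 = ∑ i, m i + (Λ + 1) := by
    rw [hm', Finset.sum_update_of_mem (Finset.mem_univ i0)]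
    rw [← Finset.add_sum_erase Finset.univ m (Finset.mem_univ i0), Finset.sdiff_singleton_eq_erase]
    omega
  have hfinal : p ^ (∑ i, m i + (Λ + 1) + l) ∣ p * ((∑ I ∈ T, f I) * (Wmat D ε u).det) := by
    have e : p * ((∑ I ∈ T, f I) * (Wmat D ε u).det) =
      (p * (CC i0 * (Wmat D ε u).det)) * u i0 := by rw [← hCi]; ring
    rw [e, ← hsum, show ∑ i, m' i + m i0 + l = (∑ i, m' i + l) + m i0 by omega, pow_add]
    exact mul_dvd_mul hwr (pow_dvd_of_le_emultiplicity (hm i0).ge)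
  have hTfin : FiniteMultiplicity p (∑ I ∈ T, f I) := by
    rw [finiteMultiplicity_iff_emultiplicity_ne_top]
    exact ne_top_of_le_ne_top (ENat.natCast_ne_top Λ) hTle
  obtain ⟨b, hb, hbp⟩ := hTfin.exists_eq_pow_mul_and_not_dvd
  set Λ' := multiplicity p (∑ I ∈ T, f I) with hΛ'
  have hΛle : Λ' ≤ Λ := by
    rw [hTfin.emultiplicity_eq_multiplicity] at hTle
    exact_mod_cast hTle
  rw [hb] at hfinal
  have h4 : p ^ (Λ' + 1) * p ^ (∑ i, m i + l) ∣ p ^ (Λ' + 1) * (b * (Wmat D ε u).det) := by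
    refine dvd_trans ?_ (hfinal.trans (dvd_of_eq (by ring)))
    rw [← pow_add]
    exact pow_dvd_pow _ (by omega)
  exact hW (hp.pow_dvd_of_dvd_mul_left _ hbp
    ((mul_dvd_mul_iff_left (pow_ne_zero _ hp.ne_zero)).1 h4))

end PartI
end CBProof

namespace CBProof

/-- Exponent data of the special conic bundle. -/
structure GData (n : ℕ) where
  α : Fin n → ℕ
  β : Fin n → ℕ
  γ : Fin n → ℕ
  κ : Fin n → ℕ
  r' : ℕ
  r : ℕ
  hlt : ∀ i, α i + β i < 2 * κ i
  hsum : 2 * ∑ i, κ i = ∑ i, α i + ∑ i, β i + 2 * (r' + r)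
  hαβ : ∃ i, α i % 2 ≠ β i % 2
  hαγ : ∃ i, α i % 2 ≠ γ i % 2
  hβγ : ∃ i, β i % 2 ≠ γ i % 2
  pβ : (∑ i, β i) % 2 = (∑ i, α i) % 2
  pγ : (∑ i, γ i) % 2 = (∑ i, α i) % 2

/-- Sum of even powers. -/
def Pf {R : Type*} [CommRing R] {n : ℕ} (r : ℕ) (u : Fin n → R) : R :=
  if r = 0 then 1 else ∑ i, u i ^ (2 * r)

/-- Sum of powers. -/
def sf {R : Type*} [CommRing R] {n : ℕ} (r : ℕ) (u : Fin n → R) : R :=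
  if r = 0 then 1 else ∑ i, u i ^ r

/-- The special equation. -/
def Gev {R : Type*} [CommRing R] {n : ℕ} (G : GData n) (u : Fin n → R) (x y z : R) : R :=
  (∏ i, u i ^ G.α i) * Pf G.r' u * x ^ 2 + (∏ i, u i ^ G.β i) * Pf G.r u * y ^ 2 +
  (∏ i, u i ^ G.γ i) * z ^ 2 + (∏ i, u i ^ G.κ i) * x * y

theorem map_Pf {R S : Type*} [CommRing R] [CommRing S] {n : ℕ} (φ : R →+* S) (r : ℕ)
    (u : Fin n → R) : φ (Pf r u) = Pf r (fun i => φ (u i)) := by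
  unfold Pf; split_ifs <;> simp

theorem map_Gev {R S : Type*} [CommRing R] [CommRing S] {n : ℕ} (φ : R →+* S) (G : GData n)
    (u : Fin n → R) (x y z : R) :
    φ (Gev G u x y z) = Gev G (fun i => φ (u i)) (φ x) (φ y) (φ z) := by
  simp [Gev, map_Pf]

theorem Pf_eq {R : Type*} [CommRing R] [CharP R 2] {n : ℕ} (r : ℕ) (u : Fin n → R) :
    Pf r u = sf r u ^ 2 := by
  unfold Pf sf
  split_ifs
  · simp
  · haveI : Fact (Nat.Prime 2) := ⟨Nat.prime_two⟩
    rw [sum_pow_char 2]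
    refine Finset.sum_congr rfl fun i _ => ?_
    rw [← pow_mul, mul_comm]

section
set_option linter.unusedSectionVars false
variable {R : Type*} [CommRing R] [IsDomain R] [CharP R 2] {n : ℕ}
variable {D : Fin n → Derivation ℤ R R} {ε u : Fin n → R}

theorem cast_par {a b : ℕ} (h : a % 2 = b % 2) : (a : R) = b := by
  have h2 : (2 : R) = 0 := by exact_mod_cast CharP.cast_eq_zero R 2
  rw [← Nat.div_add_mod a 2, ← Nat.div_add_mod b 2, h]; push_cast; rw [h2]; ring

theorem sf_le {p : R} (hp : Prime p) {m : Fin n → ℕ} {l : ℕ} (hl : LOK D p l)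
    (hm : ∀ i, emultiplicity p (u i) = m i)
    (hW : ¬ p ^ (∑ i, m i + l) ∣ (Wmat D ε u).det) (r : ℕ) :
    ∀ i, emultiplicity p (sf r u) ≤ (r * m i : ℕ) := by
  induction r using Nat.strong_induction_on with
  | _ r IH =>
  intro i
  rcases Nat.eq_zero_or_pos r with h0 | h0
  · subst h0
    simp only [sf, if_true]
    rw [emultiplicity_of_one_right hp.not_isUnit]; simp
  rcases Nat.even_or_odd' r with ⟨q, hq | hq⟩
  · have : sf r u = sf q u ^ 2 := by
      rw [← Pf_eq, Pf, sf, if_neg (by omega), if_neg (by omega), hq]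
    rw [this, emultiplicity_pow hp]
    have := IH q (by omega) i
    calc _ ≤ ((2 : ℕ) : ℕ∞) * ((q * m i : ℕ) : ℕ∞) := by gcongr
      _ = _ := by rw [hq]; norm_cast; ring
  · have key := ind_lemma hp hl hm hW (fun k : Fin n => (Pi.single k 1 : Fin n → ℕ))
      (fun k => u k ^ q) 1 _ Finset.univ rfl (by
        intro I _ J _ hIJ
        refine ⟨I, ?_⟩
        simp [Pi.single_apply, hIJ]) (by
        intro I _
        simp [Pi.single_apply]) i (Finset.mem_univ i)
    have e : ∀ k, (∏ i, u i ^ (Pi.single k 1 : Fin n → ℕ) i) * (u k ^ q) ^ 2 = u k ^ r := by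
      intro k
      have : (∏ i, u i ^ (Pi.single k 1 : Fin n → ℕ) i) = u k := by
        rw [Finset.prod_eq_single k]
        · simp
        · intro b _ hb; simp [Pi.single_apply, hb]
        · simp
      rw [this, ← pow_mul, hq]; ring
    simp only [e] at key
    rw [sf, if_neg (by omega)]
    refine key.trans ?_
    rw [emultiplicity_pow hp, hm]; norm_cast

theorem emul_prod {p : R} (hp : Prime p) {m : Fin n → ℕ}
    (hm : ∀ i, emultiplicity p (u i) = m i) (E : Fin n → ℕ) :
    emultiplicity p (∏ i, u i ^ E i) = (∑ i, E i * m i : ℕ) := by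
  rw [Finset.emultiplicity_prod hp]
  push_cast
  refine Finset.sum_congr rfl fun i _ => ?_
  rw [emultiplicity_pow hp, hm]

theorem star2 (G : GData n) {p : R} (hp : Prime p) (hfin : ∀ a : R, a ≠ 0 → FiniteMultiplicity p a)
    {m : Fin n → ℕ} {l : ℕ} (hl : LOK D p l)
    (hm : ∀ i, emultiplicity p (u i) = m i)
    (hW : ¬ p ^ (∑ i, m i + l) ∣ (Wmat D ε u).det)
    {x y z : R} (hG : Gev G u x y z = 0) (hne : ¬ (x = 0 ∧ y = 0 ∧ z = 0)) :
    ∀ i j, m i = m j := by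
  have hu : ∀ i, u i ≠ 0 := by
    intro i h
    have := hm i
    rw [h, emultiplicity_zero] at this
    exact ENat.top_ne_natCast _ this
  have hfz : ∀ (E : Fin n → ℕ), (∏ i, u i ^ E i) ≠ 0 := fun E =>
    Finset.prod_ne_zero_iff.2 fun i _ => pow_ne_zero _ (hu i)
  have hs : ∀ r, (0 < n) → sf r u ≠ 0 := by
    intro r hn h
    have := sf_le hp hl hm hW r ⟨0, hn⟩
    rw [h, emultiplicity_zero, top_le_iff] at this
    exact ENat.natCast_ne_top _ this
  intro i j
  have hn : 0 < n := i.pos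
  set Q : R := (∏ i, u i ^ G.κ i) * x * y with hQ
  set E : Fin 3 → Fin n → ℕ := ![G.α, G.β, G.γ] with hE
  set A : Fin 3 → R := ![sf G.r' u * x, sf G.r u * y, z] with hA
  have hsum : ∑ I : Fin 3, (∏ i, u i ^ E I i) * A I ^ 2 = Q := by
    rw [Fin.sum_univ_three]
    simp only [hE, hA, Matrix.cons_val]
    rw [Gev, Pf_eq, Pf_eq] at hG
    have : CharP R 2 := inferInstance
    have h2 : (2 : R) = 0 := by exact_mod_cast CharP.cast_eq_zero R 2
    rw [hQ]
    linear_combination hG - (∏ i, u i ^ G.κ i) * x * y * h2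
  have hpar : ∀ I ∈ (Finset.univ : Finset (Fin 3)), ∑ i, (E I i : R) = ((∑ i, G.α i : ℕ) : R) := by
    intro I _
    rw [← Nat.cast_sum]
    fin_cases I
    · rfl
    · exact cast_par G.pβ
    · exact cast_par G.pγ
  have hdist : ∀ I ∈ (Finset.univ : Finset (Fin 3)), ∀ J ∈ (Finset.univ : Finset (Fin 3)),
      I ≠ J → ∃ i, E I i % 2 ≠ E J i % 2 := by
    intro I _ J _ hIJ
    obtain ⟨a, ha⟩ := G.hαβ
    obtain ⟨b, hb⟩ := G.hαγ
    obtain ⟨c, hc⟩ := G.hβγ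
    fin_cases I <;> fin_cases J <;> first | exact absurd rfl hIJ | skip
    · exact ⟨a, ha⟩
    · exact ⟨b, hb⟩
    · exact ⟨a, ha.symm⟩
    · exact ⟨c, hc⟩
    · exact ⟨b, hb.symm⟩
    · exact ⟨c, hc.symm⟩
  have key := ind_lemma hp hl hm hW E A _ _ Finset.univ rfl hdist hpar
  rw [hsum] at key
  by_cases hxy : x = 0 ∨ y = 0
  · exfalso
    have hQ0 : Q = 0 := by rcases hxy with h | h <;> simp [hQ, h]
    have hz : ∀ I : Fin 3, A I = 0 := by
      intro I
      have := key I (Finset.mem_univ I)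
      rw [hQ0, emultiplicity_zero, top_le_iff] at this
      by_contra hne
      exact finiteMultiplicity_iff_emultiplicity_ne_top.1
        (hfin _ (mul_ne_zero (hfz _) (pow_ne_zero 2 hne))) this
    refine hne ⟨?_, ?_, hz 2⟩
    · exact (mul_eq_zero.1 (hz 0)).resolve_left (hs _ hn)
    · exact (mul_eq_zero.1 (hz 1)).resolve_left (hs _ hn)
  push Not at hxy
  obtain ⟨vx, hvx⟩ : ∃ k : ℕ, emultiplicity p x = k := ⟨_, (hfin x hxy.1).emultiplicity_eq_multiplicity⟩
  obtain ⟨vy, hvy⟩ : ∃ k : ℕ, emultiplicity p y = k := ⟨_, (hfin y hxy.2).emultiplicity_eq_multiplicity⟩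
  obtain ⟨s', hs'⟩ : ∃ k : ℕ, emultiplicity p (sf G.r' u) = k :=
    ⟨_, (hfin _ (hs _ hn)).emultiplicity_eq_multiplicity⟩
  obtain ⟨s, hs⟩ : ∃ k : ℕ, emultiplicity p (sf G.r u) = k :=
    ⟨_, (hfin _ (hs _ hn)).emultiplicity_eq_multiplicity⟩
  have k0 := key 0 (Finset.mem_univ _)
  have k1 := key 1 (Finset.mem_univ _)
  simp only [hE, hA, Matrix.cons_val, hQ] at k0 k1
  rw [emultiplicity_mul hp, emultiplicity_mul hp, emultiplicity_mul hp, emultiplicity_pow hp,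
    emultiplicity_mul hp, emul_prod hp hm, emul_prod hp hm, hvx, hvy, hs'] at k0
  rw [emultiplicity_mul hp, emultiplicity_mul hp, emultiplicity_mul hp, emultiplicity_pow hp,
    emultiplicity_mul hp, emul_prod hp hm, emul_prod hp hm, hvx, hvy, hs] at k1
  norm_cast at k0 k1
  obtain ⟨i1, -, hi1⟩ := Finset.exists_min_image Finset.univ m ⟨i, Finset.mem_univ i⟩
  have l0 := sf_le hp hl hm hW G.r' i1
  have l1 := sf_le hp hl hm hW G.r i1
  rw [hs'] at l0
  rw [hs] at l1
  norm_cast at l0 l1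
  have tot : ∑ i, (2 * G.κ i - G.α i - G.β i : ℤ) * ((m i : ℤ) - m i1) ≤ 0 := by
    have e1 : ∑ i, (2 * G.κ i - G.α i - G.β i : ℤ) * ((m i : ℤ) - m i1) =
      2 * ∑ i, (G.κ i * m i : ℤ) - ∑ i, (G.α i * m i : ℤ) - ∑ i, (G.β i * m i : ℤ) -
      (2 * ∑ i, (G.κ i : ℤ) - ∑ i, (G.α i : ℤ) - ∑ i, (G.β i : ℤ)) * m i1 := by
      simp only [Finset.mul_sum, ← Finset.sum_sub_distrib, Finset.sum_mul]
      exact Finset.sum_congr rfl fun _ _ => by ring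
    have e2 : (2 * ∑ i, (G.κ i : ℤ) - ∑ i, (G.α i : ℤ) - ∑ i, (G.β i : ℤ)) = 2 * (G.r' + G.r) := by
      have := G.hsum
      zify at this
      linarith
    rw [e1, e2]
    zify at k0 k1 l0 l1
    nlinarith
  have hall : ∀ j, m j = m i1 := by
    intro j
    have nn : ∀ k ∈ Finset.univ, 0 ≤ (2 * G.κ k - G.α k - G.β k : ℤ) * ((m k : ℤ) - m i1) := by
      intro k _
      have h1 := hi1 k (Finset.mem_univ k)
      have h2 := G.hlt k
      apply mul_nonneg <;> omega
    have h3 := (Finset.sum_eq_zero_iff_of_nonneg nn).1 (le_antisymm tot (Finset.sum_nonneg nn)) j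
      (Finset.mem_univ j)
    have h2 := G.hlt j
    rcases mul_eq_zero.1 h3 with h | h <;> omega
  rw [hall i, hall j]

end
end CBProof

namespace CBProof

theorem exists_poly_deriv {F : Type*} [CommRing F] (d : Derivation ℤ F F) :
    ∃ D' : Derivation ℤ (Polynomial F) (Polynomial F),
      ∀ p k, (D' p).coeff k = d (p.coeff k) := by
  refine ⟨(PolynomialModule.equivPolynomialSelf (R := F)).toLinearMap.compDer d.mapCoeffs, ?_⟩
  intro p k
  rfl

theorem Wmat_smul_det {R : Type*} [CommRing R] [IsDomain R] {n : ℕ}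
    {D : Fin n → Derivation ℤ R R} (i0 : Fin n) (hD : D i0 = 0) (u : Fin n → R) {a : R}
    (ha : a ≠ 0) :
    (Wmat D (Pi.single i0 1) (fun i => a * u i)).det =
      a ^ n * (Wmat D (Pi.single i0 1) u).det := by
  set ε : Fin n → R := Pi.single i0 1
  set v : Fin n → R := fun j => if j = i0 then 1 else a with hv
  have hv0 : ∏ j, v j ≠ 0 := Finset.prod_ne_zero_iff.2 fun j _ => by
    simp only [hv]; split_ifs
    · exact one_ne_zero
    · exact ha
  apply mul_left_cancel₀ hv0
  have e1 := Matrix.det_mul_row v (Wmat D ε (fun i => a * u i))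
  have e2 : (Matrix.of fun i j => v j * (Matrix.of fun i j => a * Wmat D ε u i j) i j).det = 
     (∏ j, v j) * (a ^ n * (Wmat D ε u).det) := by
    rw [Matrix.det_mul_row]
    congr 1
    have := Matrix.det_mul_row (fun _ : Fin n => a) (Wmat D ε u)
    simpa using this
  rw [← e1, ← e2, ← Matrix.det_transpose]
  conv_rhs => rw [← Matrix.det_transpose]
  refine Matrix.det_eq_of_forall_row_eq_smul_add_const (fun j => D j a) i0 (by simp [hD]) ?_
  intro j i
  simp only [Matrix.transpose_apply, Matrix.of_apply, Wmat, ε, hv]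
  rcases eq_or_ne j i0 with rfl | hj
  · simp [hD, Derivation.leibniz]
  · simp [hD, hj, Derivation.leibniz, Pi.single_apply]
    ring

theorem edge_lemma {F : Type*} [Field F] [CharP F 2] {n : ℕ} (G : GData n)
    (d : Fin n → Derivation ℤ F F) (i0 : Fin n) (hd : d i0 = 0) (e : ℕ)
    (u : Fin n → Polynomial F) (hu : ∀ i, (u i).natDegree ≤ e)
    (hT : (Wmat d (Pi.single i0 1) (fun i => (u i).coeff e)).det ≠ 0)
    (x y z : Polynomial F) (hne : ¬ (x = 0 ∧ y = 0 ∧ z = 0)) (hG : Gev G u x y z = 0) :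
    ∃ m, (∀ i, ∀ k < m, (u i).coeff k = 0) ∧
      (Wmat d (Pi.single i0 1) (fun i => (u i).coeff m)).det ≠ 0 := by
  have hn : 0 < n := i0.pos
  choose D hDc using fun j => exists_poly_deriv (d j)
  have hD0 : D i0 = 0 := by
    ext p k
    simp [hDc, hd]
  set ε : Fin n → Polynomial F := Pi.single i0 1 with hε
  have hεC : ∀ j, ε j = Polynomial.C ((Pi.single i0 1 : Fin n → F) j) := by
    intro j
    rcases eq_or_ne j i0 with rfl | hj
    · simp [hε]
    · simp [hε, hj]
  have hcoef : ∀ (v : Fin n → Polynomial F) (i j : Fin n) (k : ℕ), (Wmat D ε v i j).coeff k =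
      Wmat d (Pi.single i0 1) (fun i => (v i).coeff k) i j := by
    intro v i j k
    simp only [Wmat, Matrix.of_apply, Polynomial.coeff_add, hεC, Polynomial.coeff_C_mul]
    congr 1
    exact hDc _ _ _
  -- top coefficients are nonzero
  have hTne : ∀ i, (u i).coeff e ≠ 0 := by
    intro i h
    apply hT
    apply Matrix.det_eq_zero_of_row_eq_zero i
    intro j
    simp [Wmat, h]
  have hune : ∀ i, u i ≠ 0 := fun i h => hTne i (by simp [h])
  have hdeg : ∀ i, (u i).natDegree = e := fun i =>
    le_antisymm (hu i) (Polynomial.le_natDegree_of_ne_zero (hTne i))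
  set W := (Wmat D ε u).det with hW
  have hWdeg : ∀ i j, (Wmat D ε u i j).natDegree ≤ e := by
    intro i j
    rw [Polynomial.natDegree_le_iff_coeff_eq_zero]
    intro N hN
    rw [hcoef]
    have : (u i).coeff N = 0 := Polynomial.coeff_eq_zero_of_natDegree_lt (lt_of_le_of_lt (hu i) hN)
    simp [Wmat, this]
  have hWc : W.coeff (n * e) = (Wmat d (Pi.single i0 1) (fun i => (u i).coeff e)).det := by
    rw [hW, Matrix.det_apply, Matrix.det_apply, Polynomial.finsetSum_coeff]
    refine Finset.sum_congr rfl fun σ _ => ?_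
    rw [Polynomial.coeff_smul]
    congr 1
    have := Polynomial.coeff_prod_of_natDegree_le (s := Finset.univ)
      (fun i => Wmat D ε u (σ i) i) e (fun i _ => hWdeg _ _)
    simp only [Finset.card_univ, Fintype.card_fin] at this
    rw [this]
    exact Finset.prod_congr rfl fun i _ => hcoef _ _ _ _
  have hWne : W ≠ 0 := fun h => hT (by rw [← hWc, h]; simp)
  have hWnat : W.natDegree ≤ n * e := by
    rw [hW, Matrix.det_apply]
    refine Polynomial.natDegree_sum_le_of_forall_le _ _ fun σ _ => ?_
    refine (Polynomial.natDegree_smul_le _ _).trans ?_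
    refine (Polynomial.natDegree_prod_le _ _).trans ?_
    refine (Finset.sum_le_sum fun i _ => hWdeg (σ i) i).trans ?_
    simp
  have hfin : ∀ p : Polynomial F, Prime p → ∀ a, a ≠ 0 → FiniteMultiplicity p a :=
    fun p hp a ha => FiniteMultiplicity.of_not_isUnit hp.not_isUnit ha
  have hPne : ∏ i, u i ≠ 0 := Finset.prod_ne_zero_iff.2 fun i _ => hune i
  have hpm : ∀ p : Polynomial F, Prime p → ∀ i, emultiplicity p (u i) = multiplicity p (u i) :=
    fun p hp i => (hfin p hp _ (hune i)).emultiplicity_eq_multiplicity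
  have hprod : ∀ p : Polynomial F, Prime p →
      emultiplicity p (∏ i, u i) = (∑ i, multiplicity p (u i) : ℕ) := by
    intro p hp
    rw [Finset.emultiplicity_prod hp]
    push_cast
    exact Finset.sum_congr rfl fun i _ => hpm p hp i
  have hdvd : ∏ i, u i ∣ W := by
    rw [UniqueFactorizationMonoid.dvd_iff_emultiplicity_le hPne]
    intro p hp
    rw [hprod p hp]
    apply le_emultiplicity_of_pow_dvd
    by_contra hnd
    have hall := star2 (D := D) (ε := ε) (l := 0) G hp (hfin p hp) (Or.inl rfl) (hpm p hp)
      (by simpa using hnd) hG hne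
    set m := multiplicity p (u i0)
    have hdv : ∀ i, p ^ m ∣ u i := by
      intro i
      have : m = multiplicity p (u i) := hall i0 i
      rw [this]; exact pow_multiplicity_dvd _ _
    choose u' hu' using hdv
    have hs : ∑ i, multiplicity p (u i) = m * n := by
      rw [Finset.sum_congr rfl fun i _ => hall i i0]
      simp [m, mul_comm]
    apply hnd
    rw [hs, hW, show u = fun i => p ^ m * u' i from funext hu', hε,
      Wmat_smul_det i0 hD0 u' (pow_ne_zero _ hp.ne_zero), ← pow_mul]
    exact Dvd.intro _ rfl
  obtain ⟨q, hq⟩ := hdvd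
  have hq0 : q ≠ 0 := by rintro rfl; exact hWne (by simp [hq])
  have hPdeg : (∏ i, u i).natDegree = n * e := by
    rw [Polynomial.natDegree_prod _ _ fun i _ => hune i]
    simp [hdeg]
  have hqdeg : q.natDegree = 0 := by
    rw [hq, Polynomial.natDegree_mul hPne hq0, hPdeg] at hWnat
    omega
  obtain ⟨c, rfl⟩ : ∃ c, q = Polynomial.C c := ⟨_, Polynomial.eq_C_of_natDegree_eq_zero hqdeg⟩
  have hc : c ≠ 0 := by rintro rfl; simp at hq0
  have hX : Prime (Polynomial.X : Polynomial F) := Polynomial.prime_X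
  have hCnd : ¬ Polynomial.X ∣ Polynomial.C c := by
    rw [Polynomial.X_dvd_iff]; simpa using hc
  have hDX : ∀ j, D j Polynomial.X = 0 := by
    intro j
    ext k
    rw [hDc, Polynomial.coeff_X]
    split_ifs <;> simp
  have hall := star2 (D := D) (ε := ε) (l := 1) G hX (hfin _ hX) (Or.inr ⟨rfl, hDX⟩) (hpm _ hX)
    (by
      rw [← hW, hq]
      intro h
      have h1 := le_emultiplicity_of_pow_dvd h
      rw [emultiplicity_mul hX, hprod _ hX, emultiplicity_eq_zero.2 hCnd, add_zero] at h1
      norm_cast at h1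
      omega) hG hne
  set m := multiplicity Polynomial.X (u i0) with hm
  have hdv : ∀ i, Polynomial.X ^ m ∣ u i := by
    intro i
    have : m = multiplicity Polynomial.X (u i) := hall i0 i
    rw [this]; exact pow_multiplicity_dvd _ _
  have hndv : ∀ i, ¬ Polynomial.X ^ (m + 1) ∣ u i := by
    intro i h
    have h1 := le_emultiplicity_of_pow_dvd h
    rw [hpm _ hX, ← hall i0 i] at h1
    norm_cast at h1
    omega
  choose u' hu' using hdv
  have hlow : ∀ i, (u i).coeff m = (u' i).coeff 0 := by
    intro i
    rw [hu' i]
    simpa using Polynomial.coeff_X_pow_mul (u' i) m 0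
  have hlne : ∀ i, (u i).coeff m ≠ 0 := by
    intro i h
    rw [hlow, ← Polynomial.X_dvd_iff] at h
    apply hndv i
    rw [pow_succ, hu' i]
    exact mul_dvd_mul_left _ h
  refine ⟨m, ?_, ?_⟩
  · intro i k hk
    exact (Polynomial.X_pow_dvd_iff.1 ⟨u' i, hu' i⟩) k hk
  · have h1 : (Wmat D ε u').det = (∏ i, u' i) * Polynomial.C c := by
      have e1 : W = (Polynomial.X ^ m) ^ n * (Wmat D ε u').det := by
        rw [hW, show u = fun i => Polynomial.X ^ m * u' i from funext hu', hε,
          Wmat_smul_det i0 hD0 u' (pow_ne_zero _ hX.ne_zero)]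
      have e2 : ∏ i, u i = (Polynomial.X ^ m) ^ n * ∏ i, u' i := by
        rw [Finset.prod_congr rfl fun i _ => hu' i, Finset.prod_mul_distrib]
        simp
      rw [e1, e2, mul_assoc] at hq
      exact mul_left_cancel₀ (pow_ne_zero _ (pow_ne_zero _ hX.ne_zero)) hq
    have h2 : (Wmat d (Pi.single i0 1) (fun i => (u i).coeff m)).det =
        Polynomial.constantCoeff (Wmat D ε u').det := by
      rw [RingHom.map_det]
      congr 1
      ext i j
      simp only [RingHom.mapMatrix_apply, Matrix.map_apply, Polynomial.constantCoeff_apply, hcoef,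
        hlow]
    rw [h2, h1]
    simp only [map_mul, map_prod, Polynomial.constantCoeff_apply, Polynomial.coeff_C_zero]
    refine mul_ne_zero (Finset.prod_ne_zero_iff.2 fun i _ => ?_) hc
    rw [← hlow]
    exact hlne i

end CBProof

namespace CBProof

/-- Bihomogeneity over an arbitrary coefficient ring. -/
def BH {S : Type*} [CommSemiring S] {n : ℕ} (w : Fin 3 → ℤ) (d : ℤ)
    (p : MvPolynomial (Fin n ⊕ Fin 3) S) : Prop :=
  ∀ e ∈ p.support, ((∑ i : Fin n, (e (Sum.inl i) : ℤ)) + ∑ j : Fin 3, (e (Sum.inr j) : ℤ) * w j = d) ∧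
    (∑ j : Fin 3, e (Sum.inr j)) = 2

theorem BH.scale {S T : Type*} [CommRing S] [CommRing T] {n : ℕ} {w : Fin 3 → ℤ} {d : ℤ}
    {p : MvPolynomial (Fin n ⊕ Fin 3) S} (hp : BH w d p) (φ : S →+* T) (l ν : Tˣ)
    (u : Fin n → T) (x : Fin 3 → T) :
    p.eval₂ φ (Sum.elim (fun i => l * u i) (fun j => ((l ^ w j : Tˣ) : T) * ν * x j)) =
      ((l ^ d : Tˣ) : T) * ν ^ 2 * p.eval₂ φ (Sum.elim u x) := by
  rw [MvPolynomial.eval₂_eq', MvPolynomial.eval₂_eq', Finset.mul_sum]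
  refine Finset.sum_congr rfl fun e he => ?_
  obtain ⟨h1, h2⟩ := hp e he
  rw [Fintype.prod_sum_type, Fintype.prod_sum_type]
  simp only [Sum.elim_inl, Sum.elim_inr, mul_pow, Finset.prod_mul_distrib]
  have e1 : (∏ i : Fin n, (l : T) ^ e (Sum.inl i)) * (∏ j : Fin 3, ((l ^ w j : Tˣ) : T) ^ e (Sum.inr j))
      = ((l ^ d : Tˣ) : T) := by
    have : (∏ i : Fin n, l ^ e (Sum.inl i)) * (∏ j : Fin 3, (l ^ w j : Tˣ) ^ e (Sum.inr j)) = l ^ d := by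
      rw [← h1, zpow_add, Finset.prod_pow_eq_pow_sum]
      congr 1
      · rw [← zpow_natCast]; push_cast; rfl
      · rw [Fin.prod_univ_three, Fin.sum_univ_three, zpow_add, zpow_add]
        simp only [← zpow_natCast, ← zpow_mul, mul_comm]
    rw [← this]; push_cast; rfl
  have e2 : (∏ j : Fin 3, (ν : T) ^ e (Sum.inr j)) = ν ^ 2 := by
    rw [Finset.prod_pow_eq_pow_sum, h2]
  rw [← e1, ← e2]
  ring

section Chain
variable {L : Type*} [Field L] (O : ValuationSubring L)

open scoped Classical in
/-- Residue, extended by zero. -/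
noncomputable def rs (l : L) : IsLocalRing.ResidueField O :=
  if h : l ∈ O then IsLocalRing.residue O ⟨l, h⟩ else 0

theorem rs_coe (a : O) : rs O (a : L) = IsLocalRing.residue O a := by
  simp [rs]

theorem rs_mul {a b : L} (ha : a ∈ O) (hb : b ∈ O) : rs O (a * b) = rs O a * rs O b := by
  have := map_mul (IsLocalRing.residue O) ⟨a, ha⟩ ⟨b, hb⟩
  rw [← rs_coe, ← rs_coe, ← rs_coe] at this
  simpa using this

theorem rs_ne {a : L} : rs O a ≠ 0 ↔ O.valuation a = 1 := by
  constructor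
  · intro h
    by_cases ha : a ∈ O
    · rw [rs, dif_pos ha] at h
      rw [IsLocalRing.residue_ne_zero_iff_isUnit] at h
      exact (O.valuation_eq_one_iff ⟨a, ha⟩).1 h
    · exact absurd (by simp [rs, ha]) h
  · intro h
    have ha : a ∈ O := (O.valuation_le_one_iff a).1 h.le
    rw [rs, dif_pos ha, IsLocalRing.residue_ne_zero_iff_isUnit]
    exact (O.valuation_eq_one_iff ⟨a, ha⟩).2 h

theorem rs_zero_of_lt {a : L} (h : O.valuation a < 1) : rs O a = 0 := by
  by_contra hne
  rw [← ne_eq, rs_ne] at hne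
  exact absurd hne h.ne

theorem exists_lift (p : Polynomial L) (hp : ∀ k, O.valuation (p.coeff k) ≤ 1) :
    ∃ q : Polynomial O, q.map (algebraMap O L) = p := by
  have : p ∈ Polynomial.lifts (algebraMap O L) := by
    rw [Polynomial.lifts_iff_coeff_lifts]
    intro k
    exact ⟨⟨p.coeff k, (O.valuation_le_one_iff _).1 (hp k)⟩, rfl⟩
  exact (Polynomial.mem_lifts p).1 this

variable [CharP (IsLocalRing.ResidueField O) 2] {n : ℕ}

/-- Reduction of a solution. -/
theorem reduce_sol (G : GData n) {w : Fin 3 → ℤ} {d : ℤ} (gO : MvPolynomial (Fin n ⊕ Fin 3) O)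
    (hbh : BH w d gO) (p q r : Fin 3) (hpqr : ∀ j, j = p ∨ j = q ∨ j = r)
    (hres : MvPolynomial.map (IsLocalRing.residue O) gO =
      Gev G (fun i => X (Sum.inl i)) (X (Sum.inr q)) (X (Sum.inr r)) (X (Sum.inr p)))
    (u : Fin n → Polynomial L) (hu : ∀ i k, O.valuation ((u i).coeff k) ≤ 1)
    (x : Fin 3 → Polynomial L) (hx : x ≠ 0)
    (hg : gO.eval₂ (Polynomial.C.comp (algebraMap O L)) (Sum.elim u x) = 0) :
    ∃ (ub : Fin n → Polynomial (IsLocalRing.ResidueField O))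
      (X Y Z : Polynomial (IsLocalRing.ResidueField O)),
      (∀ i k, (ub i).coeff k = rs O ((u i).coeff k)) ∧ ¬ (X = 0 ∧ Y = 0 ∧ Z = 0) ∧
      Gev G ub X Y Z = 0 := by
  -- normalise x
  obtain ⟨ν, hν0, hν1, j1, k1, hν2⟩ : ∃ ν : L, ν ≠ 0 ∧ (∀ j k, O.valuation (ν * (x j).coeff k) ≤ 1) ∧
      ∃ j k, O.valuation (ν * (x j).coeff k) = 1 := by
    obtain ⟨j0, hj0⟩ := Function.ne_iff.1 hx
    set B := Finset.univ.sup (fun j => (x j).natDegree) with hB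
    obtain ⟨⟨j1, k1⟩, hjk, hmax⟩ := Finset.exists_max_image
      ((Finset.univ : Finset (Fin 3)) ×ˢ Finset.range (B + 1))
      (fun a => O.valuation ((x a.1).coeff a.2)) ⟨(j0, 0), by simp⟩
    have hmax' : ∀ j k, O.valuation ((x j).coeff k) ≤ O.valuation ((x j1).coeff k1) := by
      intro j k
      by_cases hk : k < B + 1
      · exact hmax (j, k) (by simp; omega)
      · have : (x j).coeff k = 0 := by
          apply Polynomial.coeff_eq_zero_of_natDegree_lt
          have : (x j).natDegree ≤ B := Finset.le_sup (f := fun j => (x j).natDegree) (Finset.mem_univ j)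
          omega
        rw [this]; simp
    have hne : (x j1).coeff k1 ≠ 0 := by
      intro h
      have h1 := hmax' j0 (x j0).natDegree
      rw [h, map_zero, le_zero_iff, map_eq_zero] at h1
      exact hj0 (Polynomial.leadingCoeff_eq_zero.1 h1)
    have hv : O.valuation ((x j1).coeff k1) ≠ 0 := by simpa using hne
    refine ⟨((x j1).coeff k1)⁻¹, inv_ne_zero hne, ?_, j1, k1, ?_⟩
    · intro j k
      rw [map_mul, map_inv₀]
      calc _ ≤ (O.valuation ((x j1).coeff k1))⁻¹ * O.valuation ((x j1).coeff k1) := by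
            gcongr; exact hmax' j k
        _ = 1 := inv_mul_cancel₀ hv
    · rw [inv_mul_cancel₀ hne, map_one]
  set νu : (Polynomial L)ˣ := Units.map Polynomial.C.toMonoidHom (Units.mk0 ν hν0) with hνu
  have hνc : (νu : Polynomial L) = Polynomial.C ν := rfl
  have hg' := hbh.scale (Polynomial.C.comp (algebraMap O L)) 1 νu u x
  rw [hg, mul_zero] at hg'
  simp only [one_zpow, Units.val_one, one_mul, hνc] at hg'
  choose uO huO using fun i => exists_lift O (u i) (hu i)
  choose xO hxO using fun j => exists_lift O (Polynomial.C ν * x j) (by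
    intro k; rw [Polynomial.coeff_C_mul]; exact hν1 j k)
  have hO : gO.eval₂ Polynomial.C (Sum.elim uO xO) = 0 := by
    apply Polynomial.map_injective (algebraMap O L) (IsFractionRing.injective O L)
    rw [← Polynomial.coe_mapRingHom, MvPolynomial.hom_eval₂, map_zero, ← hg']
    congr 1
    · ext a; simp
    · funext a
      rcases a with i | j
      · simp [huO]
      · simp [hxO]
  have hF := congrArg (Polynomial.mapRingHom (IsLocalRing.residue O)) hO
  rw [MvPolynomial.hom_eval₂, map_zero] at hF
  set xb : Fin n ⊕ Fin 3 → Polynomial (IsLocalRing.ResidueField O) := 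
    fun a => Polynomial.mapRingHom (IsLocalRing.residue O) (Sum.elim uO xO a) with hxb
  have hF2 : (MvPolynomial.map (IsLocalRing.residue O) gO).eval₂ Polynomial.C xb = 0 := by
    rw [MvPolynomial.eval₂_map, ← hF]
    congr 1
    ext a; simp
  rw [hres, ← MvPolynomial.coe_eval₂Hom, map_Gev] at hF2
  simp only [MvPolynomial.coe_eval₂Hom, MvPolynomial.eval₂_X] at hF2
  refine ⟨_, _, _, _, ?_, ?_, hF2⟩
  · intro i k
    simp only [hxb, Sum.elim_inl, Polynomial.coe_mapRingHom, Polynomial.coeff_map]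
    rw [← rs_coe, ← huO i, Polynomial.coeff_map]
    rfl
  · rintro ⟨h1, h2, h3⟩
    have : xb (Sum.inr j1) = 0 := by
      rcases hpqr j1 with rfl | rfl | rfl <;> assumption
    have h4 := congrArg (fun f => Polynomial.coeff f k1) this
    simp only [hxb, Sum.elim_inr, Polynomial.coe_mapRingHom, Polynomial.coeff_map,
      Polynomial.coeff_zero] at h4
    rw [← rs_coe] at h4
    have h5 : ((xO j1).coeff k1 : L) = ν * (x j1).coeff k1 := by
      have := congrArg (fun f => Polynomial.coeff f k1) (hxO j1)
      simpa using this
    rw [h5] at h4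
    exact (rs_ne O).2 hν2 h4

theorem eval_transform {w : Fin 3 → ℤ} {d : ℤ} (gO : MvPolynomial (Fin n ⊕ Fin 3) O)
    (hbh : BH w d gO) (u : Fin n → Polynomial L) (x : Fin 3 → Polynomial L) (hx : x ≠ 0)
    (hg : gO.eval₂ (Polynomial.C.comp (algebraMap O L)) (Sum.elim u x) = 0) (a ρ : L)
    (ha : a ≠ 0) (hρ : ρ ≠ 0) :
    ∃ x' : Fin 3 → Polynomial L, x' ≠ 0 ∧
      gO.eval₂ (Polynomial.C.comp (algebraMap O L))
        (Sum.elim (fun i => Polynomial.C a * (u i).comp (Polynomial.C ρ * Polynomial.X)) x') = 0 := by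
  set l : (Polynomial L)ˣ := Units.map Polynomial.C.toMonoidHom (Units.mk0 a ha) with hl
  have hlc : (l : Polynomial L) = Polynomial.C a := rfl
  have h1 := congrArg (Polynomial.compRingHom (Polynomial.C ρ * Polynomial.X)) hg
  rw [MvPolynomial.hom_eval₂, map_zero] at h1
  have h2 := hbh.scale (Polynomial.C.comp (algebraMap O L)) l 1
    (fun i => (u i).comp (Polynomial.C ρ * Polynomial.X))
    (fun j => (x j).comp (Polynomial.C ρ * Polynomial.X))
  have h3 : gO.eval₂ (Polynomial.C.comp (algebraMap O L))
      (Sum.elim (fun i => (u i).comp (Polynomial.C ρ * Polynomial.X))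
        (fun j => (x j).comp (Polynomial.C ρ * Polynomial.X))) = 0 := by
    rw [← h1]
    congr 1
    · ext b; simp [Polynomial.compRingHom]
    · funext b
      rcases b with i | j <;> rfl
  rw [h3, mul_zero] at h2
  refine ⟨_, ?_, h2⟩
  obtain ⟨j, hj⟩ := Function.ne_iff.1 hx
  refine Function.ne_iff.2 ⟨j, ?_⟩
  simp only [Units.val_one, mul_one, Pi.zero_apply]
  refine mul_ne_zero (Units.ne_zero _) ?_
  intro h
  apply hj
  ext k
  have := congrArg (fun f => Polynomial.coeff f k) h
  simp only [Polynomial.comp_C_mul_X_coeff, Polynomial.coeff_zero, mul_eq_zero, pow_eq_zero_iff',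
    hρ, false_and, or_false] at this
  simpa using this

theorem chain (hn : 2 ≤ n) (G : GData n) {w : Fin 3 → ℤ} {d : ℤ}
    (gO : MvPolynomial (Fin n ⊕ Fin 3) O)
    (hbh : BH w d gO) (p q r : Fin 3) (hpqr : ∀ j, j = p ∨ j = q ∨ j = r)
    (hres : MvPolynomial.map (IsLocalRing.residue O) gO =
      Gev G (fun i => X (Sum.inl i)) (X (Sum.inr q)) (X (Sum.inr r)) (X (Sum.inr p)))
    (D : Fin n → Derivation ℤ (IsLocalRing.ResidueField O) (IsLocalRing.ResidueField O))
    (i0 : Fin n) (hD : D i0 = 0)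
    (hdiv : ∀ l : L, l ≠ 0 → ∀ m : ℕ, 0 < m → ∃ ρ : L, O.valuation ρ ^ m = O.valuation l)
    (b : Fin n → L) (hb : b ≠ 0) (hbs : ∀ i j, b i / b j ∈ O → IsSquare (rs O (b i / b j))) 
    (e : ℕ) : ∀ (u : Fin n → Polynomial L) (x : Fin 3 → Polynomial L) (c : L), c ≠ 0 →
    x ≠ 0 → gO.eval₂ (Polynomial.C.comp (algebraMap O L)) (Sum.elim u x) = 0 →
    (∀ i, (u i).coeff 0 = c * b i) →
    (∀ i k, O.valuation ((u i).coeff k) ≤ 1) →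
    (∀ i, ∀ k < e, O.valuation ((u i).coeff k) < 1) → 
    (Wmat D (Pi.single i0 1) (fun i => rs O ((u i).coeff e))).det ≠ 0 → False := by
  induction e using Nat.strong_induction_on with
  | _ e IH =>
  intro u x c hc hx hg h0 hu hlt hW
  rcases Nat.eq_zero_or_pos e with rfl | he
  · -- constants
    obtain ⟨i1, -, hmax⟩ := Finset.exists_max_image Finset.univ (fun i => O.valuation (b i))
      ⟨i0, Finset.mem_univ _⟩
    have hb1 : b i1 ≠ 0 := by
      intro h
      apply hb
      funext i
      have := hmax i (Finset.mem_univ i)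
      rw [h, map_zero, le_zero_iff, map_eq_zero] at this
      simpa using this
    have hmem : ∀ i, b i / b i1 ∈ O := by
      intro i
      rw [← O.valuation_le_one_iff, map_div₀]
      exact div_le_one_of_le₀ (hmax i (Finset.mem_univ i)) zero_le
    have hcm : c * b i1 ∈ O := by
      rw [← O.valuation_le_one_iff, ← h0]; exact hu _ _
    have hr : ∀ i, rs O ((u i).coeff 0) = rs O (c * b i1) * rs O (b i / b i1) := by
      intro i
      rw [← rs_mul O hcm (hmem i), h0]
      congr 1
      field_simp
    have hne : rs O (c * b i1) ≠ 0 := by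
      intro h
      apply hW
      simp only [hr, h, zero_mul]
      apply Matrix.det_eq_zero_of_row_eq_zero i0
      intro j
      have hl : D j 0 = 0 := map_zero (D j)
      simp only [Wmat, Matrix.of_apply, mul_zero, add_zero]
      exact hl
    apply hW
    simp only [hr]
    rw [Wmat_smul_det i0 hD _ hne]
    obtain ⟨j, hj⟩ : ∃ j : Fin n, j ≠ i0 := by
      have : Nontrivial (Fin n) := Fin.nontrivial_iff_two_le.2 hn
      exact exists_ne i0
    rw [Matrix.det_eq_zero_of_column_eq_zero j, mul_zero]
    intro i
    obtain ⟨s, hs⟩ := hbs i i1 (hmem i)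
    have h2 : (2 : IsLocalRing.ResidueField O) = 0 := by
      exact_mod_cast CharP.cast_eq_zero (IsLocalRing.ResidueField O) 2
    have hl : D j (s * s) = s * D j s + s * D j s := (D j).leibniz s s
    simp only [Wmat, Matrix.of_apply, hs, Pi.single_apply, hj, if_false]
    linear_combination hl + (s * D j s) * h2
  · -- inductive step
    have hσ : ∀ i k, k < e → ∃ σ : L, O.valuation σ ^ (e - k) = O.valuation ((u i).coeff k) := by
      intro i k hk
      rcases eq_or_ne ((u i).coeff k) 0 with h | h
      · exact ⟨0, by rw [h, map_zero, zero_pow (by omega)]⟩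
      · exact hdiv _ h _ (by omega)
    have hσ' : ∀ a : Fin n × ℕ, ∃ σ : L, a.2 < e →
        O.valuation σ ^ (e - a.2) = O.valuation ((u a.1).coeff a.2) := by
      intro a
      by_cases h : a.2 < e
      · obtain ⟨σ, h'⟩ := hσ a.1 a.2 h
        exact ⟨σ, fun _ => h'⟩
      · exact ⟨0, fun h' => absurd h' h⟩
    choose σ hσ using hσ'
    obtain ⟨a1, ha1, hmax⟩ := Finset.exists_max_image
      ((Finset.univ : Finset (Fin n)) ×ˢ Finset.range e) (fun a => O.valuation (σ a))
      ⟨(i0, 0), by simp [he]⟩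
    have ha1' : a1.2 < e := by simpa using ha1
    set ρ := σ a1 with hρ
    obtain ⟨ib, hib⟩ := Function.ne_iff.1 hb
    have hρ0 : ρ ≠ 0 := by
      intro h
      have h1 := hmax (ib, 0) (by simp [he])
      rw [h, map_zero, le_zero_iff] at h1
      have h2 := hσ (ib, 0) he
      simp only at h2
      rw [h1, h0, zero_pow (by omega), eq_comm, map_eq_zero] at h2
      exact (mul_ne_zero hc hib) h2
    have hvρ : O.valuation ρ ≠ 0 := by simpa using hρ0
    have hρ1 : O.valuation ρ < 1 := by
      have := hlt a1.1 a1.2 ha1'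
      rw [← hσ a1 ha1'] at this
      by_contra hcon
      push Not at hcon
      exact absurd (one_le_pow₀ hcon) (not_le.2 this)
    set a : L := (ρ ^ e)⁻¹ with ha
    have ha0 : a ≠ 0 := inv_ne_zero (pow_ne_zero _ hρ0)
    obtain ⟨x', hx', hg'⟩ := eval_transform O gO hbh u x hx hg a ρ ha0 hρ0
    set u' : Fin n → Polynomial L :=
      fun i => Polynomial.C a * (u i).comp (Polynomial.C ρ * Polynomial.X) with hu'
    have hcoef : ∀ i k, (u' i).coeff k = a * ((u i).coeff k * ρ ^ k) := by
      intro i k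
      simp [hu', Polynomial.comp_C_mul_X_coeff]
    have hvlow : ∀ i k, k < e → O.valuation ((u' i).coeff k) =
        O.valuation ((u i).coeff k) * (O.valuation ρ ^ (e - k))⁻¹ := by
      intro i k hk
      rw [hcoef, ha]
      simp only [map_mul, map_inv₀, map_pow]
      have : O.valuation ρ ^ e = O.valuation ρ ^ (e - k) * O.valuation ρ ^ k := by
        rw [← pow_add]; congr 1; omega
      rw [this]
      field_simp
    have hvtop : ∀ i, (u' i).coeff e = (u i).coeff e := by
      intro i
      rw [hcoef, ha]
      field_simp
    have hvhigh : ∀ i k, e < k → O.valuation ((u' i).coeff k) < 1 := by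
      intro i k hk
      have : (u' i).coeff k = (u i).coeff k * ρ ^ (k - e) := by
        rw [hcoef, ha]
        have : ρ ^ k = ρ ^ e * ρ ^ (k - e) := by rw [← pow_add]; congr 1; omega
        rw [this]
        field_simp
      rw [this, map_mul, map_pow]
      have h1 : O.valuation ρ ^ (k - e) < 1 := pow_lt_one₀ zero_le hρ1 (by omega)
      calc _ ≤ 1 * O.valuation ρ ^ (k - e) := by gcongr; exact hu i k
        _ < 1 := by rwa [one_mul]
    have hu'1 : ∀ i k, O.valuation ((u' i).coeff k) ≤ 1 := by
      intro i k
      rcases lt_trichotomy k e with hk | hk | hk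
      · rw [hvlow i k hk, ← hσ (i, k) hk]
        have h1 : O.valuation (σ (i, k)) ≤ O.valuation ρ := hmax (i, k) (by simp [hk])
        have h2 : O.valuation ρ ^ (e - k) ≠ 0 := pow_ne_zero _ hvρ
        calc _ ≤ O.valuation ρ ^ (e - k) * (O.valuation ρ ^ (e - k))⁻¹ := by gcongr
          _ = 1 := mul_inv_cancel₀ h2
      · rw [hk, hvtop]; exact hu i e
      · exact (hvhigh i k hk).le
    obtain ⟨ub, xx, yy, zz, hub, hne, hG⟩ := reduce_sol O G gO hbh p q r hpqr hres u' hu'1 x' hx' hg'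
    obtain ⟨m, hm1, hm2⟩ := edge_lemma G D i0 hD e ub (by
      intro i
      rw [Polynomial.natDegree_le_iff_coeff_eq_zero]
      intro N hN
      rw [hub]
      exact rs_zero_of_lt O (hvhigh i N hN)) (by
      simpa only [hub, hvtop] using hW) xx yy zz hne hG
    have hme : m < e := by
      by_contra hcon
      push Not at hcon
      have h1 := hm1 a1.1 a1.2 (by omega)
      rw [hub] at h1
      refine (rs_ne O).2 ?_ h1
      rw [hvlow _ _ ha1', ← hσ a1 ha1']
      exact mul_inv_cancel₀ (pow_ne_zero _ hvρ)
    refine IH m hme u' x' (a * c) (mul_ne_zero ha0 hc) hx' hg' ?_ hu'1 ?_ ?_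
    · intro i
      rw [hcoef, h0]; ring
    · intro i k hk
      refine lt_of_le_of_ne (hu'1 i k) ?_
      intro h
      have h1 := hm1 i k hk
      rw [hub] at h1
      exact (rs_ne O).2 h h1
    · simpa only [hub] using hm2

/-- The version with arbitrary top coefficient. -/
theorem chain_top (hn : 2 ≤ n) (G : GData n) {w : Fin 3 → ℤ} {d : ℤ}
    (gO : MvPolynomial (Fin n ⊕ Fin 3) O)
    (hbh : BH w d gO) (p q r : Fin 3) (hpqr : ∀ j, j = p ∨ j = q ∨ j = r)
    (hres : MvPolynomial.map (IsLocalRing.residue O) gO =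
      Gev G (fun i => X (Sum.inl i)) (X (Sum.inr q)) (X (Sum.inr r)) (X (Sum.inr p)))
    (D : Fin n → Derivation ℤ (IsLocalRing.ResidueField O) (IsLocalRing.ResidueField O))
    (i0 : Fin n) (hD : D i0 = 0)
    (hdiv : ∀ l : L, l ≠ 0 → ∀ m : ℕ, 0 < m → ∃ ρ : L, O.valuation ρ ^ m = O.valuation l)
    (h2 : ∃ a : L, 1 < O.valuation a)
    (b : Fin n → L) (hb : b ≠ 0) (hbs : ∀ i j, b i / b j ∈ O → IsSquare (rs O (b i / b j))) 
    (N : ℕ) (u : Fin n → Polynomial L) (x : Fin 3 → Polynomial L) (hx : x ≠ 0)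
    (hg : gO.eval₂ (Polynomial.C.comp (algebraMap O L)) (Sum.elim u x) = 0)
    (h0 : ∀ i, (u i).coeff 0 = b i) (hN : ∀ i, (u i).natDegree ≤ N) (lam : L) (hlam : lam ≠ 0)
    (τ : Fin n → L) (hτ : ∀ i, O.valuation (τ i) ≤ 1) (htop : ∀ i, (u i).coeff N = lam * τ i)
    (hW : (Wmat D (Pi.single i0 1) (fun i => rs O (τ i))).det ≠ 0) : False := by
  obtain ⟨ρ0, hρ0⟩ := h2
  obtain ⟨M, hM1, hM2⟩ : ∃ M : L, 1 ≤ O.valuation M ∧ ∀ i k, k < N →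
      O.valuation ((u i).coeff k / lam) ≤ O.valuation M := by
    obtain ⟨a, ha, hmax⟩ := Finset.exists_max_image
      ((Finset.univ : Finset (Fin n)) ×ˢ Finset.range (N + 1))
      (fun a => O.valuation ((u a.1).coeff a.2 / lam)) ⟨(i0, 0), by simp⟩
    rcases le_total 1 (O.valuation ((u a.1).coeff a.2 / lam)) with h | h
    · exact ⟨_, h, fun i k hk => hmax (i, k) (by simp; omega)⟩
    · exact ⟨1, by simp, fun i k hk => by
        rw [map_one]; exact (hmax (i, k) (by simp; omega)).trans h⟩
  set ρ := M * ρ0 with hρ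
  have hρM : O.valuation M < O.valuation ρ := by
    rw [hρ, map_mul]
    have h0 : 0 < O.valuation M := lt_of_lt_of_le zero_lt_one hM1
    exact (lt_mul_iff_one_lt_right h0).2 hρ0
  have hρ1 : 1 < O.valuation ρ := lt_of_le_of_lt hM1 hρM
  have hvρ : O.valuation ρ ≠ 0 := (lt_trans zero_lt_one hρ1).ne'
  have hρn : ρ ≠ 0 := by rintro h; rw [h, map_zero] at hvρ; exact hvρ rfl
  set a : L := (lam * ρ ^ N)⁻¹ with ha
  have ha0 : a ≠ 0 := inv_ne_zero (mul_ne_zero hlam (pow_ne_zero _ hρn))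
  obtain ⟨x', hx', hg'⟩ := eval_transform O gO hbh u x hx hg a ρ ha0 hρn
  set u' : Fin n → Polynomial L :=
    fun i => Polynomial.C a * (u i).comp (Polynomial.C ρ * Polynomial.X) with hu'
  have hcoef : ∀ i k, (u' i).coeff k = a * ((u i).coeff k * ρ ^ k) := by
    intro i k
    simp [hu', Polynomial.comp_C_mul_X_coeff]
  have htop' : ∀ i, (u' i).coeff N = τ i := by
    intro i
    rw [hcoef, htop, ha]
    field_simp
  have hhigh : ∀ i k, N < k → (u' i).coeff k = 0 := by
    intro i k hk
    rw [hcoef, Polynomial.coeff_eq_zero_of_natDegree_lt (lt_of_le_of_lt (hN i) hk)]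
    ring
  have hlow : ∀ i k, k < N → O.valuation ((u' i).coeff k) < 1 := by
    intro i k hk
    have e1 : (u' i).coeff k = ((u i).coeff k / lam) * (ρ ^ (N - k))⁻¹ := by
      rw [hcoef, ha]
      have : ρ ^ N = ρ ^ (N - k) * ρ ^ k := by rw [← pow_add]; congr 1; omega
      rw [this]
      field_simp
    rw [e1, map_mul, map_inv₀, map_pow]
    have h1 : O.valuation ((u i).coeff k / lam) < O.valuation ρ ^ (N - k) :=
      calc _ ≤ O.valuation M := hM2 i k hk
        _ < O.valuation ρ := hρM
        _ ≤ _ := le_self_pow₀ hρ1.le (by omega)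
    exact mul_inv_lt_of_lt_mul₀ (by rwa [one_mul])
  refine chain O hn G gO hbh p q r hpqr hres D i0 hD hdiv b hb hbs N u' x' a ha0 hx' hg' ?_ ?_ hlow ?_
  · intro i; rw [hcoef, h0]; ring
  · intro i k
    rcases lt_trichotomy k N with hk | hk | hk
    · exact (hlow i k hk).le
    · rw [hk, htop']; exact hτ i
    · rw [hhigh i k hk]; simp
  · simpa only [htop'] using hW

end Chain
end CBProof

namespace CBProof

theorem top_prod {L ι : Type*} [Field L] (s : Finset ι) (p : ι → Polynomial L) (m : ι → ℕ)
    (h : ∀ i, (p i).natDegree ≤ m i) :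
    (∏ i ∈ s, p i).natDegree ≤ ∑ i ∈ s, m i ∧
      (∏ i ∈ s, p i).coeff (∑ i ∈ s, m i) = ∏ i ∈ s, (p i).coeff (m i) := by
  classical
  induction s using Finset.induction_on with
  | empty => simp
  | insert a s ha ih =>
    rw [Finset.prod_insert ha, Finset.sum_insert ha, Finset.prod_insert ha]
    exact ⟨Polynomial.natDegree_mul_le_of_le (h a) ih.1, by
      rw [Polynomial.coeff_mul_add_eq_of_natDegree_le (h a) ih.1, ih.2]⟩

theorem homz {K L : Type*} [Field K] [Field L] (φ : K →+* L) {s : ℕ} (A : Fin s → L)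
    (B : Fin s → K) (P : MvPolynomial (Fin s) K) (M : ℕ) (hM : P.totalDegree ≤ M)
    {R : Type*} [Field R] (c : Polynomial L →+* R) (hc : c (1 + Polynomial.X) ≠ 0) :
    ∃ Q : Polynomial L, Q.natDegree ≤ M ∧ Q.coeff 0 = φ (eval B P) ∧
      Q.coeff M = P.eval₂ φ A ∧
      c Q = c (1 + Polynomial.X) ^ M * P.eval₂ ((c.comp Polynomial.C).comp φ)
        (fun k => c (Polynomial.C (φ (B k)) + Polynomial.C (A k) * Polynomial.X) /
          c (1 + Polynomial.X)) := by
  set f : (Fin s →₀ ℕ) → Polynomial L := fun e =>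
    (1 + Polynomial.X) ^ (M - ∑ k, e k) *
      ∏ k, (Polynomial.C (φ (B k)) + Polynomial.C (A k) * Polynomial.X) ^ e k with hf
  have hle : ∀ e ∈ P.support, ∑ k, e k ≤ M := fun e he => by
    have := le_trans (MvPolynomial.le_totalDegree he) hM
    rwa [Finsupp.sum_fintype _ _ (by simp)] at this
  have hlin : ∀ a b : L, (Polynomial.C a + Polynomial.C b * Polynomial.X).natDegree ≤ 1 := by
    intro a b
    compute_degree
  have h1d : (1 + Polynomial.X : Polynomial L).natDegree ≤ 1 := by compute_degree
  have hpow : ∀ (p : Polynomial L) (k : ℕ), p.natDegree ≤ 1 → (p ^ k).natDegree ≤ k := by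
    intro p k h
    simpa using Polynomial.natDegree_pow_le_of_le k h
  have hpowc : ∀ (p : Polynomial L) (k : ℕ), p.natDegree ≤ 1 → (p ^ k).coeff k = p.coeff 1 ^ k := by
    intro p k h
    simpa using Polynomial.coeff_pow_of_natDegree_le (m := k) h
  have htop : ∀ e ∈ P.support, (f e).natDegree ≤ M ∧ (f e).coeff M = ∏ k, A k ^ e k := by
    intro e he
    have h1 := top_prod Finset.univ
      (fun k => (Polynomial.C (φ (B k)) + Polynomial.C (A k) * Polynomial.X) ^ e k) (fun k => e k)
      (fun k => hpow _ _ (hlin _ _))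
    have h2 := hpow (1 + Polynomial.X : Polynomial L) (M - ∑ k, e k) h1d
    have h3 := hpowc (1 + Polynomial.X : Polynomial L) (M - ∑ k, e k) h1d
    have hs : M = (M - ∑ k, e k) + ∑ k, e k := by have := hle e he; omega
    constructor
    · have := Polynomial.natDegree_mul_le_of_le h2 h1.1
      rw [← hs] at this
      exact this
    · have := Polynomial.coeff_mul_add_eq_of_natDegree_le h2 h1.1
      rw [← hs] at this
      rw [hf]
      simp only
      rw [this, h3, h1.2]
      simp only [hpowc _ _ (hlin _ _)]
      simp [Polynomial.coeff_one]
  refine ⟨∑ e ∈ P.support, Polynomial.C (φ (P.coeff e)) * f e, ?_, ?_, ?_, ?_⟩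
  · refine Polynomial.natDegree_sum_le_of_forall_le _ _ fun e he => ?_
    exact (Polynomial.natDegree_C_mul_le _ _).trans (htop e he).1
  · rw [Polynomial.coeff_zero_eq_eval_zero, Polynomial.eval_finsetSum, MvPolynomial.eval_eq',
      map_sum]
    refine Finset.sum_congr rfl fun e he => ?_
    simp [hf, Polynomial.eval_prod]
  · rw [Polynomial.finsetSum_coeff, MvPolynomial.eval₂_eq']
    refine Finset.sum_congr rfl fun e he => ?_
    rw [Polynomial.coeff_C_mul, (htop e he).2]
  · rw [map_sum, MvPolynomial.eval₂_eq', Finset.mul_sum]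
    refine Finset.sum_congr rfl fun e he => ?_
    have hs : M = (M - ∑ k, e k) + ∑ k, e k := by have := hle e he; omega
    rw [hf]
    simp only [map_mul, map_pow, map_prod, div_pow, Finset.prod_div_distrib,
      Finset.prod_pow_eq_pow_sum, RingHom.comp_apply]
    have : c (1 + Polynomial.X) ^ M = c (1 + Polynomial.X) ^ (M - ∑ k, e k) *
        c (1 + Polynomial.X) ^ (∑ k, e k) := by rw [← pow_add, ← hs]
    rw [this]
    field_simp

/-- Specialization of the stable-birational coordinates. -/
theorem specialize {K L0 L : Type*} [Field K] [Infinite K] [CommRing L0] [IsDomain L0] [Algebra K L0]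
    [Field L] (j : L0 →+* L) (hj : Function.Injective j) (r s : ℕ)
    (Φ : FractionRing (MvPolynomial (Fin r) L0) ≃ₐ[K] FractionRing (MvPolynomial (Fin s) K))
    {n : ℕ} (τ : Fin n → L0) (H : MvPolynomial (Fin s) K) (hH : H ≠ 0)
    (U : Fin n → MvPolynomial (Fin s) K)
    (hU : ∀ i, algebraMap _ (FractionRing (MvPolynomial (Fin s) K)) (U i) =
      algebraMap _ _ H * Φ (algebraMap L0 _ (τ i))) :
    ∃ A : Fin s → L, H.eval₂ (j.comp (algebraMap K L0)) A ≠ 0 ∧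
      ∀ i, (U i).eval₂ (j.comp (algebraMap K L0)) A =
        H.eval₂ (j.comp (algebraMap K L0)) A * j (τ i) := by
  classical
  have hinf : Infinite L := by
    exact Infinite.of_injective (j.comp (algebraMap K L0)) (j.comp (algebraMap K L0)).injective
  set R := MvPolynomial (Fin r) L0
  set E := FractionRing R
  set F := FractionRing (MvPolynomial (Fin s) K)
  set y : Fin s → E := fun k => Φ.symm (algebraMap (MvPolynomial (Fin s) K) F (X k)) with hy
  have hev : ∀ P : MvPolynomial (Fin s) K, Φ.symm (algebraMap _ F P) = aeval y P := by
    intro P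
    have : (Φ.symm : F →ₐ[K] E).comp (IsScalarTower.toAlgHom K (MvPolynomial (Fin s) K) F) =
        aeval y := by
      apply MvPolynomial.algHom_ext
      intro k
      simp [hy]
    exact DFunLike.congr_fun this P
  obtain ⟨c, hc⟩ := IsLocalization.exist_integer_multiples_of_finset (nonZeroDivisors R)
    (Finset.univ.image y)
  have hc' : ∀ k, ∃ a : R, algebraMap R E a = algebraMap R E c * y k := by
    intro k
    obtain ⟨a, ha⟩ := hc (y k) (by simp)
    exact ⟨a, by rw [ha, Algebra.smul_def]⟩
  choose a ha using hc'
  obtain ⟨⟨h1, h2⟩, hh⟩ := IsLocalization.surj (nonZeroDivisors R) (aeval y H : E)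
  simp only at hh
  have hinjE : Function.Injective (algebraMap R E) := IsFractionRing.injective R E
  have hinjF : Function.Injective (algebraMap (MvPolynomial (Fin s) K) F) := IsFractionRing.injective _ F
  have hHy : (aeval y H : E) ≠ 0 := by
    rw [← hev]
    intro h
    rw [map_eq_zero_iff _ Φ.symm.injective, map_eq_zero_iff _ hinjF] at h
    exact hH h
  have h1ne : h1 ≠ 0 := by
    rintro rfl
    rw [map_zero, mul_eq_zero] at hh
    rcases hh with h | h
    · exact hHy h
    · exact nonZeroDivisors.ne_zero h2.2 (hinjE (by rw [h, map_zero]))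
  have hcne : (c : R) ≠ 0 := nonZeroDivisors.ne_zero c.2
  -- choose the point
  have hch : (MvPolynomial.map j ((c : R) * h1)) ≠ 0 := by
    exact (map_ne_zero_iff _ (MvPolynomial.map_injective j hj)).2 (mul_ne_zero hcne h1ne)
  obtain ⟨ρ, hρ⟩ : ∃ ρ : Fin r → L, eval ρ (MvPolynomial.map j ((c : R) * h1)) ≠ 0 := by
    by_contra hcon
    push Not at hcon
    exact hch (MvPolynomial.funext (by simpa using hcon))
  set ev : R →+* L := (eval ρ).comp (MvPolynomial.map j) with hevd
  have hev1 : ev (c * h1) ≠ 0 := hρ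
  rw [map_mul] at hev1
  have hevC : ∀ l : L0, ev (algebraMap L0 R l) = j l := by
    intro l
    simp [hevd, R, MvPolynomial.algebraMap_eq]
  set S : Submonoid R := (nonZeroDivisors L).comap ev with hS
  have hSmem : ∀ b : R, b ∈ S ↔ ev b ≠ 0 := by
    intro b
    simp [hS, Submonoid.mem_comap]
  have hS0 : ∀ b : S, IsUnit (algebraMap R E b) := by
    intro b
    rw [isUnit_iff_ne_zero]
    intro h
    have : (b : R) = 0 := hinjE (by rw [h, map_zero])
    exact (hSmem b).1 b.2 (by rw [this, map_zero])
  have hS1 : ∀ b : S, IsUnit (ev b) := fun b => isUnit_iff_ne_zero.2 ((hSmem b).1 b.2)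
  set p1 : Localization S →+* E := IsLocalization.lift hS0 with hp1
  set p2 : Localization S →+* L := IsLocalization.lift hS1 with hp2
  have hp1inj : Function.Injective p1 := by
    rw [hp1, IsLocalization.lift_injective_iff]
    intro b b'
    have hSle : S ≤ nonZeroDivisors R := by
      intro b hb
      apply mem_nonZeroDivisors_of_ne_zero
      rintro rfl
      exact (hSmem 0).1 hb (map_zero _)
    rw [(IsLocalization.injective (Localization S) hSle).eq_iff, hinjE.eq_iff]
  set y' : Fin s → Localization S := fun k =>
    IsLocalization.mk' (Localization S) (a k) ⟨c, (hSmem c).2 (left_ne_zero_of_mul hev1)⟩ with hy'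
  have hp1y : ∀ k, p1 (y' k) = y k := by
    intro k
    rw [hp1, hy', IsLocalization.lift_mk'_spec, ha]
  have hK1 : ∀ P : MvPolynomial (Fin s) K, p1 (aeval y' P) = aeval y P := by
    intro P
    rw [MvPolynomial.aeval_def, MvPolynomial.hom_eval₂, MvPolynomial.aeval_def]
    congr 1
    · ext k
      rw [RingHom.comp_apply, IsScalarTower.algebraMap_apply K R (Localization S),
        hp1, IsLocalization.lift_eq, ← IsScalarTower.algebraMap_apply]
    · funext k
      exact hp1y k
  have hK2 : ∀ P : MvPolynomial (Fin s) K, p2 (aeval y' P) =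
      P.eval₂ (j.comp (algebraMap K L0)) (fun k => p2 (y' k)) := by
    intro P
    rw [MvPolynomial.aeval_def, MvPolynomial.hom_eval₂]
    congr 1
    ext k
    rw [RingHom.comp_apply, IsScalarTower.algebraMap_apply K R (Localization S),
        hp2, IsLocalization.lift_eq, IsScalarTower.algebraMap_apply K L0 R, hevC]
    rfl
  refine ⟨fun k => p2 (y' k), ?_, ?_⟩
  · rw [← hK2]
    have : aeval y' H * algebraMap R (Localization S) h2 = algebraMap R _ h1 := by
      apply hp1inj
      rw [map_mul, hK1, hp1, IsLocalization.lift_eq, IsLocalization.lift_eq, hh]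
    have h3 := congrArg p2 this
    rw [map_mul, hp2, IsLocalization.lift_eq, IsLocalization.lift_eq, ← hp2] at h3
    intro h
    rw [h, zero_mul] at h3
    exact right_ne_zero_of_mul hev1 h3.symm
  · intro i
    rw [← hK2, ← hK2]
    have : aeval y' (U i) = aeval y' H * algebraMap R (Localization S) (algebraMap L0 R (τ i)) := by
      apply hp1inj
      rw [map_mul, hK1, hK1, hp1, IsLocalization.lift_eq]
      have h4 := congrArg Φ.symm (hU i)
      rw [map_mul, hev, hev, AlgEquiv.symm_apply_apply] at h4
      rw [h4]
      rfl
    rw [this, map_mul, hp2, IsLocalization.lift_eq, hevC]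

/-- The path in the cone produced by stable rationality. -/
theorem path {K L0 L : Type*} [Field K] [Infinite K] [CommRing L0] [IsDomain L0] [Algebra K L0]
    [Field L] (j : L0 →+* L) (hj : Function.Injective j) (r s : ℕ)
    (Φ : FractionRing (MvPolynomial (Fin r) L0) ≃ₐ[K] FractionRing (MvPolynomial (Fin s) K))
    {n : ℕ} {w : Fin 3 → ℤ} {d : ℤ} (g : MvPolynomial (Fin n ⊕ Fin 3) K) (hg : BH w d g)
    (τ : Fin n → L0) (i0 : Fin n) (hτ : τ i0 = 1) (θ : Fin 3 → L0) (hθ : θ ≠ 0)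
    (h0 : g.eval₂ (algebraMap K L0) (Sum.elim τ θ) = 0) :
    ∃ (N : ℕ) (u : Fin n → Polynomial L) (x : Fin 3 → Polynomial L) (b : Fin n → K) (lam : L),
      x ≠ 0 ∧ b ≠ 0 ∧ lam ≠ 0 ∧
      g.eval₂ (Polynomial.C.comp (j.comp (algebraMap K L0))) (Sum.elim u x) = 0 ∧
      (∀ i, (u i).coeff 0 = j (algebraMap K L0 (b i))) ∧ (∀ i, (u i).natDegree ≤ N) ∧
      (∀ i, (u i).coeff N = lam * j (τ i)) := by
  classical
  set R := MvPolynomial (Fin s) K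
  set F := FractionRing R
  have hinjF : Function.Injective (algebraMap R F) := IsFractionRing.injective _ F
  set Ψ : L0 →+* F := (Φ : FractionRing (MvPolynomial (Fin r) L0) →+* F).comp (algebraMap L0 _) with hΨ
  have hΨinj : Function.Injective Ψ := by
    have h1 : Function.Injective (algebraMap (MvPolynomial (Fin r) L0)
      (FractionRing (MvPolynomial (Fin r) L0))) := IsFractionRing.injective _ _
    have h2 : Function.Injective (algebraMap L0 (MvPolynomial (Fin r) L0)) :=
      MvPolynomial.C_injective _ _
    rw [hΨ, RingHom.coe_comp, IsScalarTower.algebraMap_eq L0 (MvPolynomial (Fin r) L0)]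
    exact Φ.injective.comp (h1.comp h2)
  have hΨK : Ψ.comp (algebraMap K L0) = algebraMap K F := by
    ext k
    simp only [hΨ, RingHom.comp_apply]
    rw [← IsScalarTower.algebraMap_apply K L0]
    exact Φ.commutes k
  obtain ⟨H, hH⟩ := IsLocalization.exist_integer_multiples_of_finset (nonZeroDivisors R)
    ((Finset.univ.image (fun i => Ψ (τ i))) ∪ (Finset.univ.image (fun i => Ψ (θ i))))
  have hHne : (H : R) ≠ 0 := nonZeroDivisors.ne_zero H.2
  have hUe : ∀ i, ∃ a : R, algebraMap R F a = algebraMap R F H * Ψ (τ i) := by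
    intro k
    obtain ⟨a, ha⟩ := hH (Ψ (τ k)) (by simp)
    exact ⟨a, by rw [ha, Algebra.smul_def]⟩
  have hVe : ∀ i, ∃ a : R, algebraMap R F a = algebraMap R F H * Ψ (θ i) := by
    intro k
    obtain ⟨a, ha⟩ := hH (Ψ (θ k)) (by simp)
    exact ⟨a, by rw [ha, Algebra.smul_def]⟩
  choose U hU using hUe
  choose V hV using hVe
  have hHF : algebraMap R F H ≠ 0 := (map_ne_zero_iff _ hinjF).2 hHne
  have hUi0 : U i0 = H := by
    apply hinjF
    rw [hU, hτ, map_one, mul_one]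
  obtain ⟨A, hA1, hA2⟩ := specialize j hj r s Φ τ H hHne U hU
  -- clear denominators
  obtain ⟨k, hk⟩ : ∃ k : ℕ, ∀ j, 0 ≤ w j + k - 1 := by
    refine ⟨(∑ j, |w j|).toNat + 1, fun j => ?_⟩
    have h1 := Finset.single_le_sum (f := fun j => |w j|) (fun i _ => abs_nonneg (w i))
      (Finset.mem_univ j)
    have h2 := neg_abs_le (w j)
    have h3 := Int.self_le_toNat (∑ j, |w j|)
    push_cast
    linarith
  set y : Fin 3 → R := fun j => (H : R) ^ (w j + k - 1).toNat * V j with hy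
  set l : Fˣ := Units.mk0 _ hHF with hl
  have hyF : ∀ j, algebraMap R F (y j) = ((l ^ w j : Fˣ) : F) * ((l ^ k : Fˣ) : F) * Ψ (θ j) := by
    intro j
    rw [hy]
    simp only [map_mul, map_pow, hV, Units.val_zpow_eq_zpow_val, Units.val_pow_eq_pow_val, hl,
      Units.val_mk0]
    rw [← zpow_natCast, Int.toNat_of_nonneg (hk j), ← zpow_natCast _ k, ← zpow_add₀ hHF,
      ← mul_assoc, ← zpow_add_one₀ hHF]
    congr 2
    ring
  have hgR : g.eval₂ (C : K →+* R) (Sum.elim U y) = 0 := by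
    apply hinjF
    rw [map_zero, MvPolynomial.hom_eval₂]
    have h1 := hg.scale (algebraMap K F) l (l ^ k) (fun i => Ψ (τ i)) (fun i => Ψ (θ i))
    have h2 := congrArg Ψ h0
    rw [map_zero, MvPolynomial.hom_eval₂, hΨK] at h2
    have h3 : (fun i => Ψ (Sum.elim τ θ i)) = Sum.elim (fun i => Ψ (τ i)) (fun i => Ψ (θ i)) := by
      funext b; rcases b with b | b <;> rfl
    rw [h3] at h2
    rw [h2, mul_zero] at h1
    rw [← h1]
    have h4 : (algebraMap R F).comp C = algebraMap K F := by
      rw [← MvPolynomial.algebraMap_eq, ← IsScalarTower.algebraMap_eq]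
    rw [h4]
    congr 1
    funext b
    rcases b with b | b
    · simp only [Function.comp_apply, Sum.elim_inl, hU]
      rfl
    · simp only [Function.comp_apply, Sum.elim_inr, hyF]
  obtain ⟨j0, hj0⟩ := Function.ne_iff.1 hθ
  have hyj0 : y j0 ≠ 0 := by
    intro h
    have h1 := hyF j0
    rw [h, map_zero] at h1
    have h2 := mul_ne_zero (mul_ne_zero (Units.ne_zero (l ^ w j0)) (Units.ne_zero (l ^ k)))
      ((map_ne_zero_iff Ψ hΨinj).2 hj0)
    exact h2 h1.symm
  obtain ⟨B, hB⟩ : ∃ B : Fin s → K, eval B ((H : R) * y j0) ≠ 0 := by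
    by_contra hcon
    push Not at hcon
    exact mul_ne_zero hHne hyj0 (MvPolynomial.funext (by simpa using hcon))
  rw [map_mul] at hB
  -- the path
  set φ := j.comp (algebraMap K L0) with hφ
  set Q := FractionRing (Polynomial L)
  set c := algebraMap (Polynomial L) Q with hcdef
  have hcinj : Function.Injective c := IsFractionRing.injective _ Q
  have hc : c (1 + Polynomial.X) ≠ 0 := by
    rw [map_ne_zero_iff c hcinj]
    intro h
    have := congrArg (fun p => Polynomial.coeff p 1) h
    simp [Polynomial.coeff_one] at this
  set M : ℕ := ∑ i, (U i).totalDegree with hM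
  have hMle : ∀ i, (U i).totalDegree ≤ M := fun i =>
    Finset.single_le_sum (f := fun i => (U i).totalDegree) (fun _ _ => Nat.zero_le _)
      (Finset.mem_univ i)
  choose u hu1 hu2 hu3 hu4 using fun i => homz φ A B (U i) M (hMle i) c hc
  obtain ⟨M', hM'⟩ : ∃ M' : ℕ, ∀ j, ((y j).totalDegree : ℤ) ≤ M * w j + M' := by
    refine ⟨(∑ j, (|(M : ℤ) * w j| + (y j).totalDegree)).toNat, fun j => ?_⟩
    have h1 := Finset.single_le_sum (f := fun j => (|(M : ℤ) * w j| + (y j).totalDegree))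
      (fun i _ => by positivity) (Finset.mem_univ j)
    have h2 := neg_abs_le ((M : ℤ) * w j)
    have h3 := Int.self_le_toNat (∑ j, (|(M : ℤ) * w j| + ((y j).totalDegree : ℤ)))
    linarith
  have hMj : ∀ j, (y j).totalDegree ≤ (M * w j + M').toNat := fun j => by
    have := hM' j; omega
  choose x hx1 hx2 hx3 hx4 using fun j => homz φ A B (y j) _ (hMj j) c hc
  refine ⟨M, u, x, fun i => eval B (U i), H.1.eval₂ φ A, ?_, ?_, hA1, ?_, ?_, hu1, ?_⟩
  · intro h
    have h1 := hx2 j0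
    rw [h] at h1
    simp only [Pi.zero_apply, Polynomial.coeff_zero] at h1
    exact right_ne_zero_of_mul hB ((map_eq_zero φ).1 h1.symm)
  · intro h
    have := congrFun h i0
    simp only [hUi0] at this
    exact left_ne_zero_of_mul hB this
  · apply hcinj
    rw [map_zero, MvPolynomial.hom_eval₂]
    set v : Fin s → Q := (fun k => c (Polynomial.C (φ (B k)) + Polynomial.C (A k) * Polynomial.X) /
          c (1 + Polynomial.X)) with hv
    set l' : Qˣ := Units.mk0 _ hc with hl'
    have h1 := hg.scale ((c.comp Polynomial.C).comp φ) (l' ^ M) (l' ^ M')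
      (fun i => (U i).eval₂ ((c.comp Polynomial.C).comp φ) v)
      (fun i => (y i).eval₂ ((c.comp Polynomial.C).comp φ) v)
    have h2 := congrArg (MvPolynomial.eval₂Hom ((c.comp Polynomial.C).comp φ) v) hgR
    rw [map_zero, MvPolynomial.hom_eval₂] at h2
    have h3 : (MvPolynomial.eval₂Hom ((c.comp Polynomial.C).comp φ) v).comp C =
      (c.comp Polynomial.C).comp φ := by
      ext a; simp
    have h4 : (fun i => (MvPolynomial.eval₂Hom ((c.comp Polynomial.C).comp φ) v) (Sum.elim U y i)) =
        Sum.elim (fun i => (U i).eval₂ ((c.comp Polynomial.C).comp φ) v)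
          (fun i => (y i).eval₂ ((c.comp Polynomial.C).comp φ) v) := by
      funext b; rcases b with b | b <;> rfl
    rw [h3, h4] at h2
    rw [h2, mul_zero] at h1
    rw [← h1, RingHom.comp_assoc]
    congr 1
    funext b
    rcases b with b | b
    · simp only [Function.comp_apply, Sum.elim_inl, hu4, Units.val_pow_eq_pow_val]
      rfl
    · simp only [Function.comp_apply, Sum.elim_inr, hx4, Units.val_pow_eq_pow_val,
        Units.val_zpow_eq_zpow_val, hl', Units.val_mk0]
      congr 1
      have h5 : 0 ≤ (M : ℤ) * w b + M' := by have := hM' b; omega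
      rw [← zpow_natCast, Int.toNat_of_nonneg h5, zpow_add₀ hc, zpow_mul, zpow_natCast, zpow_natCast]
  · intro i
    exact hu2 i
  · intro i
    rw [hu3, hA2]

end CBProof

namespace CBProof

/-- Single out the variable `v`. -/
noncomputable def Ez {σ : Type*} [DecidableEq σ] (v : σ) (R : Type*) [CommRing R] :
    MvPolynomial σ R ≃ₐ[R] Polynomial (MvPolynomial {b : σ // b ≠ v} R) :=
  (renameEquiv R (Equiv.optionSubtypeNe v).symm).trans (optionEquivLeft R _)

section Ez
variable {σ : Type*} [DecidableEq σ] (v : σ) {R : Type*} [CommRing R]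

theorem Ez_self : Ez v R (X v) = Polynomial.X := by
  simp [Ez]

theorem Ez_ne {b : σ} (h : b ≠ v) : Ez v R (X b) = Polynomial.C (X ⟨b, h⟩) := by
  simp [Ez, Equiv.optionSubtypeNe_symm_of_ne h]

theorem Ez_C (a : R) : Ez v R (C a) = Polynomial.C (C a) := by
  simp [Ez]

theorem Ez_map {S : Type*} [CommRing S] (φ : R →+* S) (P : MvPolynomial σ R) :
    Ez v S (MvPolynomial.map φ P) = (Ez v R P).map (MvPolynomial.map φ) := by
  have : ((Ez v S).toRingEquiv.toRingHom.comp
      (MvPolynomial.map φ : MvPolynomial σ R →+* MvPolynomial σ S)) =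
      (Polynomial.mapRingHom (MvPolynomial.map φ)).comp (Ez v R).toRingEquiv.toRingHom := by
    apply MvPolynomial.ringHom_ext
    · intro a
      simp [Ez_C]
    · intro b
      by_cases h : b = v
      · subst h; simp [Ez_self]
      · simp [Ez_ne v h]
  exact DFunLike.congr_fun this P

end Ez

section
variable {R : Type*} [CommRing R] {n : ℕ} (G : GData n)

theorem Gev_x (u : Fin n → R) (x y z e : R) : Gev G u (x + e) y z =
    Gev G u x y z + (∏ i, u i ^ G.α i) * Pf G.r' u * (2 * x * e + e ^ 2) +
      (∏ i, u i ^ G.κ i) * e * y := by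
  unfold Gev; ring

theorem Gev_y (u : Fin n → R) (x y z e : R) : Gev G u x (y + e) z =
    Gev G u x y z + (∏ i, u i ^ G.β i) * Pf G.r u * (2 * y * e + e ^ 2) +
      (∏ i, u i ^ G.κ i) * x * e := by
  unfold Gev; ring

theorem Gev_z (u : Fin n → R) (x y z : R) : Gev G u x y z =
    Gev G u x y 0 + (∏ i, u i ^ G.γ i) * z ^ 2 := by
  unfold Gev; ring

end

theorem dual_sq {R : Type*} [CommRing R] (h2 : (2 : R) = 0) (a : DualNumber R) :
    a ^ 2 = TrivSqZeroExt.inl (a.fst ^ 2) := by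
  ext
  · simp
  · simp only [pow_two, TrivSqZeroExt.snd_mul, TrivSqZeroExt.snd_inl, smul_eq_mul,
      MulOpposite.smul_eq_mul_unop, MulOpposite.unop_op]
    linear_combination (a.fst * a.snd) * h2

/-- Derivations over the integers. -/
abbrev IDer (F : Type*) [CommRing F] := Derivation ℤ F F

theorem deriv_of_dual {F : Type*} [Field F] (T : F →+* DualNumber F) (h : ∀ a, (T a).fst = a) :
    ∃ D : IDer F, ∀ a, D a = (T a).snd := by
  refine ⟨Derivation.mk'
    { toFun := fun a => (T a).snd, map_add' := by simp, map_smul' := ?_ } ?_, ?_⟩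
  · intro m x
    rw [zsmul_eq_mul, map_mul, map_intCast]
    simp [TrivSqZeroExt.snd_mul]
  · intro a b
    simp [TrivSqZeroExt.snd_mul, h, mul_comm]
  · intro a; rfl

theorem not_sq {k : Type*} [Field k] [CharP k 2] {n : ℕ} (G : GData n) {vars : Type*}
    [DecidableEq vars]
    (fu : Fin n → vars) (fx fy : vars) (hx : ∀ i, fu i ≠ fx) (hxy : fx ≠ fy)
    (a b : MvPolynomial vars k) (hb : b ≠ 0) :
    (∏ i, (X (fu i) : MvPolynomial vars k) ^ G.γ i) * a ^ 2 ≠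
      Gev G (fun i => X (fu i)) (X fx) (X fy) 0 * b ^ 2 := by
  intro h
  set R := MvPolynomial vars k
  have h2 : (2 : R) = 0 := by
    have : (2 : k) = 0 := by exact_mod_cast CharP.cast_eq_zero k 2
    rw [← map_ofNat (C : k →+* R), this, map_zero]
  set T : R →+* DualNumber R := MvPolynomial.eval₂Hom
    ((TrivSqZeroExt.inlHom R R).comp (C : k →+* R))
    (fun b => TrivSqZeroExt.inl (X b) + if b = fx then TrivSqZeroExt.inr 1 else 0) with hT
  have hTx : ∀ b, T (X b) = TrivSqZeroExt.inl (X b) + if b = fx then TrivSqZeroExt.inr 1 else 0 := by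
    intro b; rw [hT]; exact MvPolynomial.eval₂Hom_X' _ _ _
  have hTu : ∀ i, T (X (fu i)) = TrivSqZeroExt.inl (X (fu i)) := by
    intro b; rw [hTx, if_neg (hx b), add_zero]
  have hfst : ∀ P, (T P).fst = P := by
    have : ((TrivSqZeroExt.fstHom R R R : DualNumber R →ₐ[R] R) : DualNumber R →+* R).comp T =
        RingHom.id R := by
      apply MvPolynomial.ringHom_ext
      · intro a; simp [hT]
      · intro b
        simp only [RingHom.comp_apply, hTx]
        split_ifs <;> simp <;> rfl
    intro P
    exact DFunLike.congr_fun this P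
  have h3 := congrArg (fun P => (T P).snd) h
  simp only [map_mul, map_prod, map_pow, map_Gev, map_zero] at h3
  rw [dual_sq h2, dual_sq h2] at h3
  simp only [hTu, hTx fx, hTx fy, if_true, if_neg hxy.symm, add_zero] at h3
  rw [Gev_x] at h3
  have e1 : Gev G (fun i => (TrivSqZeroExt.inl (X (fu i)) : DualNumber R)) (TrivSqZeroExt.inl (X fx))
      (TrivSqZeroExt.inl (X fy)) 0 =
      TrivSqZeroExt.inl (Gev G (fun i => X (fu i)) (X fx) (X fy) 0) := by
    have := map_Gev (TrivSqZeroExt.inlHom R R) G (fun i => X (fu i)) (X fx) (X fy) 0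
    rw [map_zero] at this
    exact this.symm
  have e2 : ∀ c : Fin n → ℕ, (∏ i, (TrivSqZeroExt.inl (X (fu i)) : DualNumber R) ^ c i) =
      TrivSqZeroExt.inl (∏ i, X (fu i) ^ c i) := by
    intro c
    have := map_prod (TrivSqZeroExt.inlHom R R) (fun i => (X (fu i) : R) ^ c i) Finset.univ
    simp only [map_pow] at this
    exact this.symm
  have e3 : (2 : DualNumber R) = 0 := by
    have := congrArg (TrivSqZeroExt.inlHom R R) h2
    rwa [map_ofNat, map_zero] at this
  have e4 : (TrivSqZeroExt.inr 1 : DualNumber R) ^ 2 = 0 := by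
    rw [pow_two, TrivSqZeroExt.inr_mul_inr]
  rw [e1] at h3
  simp only [e2, e3, e4] at h3
  simp only [zero_mul, add_zero, mul_zero] at h3
  simp only [TrivSqZeroExt.snd_mul, TrivSqZeroExt.snd_add, TrivSqZeroExt.snd_inl, 
    TrivSqZeroExt.fst_inl, TrivSqZeroExt.fst_inr, TrivSqZeroExt.snd_inr, 
      smul_eq_mul, MulOpposite.smul_eq_mul_unop, MulOpposite.unop_op, hfst, smul_zero, zero_add, add_zero,
      mul_zero, zero_mul, mul_one] at h3
  have h4 : (∏ i, (X (fu i) : R) ^ G.κ i) ≠ 0 :=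
    Finset.prod_ne_zero_iff.2 fun i _ => pow_ne_zero _ (X_ne_zero _)
  exact mul_ne_zero (mul_ne_zero h4 (X_ne_zero fy)) (pow_ne_zero 2 hb) (by rw [h3])

theorem exists_F0 {k : Type} [Field k] [CharP k 2] {n : ℕ} (G : GData n) (p q r : Fin 3)
    (hqp : q ≠ p) (hrp : r ≠ p) (hqr : q ≠ r) (i0 : Fin n) :
    ∃ (F : Type) (_ : Field F) (π : MvPolynomial (Fin n ⊕ Fin 3) k →+* F)
      (D : Fin n → IDer F), D i0 = 0 ∧
      π (Gev G (fun i => X (Sum.inl i)) (X (Sum.inr q)) (X (Sum.inr r)) (X (Sum.inr p))) = 0 ∧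
      (∀ P, P ≠ 0 → (Ez (Sum.inr p) k P).natDegree ≤ 1 → π P ≠ 0) ∧
      (∀ f, ∃ a b, π b ≠ 0 ∧ f * π b = π a) ∧
      (Wmat D (Pi.single i0 1) (fun i => π (X (Sum.inl i)))).det ≠ 0 := by
  classical
  set vars := {b : Fin n ⊕ Fin 3 // b ≠ Sum.inr p}
  set R := MvPolynomial vars k
  set K0 := FractionRing R
  have hinj : Function.Injective (algebraMap R K0) := IsFractionRing.injective R K0
  set fu : Fin n → vars := fun i => ⟨Sum.inl i, by simp⟩ with hfu
  set fx : vars := ⟨Sum.inr q, by simpa using hqp⟩ with hfx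
  set fy : vars := ⟨Sum.inr r, by simpa using hrp⟩ with hfy
  have hux : ∀ i, fu i ≠ fx := by intro i h; have := congrArg Subtype.val h; simp [hfu, hfx] at this
  have huy : ∀ i, fu i ≠ fy := by intro i h; have := congrArg Subtype.val h; simp [hfu, hfy] at this
  have hxy : fx ≠ fy := by
    intro h; have := congrArg Subtype.val h; simp [hfx, hfy] at this; exact hqr this
  have hvars : ∀ b : vars, (∃ i, b = fu i) ∨ b = fx ∨ b = fy := by
    rintro ⟨b | b, hb⟩
    · exact Or.inl ⟨b, rfl⟩
    · right
      have hb' : b ≠ p := by simpa using hb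
      have : b = q ∨ b = r := by omega
      rcases this with rfl | rfl
      · exact Or.inl rfl
      · exact Or.inr rfl
  set uγ : R := ∏ i, (X (fu i) : R) ^ G.γ i with huγ
  have huγ0 : uγ ≠ 0 := Finset.prod_ne_zero_iff.2 fun i _ => pow_ne_zero _ (X_ne_zero _)
  set NP : R := Gev G (fun i => X (fu i)) (X fx) (X fy) 0 with hNP
  have h2R : (2 : K0) = 0 := by
    have : (2 : k) = 0 := by exact_mod_cast CharP.cast_eq_zero k 2
    rw [← map_ofNat (algebraMap k K0), this, map_zero]
  set ψ : K0 := algebraMap R K0 NP / algebraMap R K0 uγ with hψ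
  have huγK : algebraMap R K0 uγ ≠ 0 := (map_ne_zero_iff _ hinj).2 huγ0
  have hnsq : ∀ ρ : K0, ρ ^ 2 ≠ ψ := by
    intro ρ h
    obtain ⟨⟨a, b⟩, hab⟩ := IsLocalization.surj (nonZeroDivisors R) ρ
    simp only at hab
    have hb : (b : R) ≠ 0 := nonZeroDivisors.ne_zero b.2
    apply not_sq G fu fx fy hux hxy a b hb
    apply hinj
    rw [map_mul, map_mul, map_pow, map_pow, ← hab, mul_pow, h, hψ]
    change algebraMap R K0 uγ * _ = algebraMap R K0 NP * _
    rw [← mul_assoc, mul_div_cancel₀ _ huγK]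
  set f : Polynomial K0 := Polynomial.X ^ 2 - Polynomial.C ψ with hf
  have hirr : Irreducible f := X_pow_sub_C_irreducible_of_prime Nat.prime_two hnsq
  haveI : Fact (Irreducible f) := ⟨hirr⟩
  set F := AdjoinRoot f
  set z : F := AdjoinRoot.root f with hz
  have hz2 : z ^ 2 = algebraMap K0 F ψ := by
    have := AdjoinRoot.eval₂_root f
    rw [hf] at this
    simp only [Polynomial.eval₂_sub, Polynomial.eval₂_pow, Polynomial.eval₂_X,
      Polynomial.eval₂_C] at this
    exact sub_eq_zero.1 this
  set iR : R →+* F := (algebraMap K0 F).comp (algebraMap R K0) with hiR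
  have hiRinj : Function.Injective iR := (algebraMap K0 F).injective.comp hinj
  set π : MvPolynomial (Fin n ⊕ Fin 3) k →+* F :=
    (Polynomial.eval₂RingHom iR z).comp (Ez (Sum.inr p) k).toRingEquiv.toRingHom with hπ
  have hπX : ∀ b : vars, π (X b.1) = iR (X b) := by
    intro b
    simp [hπ, Ez_ne _ b.2]
  have hπz : π (X (Sum.inr p)) = z := by
    simp [hπ, Ez_self]
  have hzeq : iR NP + iR uγ * z ^ 2 = 0 := by
    have h3 : iR NP = iR uγ * z ^ 2 := by
      rw [hz2, hψ, hiR]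
      simp only [RingHom.comp_apply]
      rw [← map_mul, mul_div_cancel₀ _ huγK]
    have h4 : (2 : F) = 0 := by
      rw [← map_ofNat (algebraMap K0 F), h2R, map_zero]
    rw [h3]
    linear_combination (iR uγ * z ^ 2) * h4
  have h2F : (2 : F) = 0 := by
    rw [← map_ofNat (algebraMap K0 F), h2R, map_zero]
  have hNPF : iR NP = Gev G (fun i => iR (X (fu i))) (iR (X fx)) (iR (X fy)) 0 := by
    rw [hNP, map_Gev, map_zero]
  have huγF : iR uγ = ∏ i, iR (X (fu i)) ^ G.γ i := by
    rw [huγ, map_prod]; simp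
  have hGF : Gev G (fun i => iR (X (fu i))) (iR (X fx)) (iR (X fy)) z = 0 := by
    rw [Gev_z, ← hNPF, ← huγF, hzeq]
  have hXne : ∀ b : vars, iR (X b) ≠ 0 := fun b => (map_ne_zero_iff _ hiRinj).2 (X_ne_zero b)
  -- derivations
  have hder : ∀ j : Fin n, ∃ D : IDer F, ∀ i, D (iR (X (fu i))) =
      if i = j then iR (X (fu i)) else 0 := by
    intro j
    set inl : F →+* DualNumber F := TrivSqZeroExt.inlHom F F with hinl
    set uu : Fin n → DualNumber F := fun i => inl (iR (X (fu i))) +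
      TrivSqZeroExt.inr (if i = j then iR (X (fu i)) else 0) with huu
    have hker : ∀ a b : F, (TrivSqZeroExt.inr a : DualNumber F) * TrivSqZeroExt.inr b = 0 :=
      fun a b => TrivSqZeroExt.inr_mul_inr _ _ _
    obtain ⟨s, hs⟩ : ∃ s : F, Gev G uu (inl (iR (X fx))) (inl (iR (X fy))) (inl z) =
        TrivSqZeroExt.inr s := by
      refine ⟨(Gev G uu (inl (iR (X fx))) (inl (iR (X fy))) (inl z)).snd, ?_⟩
      ext
      · rw [TrivSqZeroExt.fst_inr]
        have h5 := map_Gev ((TrivSqZeroExt.fstHom F F F : DualNumber F →ₐ[F] F) : DualNumber F →+* F) G uu (inl (iR (X fx))) (inl (iR (X fy))) (inl z)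
        rw [← hGF]
        refine Eq.trans h5 ?_
        simp [huu, hinl]
      · simp
    set θ : F := - s / ((∏ i, iR (X (fu i)) ^ G.κ i) * iR (X fx)) with hθ
    set yy : DualNumber F := inl (iR (X fy)) + TrivSqZeroExt.inr θ with hyy
    have hG0 : Gev G uu (inl (iR (X fx))) yy (inl z) = 0 := by
      rw [hyy, Gev_y, hs]
      have e3 : (2 : DualNumber F) = 0 := by
        have := congrArg inl h2F
        rwa [map_ofNat, map_zero] at this
      rw [e3, pow_two, hker]
      have e5 : (∏ i, uu i ^ G.κ i).fst = ∏ i, iR (X (fu i)) ^ G.κ i := by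
        have h5 := map_prod ((TrivSqZeroExt.fstHom F F F : DualNumber F →ₐ[F] F) : DualNumber F →+* F)
          (fun i => uu i ^ G.κ i) Finset.univ
        refine Eq.trans h5 ?_
        refine Finset.prod_congr rfl fun i _ => ?_
        rw [map_pow]
        simp [huu, hinl]
      have e6 : (∏ i, iR (X (fu i)) ^ G.κ i) ≠ 0 :=
        Finset.prod_ne_zero_iff.2 fun i _ => pow_ne_zero _ (hXne _)
      have e7 := hXne fx
      ext
      · simp
      · simp only [TrivSqZeroExt.snd_add, TrivSqZeroExt.snd_mul, TrivSqZeroExt.snd_inr,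
          TrivSqZeroExt.fst_inr, TrivSqZeroExt.fst_mul, e5, smul_eq_mul,
          MulOpposite.smul_eq_mul_unop, MulOpposite.unop_op, hinl, TrivSqZeroExt.inlHom_apply,
          TrivSqZeroExt.fst_inl, TrivSqZeroExt.snd_zero, zero_mul, mul_zero, smul_zero, add_zero, hθ]
        rw [mul_div_cancel₀ _ (mul_ne_zero e6 e7), add_neg_cancel]
    -- the hom
    set t : vars → DualNumber F := fun b =>
      if h : ∃ i, b = fu i then uu h.choose else if b = fx then inl (iR (X fx)) else yy with ht
    have htu : ∀ i, t (fu i) = uu i := by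
      intro i
      have h : ∃ i', fu i = fu i' := ⟨i, rfl⟩
      have h' : i = h.choose := by
        have := congrArg Subtype.val h.choose_spec
        simpa [hfu] using this
      rw [ht]
      simp only
      rw [dif_pos h, ← h']
    have htx : t fx = inl (iR (X fx)) := by
      rw [ht]
      simp only
      rw [dif_neg (by rintro ⟨i, h⟩; exact hux i h.symm)]
      simp
    have hty : t fy = yy := by
      rw [ht]
      simp only
      rw [dif_neg (by rintro ⟨i, h⟩; exact huy i h.symm), if_neg hxy.symm]
    set T0 : R →+* DualNumber F := MvPolynomial.eval₂Hom (inl.comp (iR.comp C)) t with hT0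
    have hT0X : ∀ b, T0 (X b) = t b := by intro b; rw [hT0]; exact MvPolynomial.eval₂Hom_X' _ _ _
    set fst : DualNumber F →+* F := ((TrivSqZeroExt.fstHom F F F : DualNumber F →ₐ[F] F) : DualNumber F →+* F) with hfst
    have hfa : ∀ a, fst a = a.fst := fun a => rfl
    have hfT0 : fst.comp T0 = iR := by
      apply MvPolynomial.ringHom_ext
      · intro a; simp [hT0, hfa, hinl]
      · intro b
        rw [RingHom.comp_apply, hT0X]
        rcases hvars b with ⟨i, rfl⟩ | rfl | rfl
        · rw [htu, huu, hfa]; simp [hinl]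
        · rw [htx, hfa]; simp [hinl]
        · rw [hty, hyy, hfa]; simp [hinl]
    have hunit : ∀ b : nonZeroDivisors R, IsUnit (T0 b) := by
      intro b
      rw [TrivSqZeroExt.isUnit_iff_isUnit_fst, isUnit_iff_ne_zero]
      have : (T0 b.1).fst = iR b.1 := DFunLike.congr_fun hfT0 b.1
      rw [this, map_ne_zero_iff _ hiRinj]
      exact nonZeroDivisors.ne_zero b.2
    set T1 : K0 →+* DualNumber F := IsLocalization.lift hunit with hT1
    have hT1a : ∀ a, T1 (algebraMap R K0 a) = T0 a := fun a => IsLocalization.lift_eq _ _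
    have hfT1 : fst.comp T1 = algebraMap K0 F := by
      apply IsLocalization.ringHom_ext (nonZeroDivisors R)
      refine RingHom.ext fun a => ?_
      simp only [RingHom.comp_apply, hT1a]
      exact DFunLike.congr_fun hfT0 a
    have hroot : Polynomial.eval₂ T1 (inl z) f = 0 := by
      change Polynomial.eval₂ T1 (inl z) (Polynomial.X ^ 2 - Polynomial.C ψ) = 0
      simp only [Polynomial.eval₂_sub, Polynomial.eval₂_pow, Polynomial.eval₂_X,
        Polynomial.eval₂_C]
      have hu := hunit ⟨uγ, mem_nonZeroDivisors_of_ne_zero huγ0⟩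
      apply hu.mul_left_cancel
      rw [mul_zero, mul_sub]
      simp only
      have h5 : T0 uγ * T1 ψ = T0 NP := by
        rw [← hT1a, ← hT1a, ← map_mul, hψ, mul_div_cancel₀ _ huγK]
      rw [h5]
      have h6 : T0 NP = Gev G uu (inl (iR (X fx))) yy 0 := by
        rw [hNP, map_Gev, map_zero]
        simp only [hT0X, htu, htx, hty]
      have h7 : T0 uγ = ∏ i, uu i ^ G.γ i := by
        rw [huγ, map_prod]
        simp only [map_pow, hT0X, htu]
      rw [Gev_z, ← h6, ← h7] at hG0
      have e3 : (2 : DualNumber F) = 0 := by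
        have := congrArg inl h2F
        rwa [map_ofNat, map_zero] at this
      linear_combination hG0 - (T0 NP) * e3
    set T : F →+* DualNumber F := AdjoinRoot.lift T1 (inl z) hroot with hT
    have hTa : ∀ a, T (algebraMap K0 F a) = T1 a := fun a => AdjoinRoot.lift_of _
    have hfT : ∀ a, (T a).fst = a := by
      have : fst.comp T = RingHom.id F := by
        apply AdjoinRoot.ringHom_ext
        · ext1 a
          rw [RingHom.comp_apply, RingHom.comp_apply]
          change fst (T (algebraMap K0 F a)) = _
          rw [hTa]
          exact DFunLike.congr_fun hfT1 a
        · rw [RingHom.comp_apply, hT, AdjoinRoot.lift_root, hfa]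
          simp [hinl, hz]
          rfl
      exact fun a => DFunLike.congr_fun this a
    obtain ⟨D, hD⟩ := deriv_of_dual T hfT
    refine ⟨D, ?_⟩
    · intro i
      have : T (iR (X (fu i))) = uu i := by
        rw [hiR, RingHom.comp_apply, hTa, hT1a, hT0X, htu]
      rw [hD, this, huu]
      simp [hinl]
  choose D hD using hder
  refine ⟨F, inferInstance, π, fun j => if j = i0 then 0 else D j, by simp, ?_, ?_, ?_, ?_⟩
  · rw [map_Gev, hπz]
    have e1 := hπX fx
    have e2 := hπX fy
    have e3 : ∀ i, π (X (Sum.inl i)) = iR (X (fu i)) := fun i => hπX (fu i)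
    simp only [hfx, hfy] at e1 e2
    simp only [e1, e2, e3]
    exact hGF
  · intro P hP hdeg h0
    obtain ⟨b, a, hab⟩ := Polynomial.exists_eq_X_add_C_of_natDegree_le_one hdeg
    have h1 : iR b * z + iR a = 0 := by
      have : π P = iR b * z + iR a := by
        rw [hπ, RingHom.comp_apply]
        change Polynomial.eval₂RingHom iR z (Ez (Sum.inr p) k P) = _
        rw [hab]
        simp
      rw [← this, h0]
    rcases eq_or_ne b 0 with hb | hb
    · rw [hb, map_zero, zero_mul, zero_add, map_eq_zero_iff _ hiRinj] at h1
      rw [hb, h1] at hab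
      simp only [map_zero, zero_mul, add_zero] at hab
      exact hP ((map_eq_zero_iff _ (Ez (Sum.inr p) k).injective).1 hab)
    · have hbK : algebraMap R K0 b ≠ 0 := (map_ne_zero_iff _ hinj).2 hb
      apply hnsq (algebraMap R K0 a / algebraMap R K0 b)
      apply (algebraMap K0 F).injective
      rw [← hz2, map_pow, map_div₀]
      have hbF : iR b ≠ 0 := (map_ne_zero_iff _ hiRinj).2 hb
      change (iR a / iR b) ^ 2 = z ^ 2
      rw [div_pow, div_eq_iff (pow_ne_zero 2 hbF)]
      have : iR a = - (iR b * z) := by linear_combination h1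
      rw [this]; ring
  · intro x
    obtain ⟨P, rfl⟩ := AdjoinRoot.mk_surjective x
    -- reduce to linear combinations
    have hK : ∀ c : K0, ∃ a b, π b ≠ 0 ∧ algebraMap K0 F c * π b = π a := by
      intro c
      obtain ⟨⟨a, b⟩, hab⟩ := IsLocalization.surj (nonZeroDivisors R) c
      have hre : ∀ P : R, π (MvPolynomial.rename Subtype.val P) = iR P := by
        have : π.comp (MvPolynomial.rename Subtype.val : R →ₐ[k] _) = iR := by
          apply MvPolynomial.ringHom_ext
          · intro a
            simp only [RingHom.comp_apply, RingHom.coe_coe, MvPolynomial.rename_C]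
            simp [hπ, Ez_C]
          · intro b
            simp only [RingHom.comp_apply, RingHom.coe_coe, MvPolynomial.rename_X, hπX]
        intro P
        exact DFunLike.congr_fun this P
      refine ⟨rename Subtype.val a, rename Subtype.val b.1, ?_, ?_⟩
      · rw [hre, map_ne_zero_iff _ hiRinj]
        exact nonZeroDivisors.ne_zero b.2
      · rw [hre, hre, hiR, RingHom.comp_apply, RingHom.comp_apply, ← map_mul, hab]
    induction P using Polynomial.induction_on' with
    | add P Q hP hQ =>
      obtain ⟨a, b, h1, h2⟩ := hP
      obtain ⟨a', b', h1', h2'⟩ := hQ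
      refine ⟨a * b' + a' * b, b * b', by rw [map_mul]; exact mul_ne_zero h1 h1', ?_⟩
      rw [map_add, map_add, map_mul, map_mul, map_mul, ← h2, ← h2']
      ring
    | monomial m c =>
      obtain ⟨a, b, h1, h2⟩ := hK c
      refine ⟨a * X (Sum.inr p) ^ m, b, h1, ?_⟩
      rw [map_mul, ← h2, map_pow, hπz, ← Polynomial.C_mul_X_pow_eq_monomial, map_mul, map_pow]
      have e1 : AdjoinRoot.mk f (Polynomial.C c) = algebraMap K0 F c := rfl
      have e2 : AdjoinRoot.mk f Polynomial.X = z := rfl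
      rw [e1, e2]
      ring
  · have e3 : ∀ i, π (X (Sum.inl i)) = iR (X (fu i)) := fun i => hπX (fu i)
    simp only [e3]
    have : Wmat (fun j => if j = i0 then 0 else D j) (Pi.single i0 1)
        (fun i => iR (X (fu i))) = Matrix.of fun i j => iR (X (fu i)) *
          ((1 : Matrix (Fin n) (Fin n) F).updateCol i0 (fun _ => 1)) i j := by
      ext i j
      simp only [Wmat, Matrix.of_apply, Matrix.updateCol_apply, Pi.single_apply]
      by_cases hj : j = i0
      · simp [hj]
      · simp only [hj, if_false, zero_mul, add_zero, hD, Matrix.one_apply]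
        split_ifs <;> simp
    rw [this, Matrix.det_mul_column, ← Matrix.cramer_apply, Matrix.cramer_one]
    simp only [Module.End.one_apply, mul_one]
    exact Finset.prod_ne_zero_iff.2 fun i _ => hXne _

end CBProof

namespace CBProof

theorem mk_val {A F L : Type*} [CommRing A] [Field F] [Field L] (inc : A →+* L) (red : A →+* F)
    (hker : ∀ a, inc a = 0 → red a = 0)
    (hstar : ∀ l : L, (∃ a b, red b ≠ 0 ∧ l * inc b = inc a) ∨
      (∃ a b, red b ≠ 0 ∧ l⁻¹ * inc b = inc a))
    (hsurj : ∀ f, ∃ a b, red b ≠ 0 ∧ f * red b = red a) :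
    ∃ (O : ValuationSubring L) (hO : ∀ a, inc a ∈ O) (e : IsLocalRing.ResidueField O ≃+* F),
      ∀ a, e (IsLocalRing.residue O ⟨inc a, hO a⟩) = red a := by
  have hinc : ∀ b, red b ≠ 0 → inc b ≠ 0 := fun b hb h => hb (hker b h)
  let O : ValuationSubring L :=
    { carrier := {l | ∃ a b, red b ≠ 0 ∧ l * inc b = inc a}
      mul_mem' := by
        rintro l l' ⟨a, b, hb, h⟩ ⟨a', b', hb', h'⟩
        refine ⟨a * a', b * b', by rw [map_mul]; exact mul_ne_zero hb hb', ?_⟩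
        rw [map_mul, map_mul, ← h, ← h']; ring
      one_mem' := ⟨1, 1, by simp, by simp⟩
      add_mem' := by
        rintro l l' ⟨a, b, hb, h⟩ ⟨a', b', hb', h'⟩
        refine ⟨a * b' + a' * b, b * b', by rw [map_mul]; exact mul_ne_zero hb hb', ?_⟩
        rw [map_mul, map_add, map_mul, map_mul, ← h, ← h']; ring
      zero_mem' := ⟨0, 1, by simp, by simp⟩
      neg_mem' := by
        rintro l ⟨a, b, hb, h⟩
        exact ⟨-a, b, hb, by rw [map_neg, ← h]; ring⟩
      mem_or_inv_mem' := hstar }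
  have hmem : ∀ l : L, l ∈ O ↔ ∃ a b, red b ≠ 0 ∧ l * inc b = inc a := fun l => Iff.rfl
  have hch : ∀ l : O, ∃ a b, red b ≠ 0 ∧ (l : L) * inc b = inc a := fun l => (hmem _).1 l.2
  choose na nb hb hab using hch
  have hwd : ∀ (l : O) (a b : A), red b ≠ 0 → (l : L) * inc b = inc a →
      red (na l) / red (nb l) = red a / red b := by
    intro l a b hb' h
    rw [div_eq_div_iff (hb l) hb', ← map_mul, ← map_mul, ← sub_eq_zero, ← map_sub]
    apply hker
    rw [map_sub, map_mul, map_mul, ← hab, ← h]; ring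
  let ρ : O →+* F :=
    { toFun := fun l => red (na l) / red (nb l)
      map_one' := by rw [hwd 1 1 1 (by simp) (by simp)]; simp
      map_zero' := by rw [hwd 0 0 1 (by simp) (by simp)]; simp
      map_mul' := by
        intro l l'
        rw [hwd (l * l') (na l * na l') (nb l * nb l')
          (by rw [map_mul]; exact mul_ne_zero (hb l) (hb l'))
          (by rw [map_mul, map_mul, ← hab, ← hab]; push_cast; ring)]
        rw [map_mul, map_mul, mul_div_mul_comm]
      map_add' := by
        intro l l'
        rw [hwd (l + l') (na l * nb l' + na l' * nb l) (nb l * nb l')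
          (by rw [map_mul]; exact mul_ne_zero (hb l) (hb l'))
          (by rw [map_mul, map_add, map_mul, map_mul, ← hab, ← hab]; push_cast; ring)]
        rw [map_mul, map_add, map_mul, map_mul, div_add_div _ _ (hb l) (hb l')]
        congr 1; ring }
  have hρ : ∀ (l : O) (a b : A), red b ≠ 0 → (l : L) * inc b = inc a → ρ l = red a / red b := hwd
  have hO : ∀ a, inc a ∈ O := fun a => (hmem _).2 ⟨a, 1, by simp, by simp⟩
  have hloc : IsLocalHom ρ := by
    constructor
    intro l hl
    have h0 : ρ l ≠ 0 := hl.ne_zero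
    rw [hρ l _ _ (hb l) (hab l)] at h0
    have hna : red (na l) ≠ 0 := fun h => h0 (by rw [h, zero_div])
    have hl0 : (l : L) ≠ 0 := by
      intro h
      have := hab l
      rw [h, zero_mul] at this
      exact hinc _ hna this.symm
    have hinv : (l : L)⁻¹ ∈ O := (hmem _).2 ⟨nb l, na l, hna, by
      rw [← hab l]; field_simp⟩
    exact IsUnit.of_mul_eq_one ⟨(l : L)⁻¹, hinv⟩ (Subtype.ext (mul_inv_cancel₀ hl0))
  have hbij : Function.Bijective (IsLocalRing.ResidueField.lift ρ) := by
    refine ⟨RingHom.injective _, fun f => ?_⟩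
    obtain ⟨a, b, h1, h2⟩ := hsurj f
    have hl : inc a / inc b ∈ O := (hmem _).2 ⟨a, b, h1, div_mul_cancel₀ _ (hinc b h1)⟩
    refine ⟨IsLocalRing.residue O ⟨_, hl⟩, ?_⟩
    rw [IsLocalRing.ResidueField.lift_residue_apply]
    rw [hρ _ a b h1 (div_mul_cancel₀ _ (hinc b h1)), ← h2, mul_div_cancel_right₀ _ h1]
  refine ⟨O, hO, RingEquiv.ofBijective _ hbij, fun a => ?_⟩
  rw [RingEquiv.ofBijective_apply, IsLocalRing.ResidueField.lift_residue_apply,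
    hρ _ a 1 (by simp) (by simp)]
  simp

theorem prim_lemma {K σ : Type*} [Field K] (V : ValuationSubring K) (P : MvPolynomial σ K)
    (hP : P ≠ 0) : ∃ (c : K) (P' : MvPolynomial σ V), c ≠ 0 ∧
      P = C c * MvPolynomial.map (algebraMap V K) P' ∧
      MvPolynomial.map (IsLocalRing.residue V) P' ≠ 0 := by
  classical
  obtain ⟨e, he, hmax⟩ := Finset.exists_max_image P.support (fun e => V.valuation (P.coeff e))
    (support_nonempty.2 hP)
  have hc : P.coeff e ≠ 0 := mem_support_iff.1 he
  have hin : C (P.coeff e)⁻¹ * P ∈ Set.range (MvPolynomial.map (σ := σ) (algebraMap V K)) := by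
    rw [mem_range_map_iff_coeffs_subset]
    intro c hc'
    obtain ⟨e', he', rfl⟩ := mem_coeffs_iff.1 hc'
    rw [coeff_C_mul]
    have he'' : e' ∈ P.support := by
      rw [mem_support_iff, coeff_C_mul] at he'
      rw [mem_support_iff]
      exact right_ne_zero_of_mul he'
    have hle := hmax e' he''
    have : (P.coeff e)⁻¹ * P.coeff e' ∈ V := by
      rw [← V.valuation_le_one_iff, map_mul, map_inv₀]
      have h0 : V.valuation (P.coeff e) ≠ 0 := (map_ne_zero _).2 hc
      calc _ ≤ (V.valuation (P.coeff e))⁻¹ * V.valuation (P.coeff e) := by gcongr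
        _ = 1 := inv_mul_cancel₀ h0
    exact ⟨⟨_, this⟩, rfl⟩
  obtain ⟨P', hP'⟩ := hin
  refine ⟨P.coeff e, P', hc, ?_, ?_⟩
  · rw [hP', ← mul_assoc, ← C_mul, mul_inv_cancel₀ hc, C_1, one_mul]
  · intro h0
    have h1 : ((P'.coeff e : V) : K) = 1 := by
      have := congrArg (coeff e) hP'
      rw [coeff_map, coeff_C_mul, inv_mul_cancel₀ hc] at this
      exact this
    have h2 : P'.coeff e = 1 := Subtype.ext h1
    have h3 := congrArg (coeff e) h0
    rw [coeff_map, h2, map_one, coeff_zero] at h3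
    exact one_ne_zero h3

theorem pseudo_div {A : Type*} [CommRing A] (Q : Polynomial A) (hQ : Q.natDegree ≤ 2)
    (f : Polynomial A) : ∃ (N : ℕ) (q r : Polynomial A), r.natDegree ≤ 1 ∧
      Polynomial.C (Q.coeff 2) ^ N * f = Q * q + r := by
  induction f using Polynomial.induction_on with
  | C a => exact ⟨0, 0, Polynomial.C a, by simp, by simp⟩
  | add f g hf hg =>
    obtain ⟨N, q, r, h1, h2⟩ := hf
    obtain ⟨N', q', r', h1', h2'⟩ := hg
    refine ⟨N + N', Polynomial.C (Q.coeff 2) ^ N' * q + Polynomial.C (Q.coeff 2) ^ N * q',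
      Polynomial.C (Q.coeff 2) ^ N' * r + Polynomial.C (Q.coeff 2) ^ N * r', ?_, ?_⟩
    · refine (Polynomial.natDegree_add_le _ _).trans (max_le ?_ ?_)
      · rw [← Polynomial.C_pow]; exact (Polynomial.natDegree_C_mul_le _ _).trans h1
      · rw [← Polynomial.C_pow]; exact (Polynomial.natDegree_C_mul_le _ _).trans h1'
    · linear_combination Polynomial.C (Q.coeff 2) ^ N' * h2 + Polynomial.C (Q.coeff 2) ^ N * h2'
  | monomial m a hf =>
    obtain ⟨N, q, r, h1, h2⟩ := hf
    obtain ⟨r1, r0, hr⟩ := Polynomial.exists_eq_X_add_C_of_natDegree_le_one h1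
    have hQe : Q = Polynomial.C (Q.coeff 2) * Polynomial.X ^ 2 + Polynomial.C (Q.coeff 1) *
        Polynomial.X + Polynomial.C (Q.coeff 0) :=
      Polynomial.eq_quadratic_of_degree_le_two (Polynomial.natDegree_le_iff_degree_le.1 hQ)
    set a2 := Q.coeff 2
    set a1 := Q.coeff 1
    set a0 := Q.coeff 0
    refine ⟨N + 1, Polynomial.C a2 * Polynomial.X * q + Polynomial.C r1,
      Polynomial.C (a2 * r0 - r1 * a1) * Polynomial.X + Polynomial.C (- r1 * a0), ?_, ?_⟩
    · exact Polynomial.natDegree_linear_le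
    · rw [hr] at h2
      simp only [Polynomial.C_sub, Polynomial.C_mul, Polynomial.C_neg]
      linear_combination Polynomial.C a2 * Polynomial.X * h2 - Polynomial.C r1 * hQe

theorem transport_der {A B : Type*} [Field A] [Field B] (e : A ≃+* B) (D : IDer B) :
    ∃ D' : IDer A, ∀ a, e (D' a) = D (e a) := by
  refine ⟨Derivation.mk'
    { toFun := fun a => e.symm (D (e a)), map_add' := by simp, map_smul' := ?_ } ?_, ?_⟩
  · intro m x
    rw [zsmul_eq_mul, map_mul, map_intCast, Derivation.leibniz]
    simp
  · intro a b
    simp [Derivation.leibniz]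
  · intro a
    exact e.apply_symm_apply _

end CBProof

namespace CBProof

/-- coefficient of z² in the reduced polynomial -/
theorem Gev_Ez {k : Type*} [Field k] {n : ℕ} (G : GData n) (p q r : Fin 3)
    (hqp : q ≠ p) (hrp : r ≠ p) :
    (Ez (Sum.inr p) k (Gev G (fun i => X (Sum.inl i)) (X (Sum.inr q)) (X (Sum.inr r))
      (X (Sum.inr p)))).coeff 2 ≠ 0 := by
  have hqp' : (Sum.inr q : Fin n ⊕ Fin 3) ≠ Sum.inr p := by simpa using hqp
  have hrp' : (Sum.inr r : Fin n ⊕ Fin 3) ≠ Sum.inr p := by simpa using hrp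
  have e1 : (Ez (Sum.inr p) k (Gev G (fun i => X (Sum.inl i)) (X (Sum.inr q)) (X (Sum.inr r))
      (X (Sum.inr p)))) = Polynomial.C (Gev G (fun i => X ⟨Sum.inl i, by simp⟩)
        (X ⟨Sum.inr q, hqp'⟩) (X ⟨Sum.inr r, hrp'⟩) 0) +
        Polynomial.C (∏ i, X ⟨Sum.inl i, by simp⟩ ^ G.γ i) * Polynomial.X ^ 2 := by
    have hE : ∀ P, (Ez (Sum.inr p : Fin n ⊕ Fin 3) k).toRingEquiv.toRingHom P =
      Ez (Sum.inr p : Fin n ⊕ Fin 3) k P := fun _ => rfl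
    rw [← hE, map_Gev]
    simp only [hE]
    have hi : ∀ i : Fin n, (Sum.inl i : Fin n ⊕ Fin 3) ≠ Sum.inr p := by simp
    simp only [Ez_ne _ hqp', Ez_ne _ hrp', Ez_ne _ (hi _), Ez_self]
    rw [Gev_z, map_Gev Polynomial.C, map_prod, map_zero]
    simp only [map_pow]
  rw [e1, Polynomial.coeff_add, Polynomial.coeff_C_mul, Polynomial.coeff_X_pow_self, mul_one,
    Polynomial.coeff_C_ne_zero (by norm_num), zero_add]
  exact Finset.prod_ne_zero_iff.2 fun i _ => pow_ne_zero _ (X_ne_zero _)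

theorem core {K : Type} [Field K] [IsAlgClosed K] (hK2 : (2 : K) ≠ 0) (V : ValuationSubring K)
    (hV2 : (IsLocalRing.residue V) 2 = 0) {n : ℕ} (hn : 2 ≤ n) (G : GData n)
    {w : Fin 3 → ℤ} {d : ℤ} (gV : MvPolynomial (Fin n ⊕ Fin 3) V) (hbh : BH w d gV)
    (p q r : Fin 3) (hqp : q ≠ p) (hrp : r ≠ p) (hqr : q ≠ r)
    (hres : MvPolynomial.map (IsLocalRing.residue V) gV =
      Gev G (fun i => X (Sum.inl i)) (X (Sum.inr q)) (X (Sum.inr r)) (X (Sum.inr p)))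
    (hdeg : (Ez (Sum.inr p) V gV).natDegree ≤ 2)
    {L : Type*} [Field L] (ι : MvPolynomial (Fin n ⊕ Fin 3) K →+* L)
    (hι : ∀ P, ι P = 0 ↔ MvPolynomial.map (algebraMap V K) gV ∣ P)
    (hfr : ∀ l : L, ∃ a b, ι b ≠ 0 ∧ l * ι b = ι a) (i0 : Fin n)
    (N : ℕ) (u : Fin n → Polynomial L) (x : Fin 3 → Polynomial L) (b : Fin n → K) (lam : L)
    (hx : x ≠ 0) (hb : b ≠ 0) (hlam : lam ≠ 0)
    (hg : (MvPolynomial.map (algebraMap V K) gV).eval₂ (Polynomial.C.comp (ι.comp C))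
      (Sum.elim u x) = 0)
    (h0 : ∀ i, (u i).coeff 0 = ι (C (b i))) (hN : ∀ i, (u i).natDegree ≤ N)
    (τ : Fin n → L) (hτ : ∀ i, τ i * ι (X (Sum.inl i0)) = ι (X (Sum.inl i)))
    (htop : ∀ i, (u i).coeff N = lam * τ i) : False := by
  set k := IsLocalRing.ResidueField V with hk
  have h2k : (2 : k) = 0 := by rw [← hV2, map_ofNat]
  haveI : CharP k 2 := CharTwo.of_one_ne_zero_of_two_eq_zero one_ne_zero h2k
  obtain ⟨F, _, π, D, hDi0, hπ0, hπ1, hπf, hW⟩ := exists_F0 (k := k) G p q r hqp hrp hqr i0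
  set mapK := MvPolynomial.map (σ := Fin n ⊕ Fin 3) (algebraMap V K) with hmapK
  have hmapKinj : Function.Injective mapK :=
    MvPolynomial.map_injective _ (Subtype.val_injective)
  set mapk := MvPolynomial.map (σ := Fin n ⊕ Fin 3) (IsLocalRing.residue V) with hmapk
  have hmapks : Function.Surjective mapk :=
    MvPolynomial.map_surjective _ IsLocalRing.residue_surjective
  set inc : MvPolynomial (Fin n ⊕ Fin 3) V →+* L := ι.comp mapK with hinc
  set red : MvPolynomial (Fin n ⊕ Fin 3) V →+* F := π.comp mapk with hred
  have hgb0 : mapk gV ≠ 0 := by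
    intro h
    apply Gev_Ez (k := k) G p q r hqp hrp
    rw [← hres, h]; simp
  have hredg : red gV = 0 := by
    rw [hred, RingHom.comp_apply, hres]; exact hπ0
  have hVinv : ∀ c : K, c ∉ V → ∃ c' : V, (c' : K) = c⁻¹ ∧ IsLocalRing.residue V c' = 0 := by
    intro c hc
    have hc1 : c⁻¹ ∈ V := (V.mem_or_inv_mem c).resolve_left hc
    refine ⟨⟨c⁻¹, hc1⟩, rfl, ?_⟩
    rw [IsLocalRing.residue_eq_zero_iff, IsLocalRing.mem_maximalIdeal, mem_nonunits_iff]
    rintro ⟨v, hv⟩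
    apply hc
    have h1 : (v⁻¹ : Vˣ).1.1 * c⁻¹ = 1 := by
      have := congrArg Subtype.val (v.inv_mul)
      rw [hv] at this
      exact this
    have hc0 : c ≠ 0 := by rintro rfl; exact hc V.zero_mem
    have : c = (v⁻¹ : Vˣ).1.1 := by
      field_simp at h1
      exact h1.symm
    rw [this]
    exact (v⁻¹ : Vˣ).1.2
  have hker : ∀ a, inc a = 0 → red a = 0 := by
    intro a ha
    obtain ⟨Q, hQ⟩ := (hι _).1 ha
    rcases eq_or_ne Q 0 with rfl | hQ0
    · rw [mul_zero] at hQ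
      have : a = 0 := hmapKinj (by rw [map_zero]; exact hQ)
      rw [this, map_zero]
    · obtain ⟨c, Q', hc, hQ', hQb⟩ := prim_lemma V Q hQ0
      by_cases hcV : c ∈ V
      · have : a = gV * (C ⟨c, hcV⟩ * Q') := by
          apply hmapKinj
          rw [map_mul, map_mul, hQ, hQ']
          simp [hmapK]
        rw [this, map_mul, hredg, zero_mul]
      · exfalso
        obtain ⟨c', hc', hc'0⟩ := hVinv c hcV
        have : C c' * a = gV * Q' := by
          apply hmapKinj
          rw [map_mul, map_mul, hQ, hQ']
          have h1 : mapK (C c') = C c⁻¹ := by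
            rw [hmapK, MvPolynomial.map_C]; congr 1
          have h2 : (C c⁻¹ : MvPolynomial (Fin n ⊕ Fin 3) K) * C c = 1 := by
            rw [← C_mul, inv_mul_cancel₀ hc, C_1]
          rw [h1]
          linear_combination (mapK gV * mapK Q') * h2
        have h3 := congrArg mapk this
        rw [map_mul, map_mul] at h3
        have h4 : mapk (C c') = 0 := by rw [hmapk, MvPolynomial.map_C, hc'0, C_0]
        rw [h4, zero_mul] at h3
        exact mul_ne_zero hgb0 hQb h3.symm
  have hincne : ∀ b, red b ≠ 0 → inc b ≠ 0 := fun b hb h => hb (hker b h)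
  -- the leading coefficient
  set AV : MvPolynomial (Fin n ⊕ Fin 3) V := (Ez (Sum.inr p) V).symm
    (Polynomial.C ((Ez (Sum.inr p) V gV).coeff 2)) with hAV
  have hEA : Ez (Sum.inr p) V AV = Polynomial.C ((Ez (Sum.inr p) V gV).coeff 2) :=
    AlgEquiv.apply_symm_apply _ _
  have hAred : red AV ≠ 0 := by
    rw [hred, RingHom.comp_apply]
    have h1 : Ez (Sum.inr p) k (mapk AV) =
        Polynomial.C ((Ez (Sum.inr p) k (mapk gV)).coeff 2) := by
      rw [hmapk, Ez_map, hEA, Ez_map, Polynomial.map_C, Polynomial.coeff_map]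
    apply hπ1
    · intro h
      rw [h, map_zero] at h1
      have h2 := Polynomial.C_eq_zero.1 h1.symm
      rw [hres] at h2
      exact Gev_Ez (k := k) G p q r hqp hrp h2
    · rw [h1, Polynomial.natDegree_C]; exact zero_le_one
  have hEAK : Ez (Sum.inr p) K (mapK AV) =
        Polynomial.C ((Ez (Sum.inr p) K (mapK gV)).coeff 2) := by
      rw [hmapK, Ez_map, hEA, Ez_map, Polynomial.map_C, Polynomial.coeff_map]
  have hstarP : ∀ P, ι P ≠ 0 → ∃ c : K, c ≠ 0 ∧ ∃ a b, red a ≠ 0 ∧ red b ≠ 0 ∧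
      ι P * inc b = ι (C c) * inc a := by
    intro P hP
    obtain ⟨M, Q, R, hR, hdiv⟩ := pseudo_div (Ez (Sum.inr p) K (mapK gV))
      (by rw [hmapK, Ez_map]; exact Polynomial.natDegree_map_le.trans hdeg) (Ez (Sum.inr p) K P)
    rw [← hEAK] at hdiv
    set R' := (Ez (Sum.inr p) K).symm R with hR'
    have hER : Ez (Sum.inr p) K R' = R := AlgEquiv.apply_symm_apply _ _
    have hd2 : mapK AV ^ M * P = mapK gV * (Ez (Sum.inr p) K).symm Q + R' := by
      apply (Ez (Sum.inr p) K).injective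
      rw [map_mul, map_pow, hdiv, map_add, map_mul, hER, AlgEquiv.apply_symm_apply]
    have hd3 : inc AV ^ M * ι P = ι R' := by
      have := congrArg ι hd2
      rw [map_mul, map_pow, map_add, map_mul, (hι (mapK gV)).2 dvd_rfl, zero_mul, zero_add] at this
      exact this
    have hR'0 : R' ≠ 0 := by
      intro h
      rw [h, map_zero] at hd3
      exact mul_ne_zero (pow_ne_zero M (hincne _ hAred)) hP hd3
    obtain ⟨c, R1, hc, hR1, hR1b⟩ := prim_lemma V R' hR'0
    refine ⟨c, hc, R1, AV ^ M, ?_, by rw [map_pow]; exact pow_ne_zero _ hAred, ?_⟩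
    · rw [hred, RingHom.comp_apply]
      refine hπ1 _ hR1b ?_
      have h5 : (Ez (Sum.inr p) V R1).natDegree ≤ 1 := by
        have h6 : Function.Injective (MvPolynomial.map (σ := {b : Fin n ⊕ Fin 3 // b ≠ Sum.inr p})
          (algebraMap V K)) := MvPolynomial.map_injective _ (Subtype.val_injective)
        rw [← Polynomial.natDegree_map_eq_of_injective h6, ← Ez_map]
        have h7 : MvPolynomial.map (algebraMap V K) R1 = C c⁻¹ * R' := by
          rw [hR1, ← mul_assoc, ← C_mul, inv_mul_cancel₀ hc, C_1, one_mul]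
        rw [h7, map_mul, Ez_C, hER]
        exact (Polynomial.natDegree_C_mul_le _ _).trans hR
      rw [hmapk, Ez_map]
      exact Polynomial.natDegree_map_le.trans h5
    · rw [map_pow, mul_comm, hd3, hR1, map_mul]; rfl
  have hstar : ∀ l, l ≠ 0 → ∃ c : K, c ≠ 0 ∧ ∃ a b, red a ≠ 0 ∧ red b ≠ 0 ∧
      l * inc b = ι (C c) * inc a := by
    intro l hl
    obtain ⟨P, Q, hQ, hPQ⟩ := hfr l
    have hP : ι P ≠ 0 := by rw [← hPQ]; exact mul_ne_zero hl hQ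
    obtain ⟨c, hc, a, b, ha, hb, h⟩ := hstarP P hP
    obtain ⟨c', hc', a', b', ha', hb', h'⟩ := hstarP Q hQ
    refine ⟨c / c', div_ne_zero hc hc', a * b', b * a', ?_, ?_, ?_⟩
    · rw [map_mul]; exact mul_ne_zero ha hb'
    · rw [map_mul]; exact mul_ne_zero hb ha'
    · have hcc : ι (C (c / c')) * ι (C c') = ι (C c) := by
        rw [← map_mul, ← C_mul, div_mul_cancel₀ _ hc']
      have hιc' : ι (C c') ≠ 0 := by
        intro h7
        rw [h7, zero_mul] at h'
        exact mul_ne_zero hQ (hincne _ hb') h'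
      apply mul_left_cancel₀ hιc'
      rw [map_mul, map_mul]
      linear_combination (-l * inc b) * h' + (inc b * inc b') * hPQ + inc b' * h - inc a * inc b' * hcc
  obtain ⟨O, hO, e, he⟩ := mk_val inc red hker (by
    intro l
    rcases eq_or_ne l 0 with rfl | hl
    · exact Or.inl ⟨0, 1, by simp, by simp⟩
    obtain ⟨c, hc, a, b, ha, hb, h⟩ := hstar l hl
    by_cases hcV : c ∈ V
    · refine Or.inl ⟨C ⟨c, hcV⟩ * a, b, hb, ?_⟩
      rw [h, map_mul]
      congr 1
      rw [hinc, RingHom.comp_apply, hmapK, MvPolynomial.map_C]; rfl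
    · obtain ⟨c', hc', -⟩ := hVinv c hcV
      refine Or.inr ⟨C c' * b, a, ha, ?_⟩
      have h1 : inc (C c') * ι (C c) = 1 := by
        rw [hinc, RingHom.comp_apply, ← map_mul, hmapK, MvPolynomial.map_C]
        have : (algebraMap V K) c' = c⁻¹ := hc'
        rw [this, ← C_mul, inv_mul_cancel₀ hc, C_1, map_one]
      rw [map_mul, inv_mul_eq_iff_eq_mul₀ hl]
      linear_combination (-inc a) * h1 - inc (C c') * h) (by
    intro f
    obtain ⟨a, b, hb, h⟩ := hπf f
    obtain ⟨a', rfl⟩ := hmapks a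
    obtain ⟨b', rfl⟩ := hmapks b
    exact ⟨a', b', hb, h⟩)
  have hres' : ∀ a, e (rs O (inc a)) = red a := by
    intro a
    have := rs_coe O ⟨inc a, hO a⟩
    rw [← he a, ← this]
  have hv1 : ∀ a, red a ≠ 0 → O.valuation (inc a) = 1 := by
    intro a ha
    rw [← rs_ne]
    intro h
    rw [← hres', h, map_zero] at ha
    exact ha rfl
  have h2O : (2 : IsLocalRing.ResidueField O) = 0 := by
    apply e.injective
    have h2F : (2 : F) = 0 := by
      have := congrArg (π.comp C) h2k
      rwa [map_ofNat, map_zero] at this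
    rw [map_ofNat, map_zero, h2F]
  haveI : CharP (IsLocalRing.ResidueField O) 2 :=
    CharTwo.of_one_ne_zero_of_two_eq_zero one_ne_zero h2O
  set φ : V →+* O := (inc.comp C).codRestrict O (fun c => hO _) with hφ
  have hφ1 : ∀ c : V, ((φ c : O) : L) = ι (C (c : K)) := by
    intro c
    change inc (C c) = _
    rw [hinc, RingHom.comp_apply, hmapK, MvPolynomial.map_C]; rfl
  have hφ2 : ∀ c : V, e (IsLocalRing.residue O (φ c)) = π (C (IsLocalRing.residue V c)) := by
    intro c
    have := he (C c)
    refine Eq.trans this ?_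
    rw [hred, RingHom.comp_apply, hmapk, MvPolynomial.map_C]
  have hιinj : Function.Injective (ι.comp (C : K →+* MvPolynomial (Fin n ⊕ Fin 3) K)) :=
    RingHom.injective _
  choose D' hD' using fun j => transport_der e (D j)
  have hWe : ∀ v : Fin n → IsLocalRing.ResidueField O,
      e ((Wmat D' (Pi.single i0 1) v).det) = (Wmat D (Pi.single i0 1) (fun i => e (v i))).det := by
    intro v
    have h1 := RingHom.map_det (e : IsLocalRing.ResidueField O →+* F) (Wmat D' (Pi.single i0 1) v)
    refine Eq.trans h1 ?_
    congr 1
    ext i j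
    simp only [Wmat, RingHom.mapMatrix_apply, Matrix.map_apply, Matrix.of_apply]
    change e _ = _
    rw [map_add, map_mul, hD']
    congr 2
    by_cases h : j = i0
    · subst h; simp
    · simp [Pi.single_apply, h]
  have hu0 : red (X (Sum.inl i0)) ≠ 0 := by
    rw [hred, RingHom.comp_apply, hmapk, MvPolynomial.map_X]
    apply hπ1 _ (X_ne_zero _)
    rw [Ez_ne _ (by simp), Polynomial.natDegree_C]; exact zero_le_one
  have hincX : ∀ v, inc (X v) = ι (X v) := by
    intro v
    rw [hinc, RingHom.comp_apply, hmapK, MvPolynomial.map_X]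
  have hv0 : O.valuation (ι (X (Sum.inl i0))) = 1 := by
    rw [← hincX]; exact hv1 _ hu0
  have hτO : ∀ i, O.valuation (τ i) ≤ 1 := by
    intro i
    have h3 := congrArg O.valuation (hτ i)
    rw [map_mul, hv0, mul_one] at h3
    rw [h3, ← hincX, O.valuation_le_one_iff]
    exact hO _
  refine chain_top O hn G (MvPolynomial.map φ gV) (w := w) (d := d) ?_ p q r ?_ ?_ D' i0 ?_ ?_ ?_
    (fun i => ι (C (b i))) ?_ ?_ N u x hx ?_ h0 hN lam hlam τ hτO htop ?_
  · exact fun E hE => hbh E (support_map_subset _ _ hE)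
  · intro j; omega
  · set kk : k →+* IsLocalRing.ResidueField O := (e.symm : F →+* _).comp (π.comp C) with hkk
    have h3 : (IsLocalRing.residue O).comp φ = kk.comp (IsLocalRing.residue V) := by
      refine RingHom.ext fun c => ?_
      apply e.injective
      rw [RingHom.comp_apply, hφ2]
      exact (e.apply_symm_apply _).symm
    rw [MvPolynomial.map_map, h3, ← MvPolynomial.map_map, hres, map_Gev]
    simp only [MvPolynomial.map_X]
  · ext a
    apply e.injective
    rw [hD', hDi0]
    exact (map_zero e).symm
  · intro l hl m hm
    obtain ⟨c, hc, a, b, ha, hb, h⟩ := hstar l hl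
    obtain ⟨c', hc'⟩ := IsAlgClosed.exists_pow_nat_eq c hm
    refine ⟨ι (C c'), ?_⟩
    have h3 := congrArg O.valuation h
    rw [map_mul, map_mul, hv1 _ ha, hv1 _ hb, mul_one, mul_one] at h3
    rw [h3, ← map_pow, ← map_pow, ← C_pow, hc']
  · refine ⟨2⁻¹, ?_⟩
    have h20 : (2 : L) ≠ 0 := by
      rw [← map_ofNat (ι.comp C)]
      exact (map_ne_zero_iff _ hιinj).2 hK2
    rw [map_inv₀]
    have h4 : O.valuation (2 : L) < 1 := by
      have h5 : O.valuation (2 : L) ≤ 1 := by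
        rw [O.valuation_le_one_iff]; exact ofNat_mem O 2
      refine lt_of_le_of_ne h5 fun h6 => ?_
      have h7 := (rs_ne O).2 h6
      apply h7
      have := rs_coe O 2
      rw [map_ofNat, h2O] at this
      exact this
    have h8 : 0 < O.valuation (2 : L) := by
      rw [zero_lt_iff]; exact (map_ne_zero _).2 h20
    exact (one_lt_inv₀ h8).2 h4
  · intro h
    apply hb
    funext i
    have := congrFun h i
    apply hιinj
    exact this.trans (map_zero _).symm
  · intro i j hij
    obtain ⟨s, hs⟩ := IsAlgClosed.exists_pow_nat_eq (b i / b j) (n := 2) (by norm_num)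
    have h3 : ι (C (b i)) / ι (C (b j)) = ι (C s) * ι (C s) := by
      rw [← map_mul, ← C_mul, ← pow_two, hs]
      exact (map_div₀ (ι.comp C) _ _).symm
    have h4 : ι (C s) ∈ O := by
      by_contra hcon
      have h5 := (O.mem_or_inv_mem (ι (C s))).resolve_left hcon
      apply hcon
      rw [h3] at hij
      have h6 := O.mul_mem _ _ hij h5
      rcases eq_or_ne (ι (C s)) 0 with h7 | h7
      · rw [h7]; exact O.zero_mem
      · rwa [mul_assoc, mul_inv_cancel₀ h7, mul_one] at h6
    simp only [h3]
    rw [rs_mul O h4 h4]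
    exact ⟨_, rfl⟩
  · rw [eval₂_map] at hg ⊢
    rw [← hg]
    congr 1
    refine RingHom.ext fun c => ?_
    simp only [RingHom.comp_apply]
    congr 1
    exact hφ1 c
  · intro hdet
    have h3 := hWe (fun i => rs O (τ i))
    rw [hdet, map_zero] at h3
    apply hW
    have h4 : ∀ i, π (X (Sum.inl i)) = π (X (Sum.inl i0)) * e (rs O (τ i)) := by
      intro i
      have h5 : ∀ i, π (X (Sum.inl i)) = e (rs O (ι (X (Sum.inl i)))) := by
        intro i
        rw [← hincX, hres', hred, RingHom.comp_apply, hmapk, MvPolynomial.map_X]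
      rw [h5, h5, ← map_mul, ← rs_mul, mul_comm, hτ]
      · rw [← hincX]; exact hO _
      · rw [← O.valuation_le_one_iff]; exact hτO i
    rw [show (fun i => π (X (Sum.inl i))) = fun i => π (X (Sum.inl i0)) * e (rs O (τ i)) from
      funext h4]
    rw [Wmat_smul_det i0 hDi0 _ (a := π (X (Sum.inl i0))), ← h3, mul_zero]
    have := hu0
    rwa [hred, RingHom.comp_apply, hmapk, MvPolynomial.map_X] at this

end CBProof

namespace CBProof
open ConicBundleFormalization

theorem isBihom_iff {K : Type} [Field K] {n : ℕ} {w : Fin 3 → ℤ} {d : ℤ}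
    {g : MvPolynomial (Fin n ⊕ Fin 3) K} :
    IsBihom K n 3 w (fun _ => 1) d 2 g ↔ BH w d g := by
  simp only [IsBihom, BH, mul_one]

theorem isBihom_monomial {K : Type} [Field K] {n : ℕ} (w : Fin 3 → ℤ) (e : Fin n ⊕ Fin 3 →₀ ℕ)
    (c : K) : IsBihom K n 3 w (fun _ => 1)
      ((∑ i : Fin n, (e (Sum.inl i) : ℤ)) + ∑ j : Fin 3, (e (Sum.inr j) : ℤ) * w j)
      (∑ j : Fin 3, e (Sum.inr j)) (monomial e c) := by
  intro e' he'
  classical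
  have := support_monomial_subset he'
  rw [Finset.mem_singleton] at this
  subst this
  simp

@[reducible]
noncomputable def fracField {K : Type} [Field K] {n : ℕ} (g : Cox K n 3)
    [IsDomain (coneRing K g)] : Field (FracCone K g) :=
  inferInstanceAs (Field (FractionRing (coneRing K g)))

theorem sr_data {K : Type} [Field K] [Infinite K] {n : ℕ} {w : Fin 3 → ℤ} {d : ℤ} (g : Cox K n 3)
    (hbh : BH w d g) (hp : (Ideal.span {g} : Ideal (Cox K n 3)).IsPrime)
    (hSR : IsStablyRationalModel K w (fun _ => 1) g) (i0 : Fin n) (q : Fin 3)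
    (hi0 : ¬ g ∣ X (Sum.inl i0)) (hq : ¬ g ∣ X (Sum.inr q)) :
    ∃ (L : Type) (_ : Field L) (ι : MvPolynomial (Fin n ⊕ Fin 3) K →+* L),
      (∀ P, ι P = 0 ↔ g ∣ P) ∧ (∀ l : L, ∃ a b, ι b ≠ 0 ∧ l * ι b = ι a) ∧
      ∃ (N : ℕ) (u : Fin n → Polynomial L) (x : Fin 3 → Polynomial L) (b : Fin n → K) (lam : L)
      (τ : Fin n → L), x ≠ 0 ∧ b ≠ 0 ∧ lam ≠ 0 ∧
      g.eval₂ (Polynomial.C.comp (ι.comp C)) (Sum.elim u x) = 0 ∧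
      (∀ i, (u i).coeff 0 = ι (C (b i))) ∧ (∀ i, (u i).natDegree ≤ N) ∧
      (∀ i, τ i * ι (X (Sum.inl i0)) = ι (X (Sum.inl i))) ∧
      (∀ i, (u i).coeff N = lam * τ i) := by
  haveI := hp
  haveI hdom : IsDomain (coneRing K g) := Ideal.Quotient.isDomain _
  letI iF : Field (FracCone K g) := fracField g
  set ι : MvPolynomial (Fin n ⊕ Fin 3) K →+* FracCone K g := toFrac K g with hιdef
  have hinj : Function.Injective (algebraMap (coneRing K g) (FracCone K g)) :=
    IsFractionRing.injective (coneRing K g) (FractionRing (coneRing K g))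
  have hι : ∀ P, ι P = 0 ↔ g ∣ P := by
    intro P
    rw [hιdef, toFrac, RingHom.comp_apply]
    rw [map_eq_zero_iff _ hinj, Ideal.Quotient.eq_zero_iff_mem, Ideal.mem_span_singleton]
  have hfr : ∀ l : FracCone K g, ∃ a b, ι b ≠ 0 ∧ l * ι b = ι a := by
    intro l
    obtain ⟨⟨a, b⟩, hab⟩ := IsLocalization.surj (nonZeroDivisors (coneRing K g))
      (S := FractionRing (coneRing K g)) l
    obtain ⟨a', ha'⟩ := Ideal.Quotient.mk_surjective a
    obtain ⟨b', hb'⟩ := Ideal.Quotient.mk_surjective (b : coneRing K g)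
    refine ⟨a', b', ?_, ?_⟩
    · rw [hιdef, toFrac, RingHom.comp_apply, hb', map_ne_zero_iff _ hinj]
      exact nonZeroDivisors.ne_zero b.2
    · rw [hιdef, toFrac, RingHom.comp_apply, RingHom.comp_apply, hb', ha']
      exact hab
  have halg : algebraMap K (FracCone K g) = ι.comp C := by
    refine RingHom.ext fun c => ?_
    exact IsScalarTower.algebraMap_apply K (coneRing K g) (FractionRing (coneRing K g)) c
  obtain ⟨r, s, ⟨Φ⟩⟩ := hSR
  haveI : IsDomain (FracCone K g) := inferInstanceAs (IsDomain (FractionRing (coneRing K g)))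
  set L0 := functionFieldModel K w (fun _ => 1) g with hL0
  have hmem : ∀ φ ∈ ratioSet K w (fun _ => 1) g, φ ∈ L0 := fun φ h => Algebra.subset_adjoin h
  have hu0 : ι (X (Sum.inl i0)) ≠ 0 := fun h => hi0 ((hι _).1 h)
  have hxq : ι (X (Sum.inr q)) ≠ 0 := fun h => hq ((hι _).1 h)
  set u0 := ι (X (Sum.inl i0)) with hu0d
  set M : ℤ := |w 0| + |w 1| + |w 2| with hM
  have hMw : ∀ j, w j ≤ M := by
    intro j
    have h0 := abs_nonneg (w 0)
    have h1 := abs_nonneg (w 1)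
    have h2 := abs_nonneg (w 2)
    have := le_abs_self (w j)
    fin_cases j <;> simp only [Fin.zero_eta, Fin.mk_one, Fin.reduceFinMk] at * <;> omega
  set a : Fin 3 → ℕ := fun j => (M - w j).toNat with ha
  have haz : ∀ j, (a j : ℤ) = M - w j := fun j => Int.toNat_of_nonneg (by linarith [hMw j])
  set T : Fin n → FracCone K g := fun i => ι (X (Sum.inl i)) / u0 with hT
  set Θ : Fin 3 → FracCone K g := fun j => ι (X (Sum.inr j)) * u0 ^ a j /
    (ι (X (Sum.inr q)) * u0 ^ a q) with hΘ
  have hTm : ∀ i, T i ∈ L0 := by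
    intro i
    refine hmem _ ⟨1, 0, X (Sum.inl i), X (Sum.inl i0), ?_, ?_, hu0, div_mul_cancel₀ _ hu0⟩
    · have := isBihom_monomial w (Finsupp.single (Sum.inl i : Fin n ⊕ Fin 3) 1) (1 : K)
      rw [X]
      convert this using 1 <;> simp [Finsupp.single_apply]
    · have := isBihom_monomial w (Finsupp.single (Sum.inl i0 : Fin n ⊕ Fin 3) 1) (1 : K)
      rw [X]
      convert this using 1 <;> simp [Finsupp.single_apply]
  have hbx : ∀ j, IsBihom K n 3 w (fun _ => 1) M 1 (X (Sum.inr j) * X (Sum.inl i0) ^ a j) := by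
    intro j
    have := isBihom_monomial w (Finsupp.single (Sum.inr j : Fin n ⊕ Fin 3) 1 +
      Finsupp.single (Sum.inl i0 : Fin n ⊕ Fin 3) (a j)) (1 : K)
    have e1 : (monomial (Finsupp.single (Sum.inr j : Fin n ⊕ Fin 3) 1 +
      Finsupp.single (Sum.inl i0 : Fin n ⊕ Fin 3) (a j)) (1 : K)) =
        X (Sum.inr j) * X (Sum.inl i0) ^ a j := by
      rw [X_pow_eq_monomial, X, monomial_mul, one_mul]
    rw [e1] at this
    convert this using 1
    · simp [Finsupp.single_apply, haz]
    · simp [Finsupp.single_apply]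
  have hden : ι (X (Sum.inr q)) * u0 ^ a q ≠ 0 := mul_ne_zero hxq (pow_ne_zero _ hu0)
  have hΘm : ∀ j, Θ j ∈ L0 := by
    intro j
    refine hmem _ ⟨M, 1, _, _, hbx j, hbx q, ?_, ?_⟩
    · change ι _ ≠ 0
      rw [map_mul, map_pow]; exact hden
    · change _ * ι _ = ι _
      rw [map_mul, map_pow, map_mul, map_pow]
      exact div_mul_cancel₀ _ hden
  have hcomp : (L0.val : L0 →+* FracCone K g).comp (algebraMap K L0) = ι.comp C := by
    rw [← halg]
    rfl
  have heval : g.eval₂ (ι.comp C) (Sum.elim T Θ) = 0 := by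
    set l : (FracCone K g)ˣ := (Units.mk0 u0 hu0)⁻¹ with hl
    set den := ι (X (Sum.inr q)) * u0 ^ a q with hdend
    set ν : (FracCone K g)ˣ := Units.mk0 (u0 ^ M / den) (div_ne_zero (zpow_ne_zero _ hu0) hden) with hν
    have h1 := BH.scale hbh (ι.comp C) l ν (fun i => ι (X (Sum.inl i))) (fun j => ι (X (Sum.inr j)))
    have h2 : g.eval₂ (ι.comp C) (Sum.elim (fun i => ι (X (Sum.inl i)))
        (fun j => ι (X (Sum.inr j)))) = 0 := by
      have h3 : ∀ P, P.eval₂ (ι.comp C) (Sum.elim (fun i => ι (X (Sum.inl i)))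
        (fun j => ι (X (Sum.inr j)))) = ι P := by
        have : MvPolynomial.eval₂Hom (ι.comp C) (Sum.elim (fun i => ι (X (Sum.inl i)))
            (fun j => ι (X (Sum.inr j)))) = ι := by
          apply MvPolynomial.ringHom_ext
          · intro c; simp
          · rintro (i | j) <;> simp
        intro P
        exact DFunLike.congr_fun this P
      rw [h3, hι]
    rw [h2, mul_zero] at h1
    rw [← h1]
    congr 1
    funext v
    rcases v with i | j
    · simp only [Sum.elim_inl, hT, hl, Units.val_inv_eq_inv_val, Units.val_mk0]
      rw [div_eq_mul_inv, mul_comm]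
    · simp only [Sum.elim_inr, hΘ, hl, hν, Units.val_inv_eq_inv_val, Units.val_mk0,
        Units.val_zpow_eq_zpow_val]
      have e1 : u0 ^ a j = u0 ^ M * u0⁻¹ ^ w j := by
        rw [← zpow_natCast, haz, zpow_sub₀ hu0, inv_zpow]; rfl
      rw [e1]
      ring
  obtain ⟨N, u, x, b, lam, hx, hb, hlam, h1, h2, h3, h4⟩ :=
    path (K := K) (L0 := L0) (L := FracCone K g) (L0.val : L0 →+* FracCone K g)
    Subtype.val_injective r s Φ g hbh (fun i => ⟨T i, hTm i⟩) i0
    (Subtype.ext (div_self hu0)) (fun j => ⟨Θ j, hΘm j⟩) (by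
      intro h
      have := congrArg Subtype.val (congrFun h q)
      simp only [hΘ] at this
      rw [div_self hden] at this
      exact one_ne_zero this) (by
      have hj : Function.Injective (L0.val : L0 →+* FracCone K g) := Subtype.val_injective
      apply hj
      rw [map_zero, MvPolynomial.hom_eval₂, hcomp, ← heval]
      congr 1
      funext v
      rcases v with i | j <;> rfl)
  refine ⟨FracCone K g, iF, ι, hι, hfr, N, u, x, b, lam, T, hx, hb, hlam, ?_, ?_, h3, ?_, h4⟩
  · rw [← h1, hcomp]
  · intro i
    rw [h2]
    exact DFunLike.congr_fun hcomp (b i)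
  · intro i
    exact div_mul_cancel₀ _ hu0

end CBProof

namespace CBProof
open ConicBundleFormalization

/-- Bihomogeneous polynomials, over any coefficient ring. -/
def BD {S : Type*} [CommSemiring S] {n : ℕ} (w : Fin 3 → ℤ) (d : ℤ) (k : ℕ)
    (p : MvPolynomial (Fin n ⊕ Fin 3) S) : Prop :=
  ∀ e ∈ p.support, ((∑ i : Fin n, (e (Sum.inl i) : ℤ)) + ∑ j : Fin 3, (e (Sum.inr j) : ℤ) * w j = d) ∧
    (∑ j : Fin 3, e (Sum.inr j)) = k

section BD
variable {S : Type*} [CommSemiring S] {n : ℕ} {w : Fin 3 → ℤ} {d d' : ℤ} {k k' : ℕ}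
  {p q : MvPolynomial (Fin n ⊕ Fin 3) S}

theorem BD.zero : BD w d k (0 : MvPolynomial (Fin n ⊕ Fin 3) S) := by
  intro e he; simp at he

theorem BD.add (hp : BD w d k p) (hq : BD w d k q) : BD w d k (p + q) := by
  classical
  intro e he
  rcases Finset.mem_union.1 (support_add he) with h | h
  · exact hp e h
  · exact hq e h

theorem BD.mul (hp : BD w d k p) (hq : BD w d' k' q) : BD w (d + d') (k + k') (p * q) := by
  classical
  intro e he
  obtain ⟨a, ha, b, hb, rfl⟩ := Finset.mem_add.1 (support_mul p q he)
  obtain ⟨h1, h2⟩ := hp a ha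
  obtain ⟨h3, h4⟩ := hq b hb
  constructor
  · rw [← h1, ← h3]
    simp only [Finsupp.add_apply, Nat.cast_add, add_mul, Finset.sum_add_distrib]
    ring
  · rw [← h2, ← h4]
    simp only [Finsupp.add_apply, Finset.sum_add_distrib]

theorem BD.monomial (e : Fin n ⊕ Fin 3 →₀ ℕ) (c : S) : BD w
      ((∑ i : Fin n, (e (Sum.inl i) : ℤ)) + ∑ j : Fin 3, (e (Sum.inr j) : ℤ) * w j)
      (∑ j : Fin 3, e (Sum.inr j)) (MvPolynomial.monomial e c) := by
  intro e' he'
  classical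
  have := support_monomial_subset he'
  rw [Finset.mem_singleton] at this
  subst this
  exact ⟨rfl, rfl⟩

theorem BD.C (c : S) : BD w 0 0 (C c : MvPolynomial (Fin n ⊕ Fin 3) S) := by
  simpa using BD.monomial (n := n) (w := w) 0 c

theorem BD.one : BD w 0 0 (1 : MvPolynomial (Fin n ⊕ Fin 3) S) := by
  simpa using BD.C (n := n) (w := w) (1 : S)

theorem BD.xl (i : Fin n) : BD w 1 0 (X (Sum.inl i) : MvPolynomial (Fin n ⊕ Fin 3) S) := by
  have := BD.monomial (w := w) (Finsupp.single (Sum.inl i : Fin n ⊕ Fin 3) 1) (1 : S)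
  rw [X]
  convert this using 1 <;> simp [Finsupp.single_apply]

theorem BD.xr (j : Fin 3) : BD w (w j) 1 (X (Sum.inr j) : MvPolynomial (Fin n ⊕ Fin 3) S) := by
  have := BD.monomial (w := w) (Finsupp.single (Sum.inr j : Fin n ⊕ Fin 3) 1) (1 : S)
  rw [X]
  convert this using 1 <;> simp [Finsupp.single_apply]

theorem BD.pow (hp : BD w d k p) (m : ℕ) : BD w (m * d) (m * k) (p ^ m) := by
  induction m with
  | zero => simpa using BD.one (w := w) (S := S) (n := n)
  | succ m ih =>
    rw [pow_succ]
    convert ih.mul hp using 1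
    · push_cast; ring
    · ring

theorem BD.sum {ι : Type*} (s : Finset ι) (f : ι → MvPolynomial (Fin n ⊕ Fin 3) S)
    (h : ∀ i ∈ s, BD w d k (f i)) : BD w d k (∑ i ∈ s, f i) := by
  classical
  induction s using Finset.induction_on with
  | empty => simpa using BD.zero
  | insert a s ha ih =>
    rw [Finset.sum_insert ha]
    exact (h a (Finset.mem_insert_self _ _)).add (ih fun i hi => h i (Finset.mem_insert_of_mem hi))

theorem BD.uprod (E : Fin n → ℕ) (s : Finset (Fin n)) : BD w (∑ i ∈ s, (E i : ℤ)) 0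
    (∏ i ∈ s, (X (Sum.inl i) : MvPolynomial (Fin n ⊕ Fin 3) S) ^ E i) := by
  classical
  induction s using Finset.induction_on with
  | empty => simpa using BD.one (w := w) (S := S) (n := n)
  | insert a s ha ih =>
    rw [Finset.prod_insert ha, Finset.sum_insert ha]
    simpa using ((BD.xl a).pow (E a)).mul ih

theorem BD.map {T : Type*} [CommSemiring T] (φ : S →+* T) (hp : BD w d k p) :
    BD w d k (MvPolynomial.map φ p) :=
  fun e he => hp e (support_map_subset _ _ he)

theorem BD.congr (hp : BD w d k p) (h : d = d') (h' : k = k') : BD w d' k' p := by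
  subst h h'; exact hp

end BD

theorem BD.Pf {S : Type*} [CommRing S] {n : ℕ} {w : Fin 3 → ℤ} (r : ℕ) :
    BD w (2 * r) 0 (Pf r (fun i => (X (Sum.inl i) : MvPolynomial (Fin n ⊕ Fin 3) S))) := by
  unfold CBProof.Pf
  split_ifs with h
  · subst h
    simpa using BD.one (w := w) (S := S) (n := n)
  · apply BD.sum
    intro i _
    simpa using (BD.xl (w := w) (S := S) i).pow (2 * r)

theorem BD.Gev {S : Type*} [CommRing S] {n : ℕ} {w : Fin 3 → ℤ} {d : ℤ} (G : GData n)
    (p q r : Fin 3)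
    (hα : ∑ i, (G.α i : ℤ) + 2 * G.r' = d - 2 * w q)
    (hβ : ∑ i, (G.β i : ℤ) + 2 * G.r = d - 2 * w r)
    (hγ : ∑ i, (G.γ i : ℤ) = d - 2 * w p)
    (hκ : ∑ i, (G.κ i : ℤ) = d - w q - w r) :
    BD w d 2 (Gev G (fun i => (X (Sum.inl i) : MvPolynomial (Fin n ⊕ Fin 3) S))
      (X (Sum.inr q)) (X (Sum.inr r)) (X (Sum.inr p))) := by
  unfold CBProof.Gev
  refine ((BD.add ?_ ?_).add ?_).add ?_
  · refine (((BD.uprod G.α _).mul (BD.Pf _)).mul ((BD.xr q).pow 2)).congr ?_ rfl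
    push_cast; linarith
  · refine (((BD.uprod G.β _).mul (BD.Pf _)).mul ((BD.xr r).pow 2)).congr ?_ rfl
    push_cast; linarith
  · refine ((BD.uprod G.γ _).mul ((BD.xr p).pow 2)).congr ?_ rfl
    push_cast; linarith
  · refine (((BD.uprod G.κ _).mul (BD.xr q)).mul (BD.xr r)).congr ?_ rfl
    linarith

theorem exists_val {σ : Type*} (g : MvPolynomial σ ℂ) (g0 : MvPolynomial σ ℤ)
    (h : ∀ P : MvPolynomial (σ →₀ ℕ) ℤ, ¬ (2:ℤ) ∣ eval (fun e => g0.coeff e) P →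
      eval₂ (Int.castRingHom ℂ) (fun e => g.coeff e) P ≠ 0) :
    ∃ (V : ValuationSubring ℂ) (gV : MvPolynomial σ V), (IsLocalRing.residue V) 2 = 0 ∧
      MvPolynomial.map (algebraMap V ℂ) gV = g ∧
      MvPolynomial.map (IsLocalRing.residue V) gV =
        MvPolynomial.map (Int.castRingHom (IsLocalRing.ResidueField V)) g0 := by
  set φ : MvPolynomial (σ →₀ ℕ) ℤ →+* ℂ := eval₂Hom (Int.castRingHom ℂ) (fun e => g.coeff e) with hφ
  set J : Ideal (MvPolynomial (σ →₀ ℕ) ℤ) :=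
    (Ideal.span {(2:ℤ)}).comap (eval (fun e => g0.coeff e)) with hJ
  have hmJ : ∀ P, P ∈ J ↔ (2:ℤ) ∣ eval (fun e => g0.coeff e) P := by
    intro P
    rw [hJ, Ideal.mem_comap, Ideal.mem_span_singleton]
  set I := J.map φ.rangeRestrict with hI
  have hItop : I ≠ ⊤ := by
    rw [Ideal.ne_top_iff_one]
    intro h1
    obtain ⟨P, hP, hP1⟩ := (Ideal.mem_map_iff_of_surjective _ φ.rangeRestrict_surjective).1 h1
    have h2 : φ P = 1 := congrArg Subtype.val hP1
    rw [hmJ] at hP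
    refine h (1 - P) ?_ ?_
    · rw [map_sub, map_one]
      intro h3
      have := dvd_add h3 hP
      rw [sub_add_cancel] at this
      omega
    · change φ (1 - P) = 0
      rw [map_sub, map_one, h2, sub_self]
  obtain ⟨V, hV, hV2⟩ := Ideal.image_subset_nonunits_valuationSubring I hItop
  have hmem : ∀ P, φ P ∈ V := fun P => hV ⟨P, rfl⟩
  have hres : ∀ P ∈ J, IsLocalRing.residue V ⟨φ P, hmem P⟩ = 0 := by
    intro P hP
    rw [IsLocalRing.residue_eq_zero_iff]
    have : φ P ∈ V.nonunits := hV2 ⟨φ.rangeRestrict P, Ideal.mem_map_of_mem _ hP, rfl⟩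
    rw [← SetLike.mem_coe, ← V.image_maximalIdeal] at this
    obtain ⟨a, ha, ha'⟩ := this
    have e : a = ⟨φ P, hmem P⟩ := Subtype.ext ha'
    rwa [← e]
  have hX : ∀ e, φ (X e) = g.coeff e := fun e => by simp [hφ]
  have hmemg : ∀ e, g.coeff e ∈ V := fun e => by rw [← hX]; exact hmem _
  have hgr : g ∈ (MvPolynomial.map (algebraMap V ℂ)).range := by
    rw [RingHom.mem_range, ← Set.mem_range, mem_range_map_iff_coeffs_subset]
    intro c hc
    rw [Finset.mem_coe, mem_coeffs_iff] at hc
    obtain ⟨e, -, rfl⟩ := hc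
    exact ⟨⟨_, hmemg e⟩, rfl⟩
  obtain ⟨gV, hgV⟩ := hgr
  have hc : ∀ e, gV.coeff e = ⟨g.coeff e, hmemg e⟩ := by
    intro e
    apply Subtype.ext
    change algebraMap V ℂ (gV.coeff e) = g.coeff e
    rw [← coeff_map, hgV]
  refine ⟨V, gV, ?_, hgV, ?_⟩
  · have := hres (MvPolynomial.C 2) (by rw [hmJ, eval_C])
    rw [← this]
    congr 1
    apply Subtype.ext
    change (2:ℂ) = φ (MvPolynomial.C 2)
    rw [hφ, coe_eval₂Hom, eval₂_C]
    simp
  · ext e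
    rw [coeff_map, coeff_map]
    have := hres (X e - MvPolynomial.C (g0.coeff e)) (by rw [hmJ]; simp)
    have e2 : (⟨φ (X e - MvPolynomial.C (g0.coeff e)), hmem _⟩ : V) =
        gV.coeff e - Int.castRingHom V (g0.coeff e) := by
      apply Subtype.ext
      rw [hc]
      change φ (X e - MvPolynomial.C (g0.coeff e)) = g.coeff e - V.subtype (Int.castRingHom V (g0.coeff e))
      rw [map_sub, hX, hφ, coe_eval₂Hom, eval₂_C]
      simp
    rw [e2, map_sub, sub_eq_zero] at this
    rw [this]
    simp

theorem Ez_natDegree_le {R : Type*} [CommRing R] {σ : Type*} [DecidableEq σ] [Finite σ] (v : σ) (m : ℕ)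
    (P : MvPolynomial σ R) (h : ∀ e ∈ P.support, e v ≤ m) : (Ez v R P).natDegree ≤ m := by
  haveI := Fintype.ofFinite σ
  conv_lhs => rw [P.as_sum]
  rw [map_sum]
  apply Polynomial.natDegree_sum_le_of_forall_le
  intro e he
  rw [monomial_eq, map_mul, Ez_C]
  refine (Polynomial.natDegree_C_mul_le _ _).trans ?_
  rw [Finsupp.prod_fintype _ _ (fun _ => pow_zero _), map_prod]
  refine (Polynomial.natDegree_prod_le _ _).trans ?_
  refine le_trans ?_ (h e he)
  rw [Finset.sum_eq_single v]
  · rw [map_pow, Ez_self]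
    exact Polynomial.natDegree_X_pow_le _
  · intro b _ hb
    rw [map_pow, Ez_ne v hb, ← Polynomial.C_pow, Polynomial.natDegree_C]
  · simp

theorem not_dvd_of_BD {K : Type} [Field K] {n : ℕ} {w : Fin 3 → ℤ} {d : ℤ}
    {g : MvPolynomial (Fin n ⊕ Fin 3) K} (hg : BD w d 2 g) (v : Fin n ⊕ Fin 3) : ¬ g ∣ X v := by
  intro h
  set ψ : MvPolynomial (Fin n ⊕ Fin 3) K →+* Polynomial K :=
    eval₂Hom Polynomial.C (Sum.elim (fun _ => 1) (fun _ => Polynomial.X)) with hψ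
  have h1 : (Polynomial.X : Polynomial K) ^ 2 ∣ ψ g := by
    rw [hψ, coe_eval₂Hom, eval₂_eq']
    apply Finset.dvd_sum
    intro e he
    apply Dvd.dvd.mul_left
    rw [Fintype.prod_sum_type]
    apply Dvd.dvd.mul_left
    simp only [Sum.elim_inr]
    rw [Finset.prod_pow_eq_pow_sum, (hg e he).2]
  have h2 := h1.trans (map_dvd ψ h)
  have h3 : ψ (X v) ∣ Polynomial.X := by
    rcases v with i | j <;> simp [hψ]
  have := h2.trans h3
  have h4 := Polynomial.degree_le_of_dvd this Polynomial.X_ne_zero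
  rw [Polynomial.degree_X_pow, Polynomial.degree_X] at h4
  exact absurd h4 (by decide)

theorem good_case {n : ℕ} (hn : 2 ≤ n) {w : Fin 3 → ℤ} {d : ℤ} (G : GData n)
    (p q r : Fin 3) (hqp : q ≠ p) (hrp : r ≠ p) (hqr : q ≠ r)
    (hα : ∑ i, (G.α i : ℤ) + 2 * G.r' = d - 2 * w q)
    (hβ : ∑ i, (G.β i : ℤ) + 2 * G.r = d - 2 * w r)
    (hγ : ∑ i, (G.γ i : ℤ) = d - 2 * w p)
    (hκ : ∑ i, (G.κ i : ℤ) = d - w q - w r) :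
    VeryGenerallyHolds ℂ n 3 w (fun _ => 1) d 2 (fun g =>
      (Ideal.span {g} : Ideal (Cox ℂ n 3)).IsPrime →
      ¬ IsStablyRationalModel ℂ w (fun _ => 1) g) := by
  classical
  set g0 : MvPolynomial (Fin n ⊕ Fin 3) ℤ := Gev G (fun i => X (Sum.inl i))
      (X (Sum.inr q)) (X (Sum.inr r)) (X (Sum.inr p)) with hg0
  have hB0 : BD w d 2 g0 := BD.Gev G p q r hα hβ hγ hκ
  set Q := {P : MvPolynomial ((Fin n ⊕ Fin 3) →₀ ℕ) ℤ // ¬ (2:ℤ) ∣ eval (fun e => g0.coeff e) P}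
  haveI : Countable (MvPolynomial ((Fin n ⊕ Fin 3) →₀ ℕ) ℤ) := by
    rw [← Cardinal.mk_le_aleph0_iff]
    refine (MvPolynomial.cardinalMk_le_max).trans ?_
    simp
  haveI : Countable Q := Subtype.countable
  haveI : Nonempty Q := ⟨⟨1, by simp⟩⟩
  obtain ⟨E, hE⟩ := exists_surjective_nat Q
  have key : ∀ (P : MvPolynomial ((Fin n ⊕ Fin 3) →₀ ℕ) ℤ) (g : Cox ℂ n 3),
      evalCoeff ℂ g (MvPolynomial.map (Int.castRingHom ℂ) P) =
        eval₂ (Int.castRingHom ℂ) (fun e => g.coeff e) P := by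
    intro P g
    rw [evalCoeff, eval_map]
  refine ⟨fun i => MvPolynomial.map (Int.castRingHom ℂ) (E i).1, ?_, ?_⟩
  · intro i
    refine ⟨MvPolynomial.map (Int.castRingHom ℂ) g0, isBihom_iff.2 (hB0.map _), ?_⟩
    rw [key]
    have : (fun e => (MvPolynomial.map (Int.castRingHom ℂ) g0).coeff e) =
        (Int.castRingHom ℂ) ∘ (fun e => g0.coeff e) := by
      funext e; rw [coeff_map]; rfl
    have e3 := eval₂_comp_left (Int.castRingHom ℂ) (RingHom.id ℤ) (fun e => g0.coeff e) (E i).1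
    rw [RingHom.comp_id] at e3
    rw [this, ← e3]
    rw [eq_intCast, Int.cast_ne_zero]
    intro h
    apply (E i).2
    have h2 : eval (fun e => g0.coeff e) (E i).1 = 0 := h
    rw [h2]
    exact dvd_zero _
  · intro g hg hD hprime hSR
    have hgB : BD w d 2 g := isBihom_iff.1 hg
    obtain ⟨V, gV, hV2, hgV, hres⟩ := exists_val g g0 (by
      intro P hP
      obtain ⟨i, hi⟩ := hE ⟨P, hP⟩
      have := hD i
      simp only at this
      rw [key, hi] at this
      exact this)
    have hBV : BD w d 2 gV := by
      intro e he
      apply hgB e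
      rw [mem_support_iff] at he ⊢
      rw [← hgV, coeff_map]
      intro h
      exact he (Subtype.ext h)
    have hi0 : 0 < n := by omega
    obtain ⟨L, _, ι, hι, hfr, N, u, x, b, lam, τ, hx, hb, hlam, h1, h2, h3, h4, h5⟩ :=
      sr_data g (isBihom_iff.1 hg) hprime hSR ⟨0, hi0⟩ q (not_dvd_of_BD hgB _) (not_dvd_of_BD hgB _)
    refine core (K := ℂ) two_ne_zero V hV2 hn G gV (w := w) (d := d) hBV p q r hqp hrp hqr ?_ ?_ ι
      (by rw [hgV]; exact hι) hfr ⟨0, hi0⟩ N u x b lam hx hb hlam (by rw [hgV]; exact h1) h2 h3 τ h4 h5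
    · rw [hres, hg0, map_Gev]
      simp only [map_X]
    · apply Ez_natDegree_le
      intro e he
      rw [← (hBV e he).2]
      exact Finset.single_le_sum (f := fun j => e (Sum.inr j)) (fun _ _ => Nat.zero_le _) (Finset.mem_univ p)

end CBProof

namespace CBProof

theorem good_num {n : ℕ} (hn : 3 ≤ n) (w : Fin 3 → ℤ) (d : ℤ) (p q r : Fin 3)
    (hpq : w q ≤ w p) (hqr : w r ≤ w q) (h0 : 0 ≤ d - 2 * w p) (h1 : 1 ≤ d - 2 * w q)
    (hδ : 3 * (n : ℤ) ≤ 3 * d - 2 * (w p + w q + w r)) :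
    ∃ G : GData n, (∑ i, (G.α i : ℤ) + 2 * G.r' = d - 2 * w q) ∧
    (∑ i, (G.β i : ℤ) + 2 * G.r = d - 2 * w r) ∧
    (∑ i, (G.γ i : ℤ) = d - 2 * w p) ∧
    (∑ i, (G.κ i : ℤ) = d - w q - w r) := by
  obtain ⟨a, ha⟩ := Int.eq_ofNat_of_zero_le h0
  obtain ⟨t, ht⟩ := Int.eq_ofNat_of_zero_le (a := d - w q - w r - n) (by omega)
  set i0 : Fin n := ⟨0, by omega⟩ with hi0
  set i1 : Fin n := ⟨1, by omega⟩ with hi1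
  set i2 : Fin n := ⟨2, by omega⟩ with hi2
  have h01 : i0 ≠ i1 := by simp [hi0, hi1]
  have h02 : i0 ≠ i2 := by simp [hi0, hi2]
  have h12 : i1 ≠ i2 := by simp [hi1, hi2]
  have h10 := h01.symm
  have h20 := h02.symm
  have h21 := h12.symm
  rcases Int.emod_two_eq_zero_or_one d with hd | hd
  · obtain ⟨b, hb⟩ := Int.eq_ofNat_of_zero_le (a := (d - 2 * w q - 2) / 2) (by omega)
    obtain ⟨c, hc⟩ := Int.eq_ofNat_of_zero_le (a := (d - 2 * w r - 2) / 2) (by omega)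
    rcases Nat.eq_zero_or_pos t with h | h
    · have h4 : 4 ≤ n := by omega
      set i3 : Fin n := ⟨3, by omega⟩ with hi3
      have h03 : i0 ≠ i3 := by simp [hi0, hi3]
      have h13 : i1 ≠ i3 := by simp [hi1, hi3]
      have h23 : i2 ≠ i3 := by simp [hi2, hi3]
      have h30 := h03.symm
      have h31 := h13.symm
      have h32 := h23.symm
      refine ⟨{ α := fun i => (if i = i0 then 1 else 0) + if i = i1 then 1 else 0
                β := fun i => (if i = i2 then 1 else 0) + if i = i3 then 1 else 0
                γ := fun i => if i = i0 then a else 0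
                κ := fun i => 1
                r' := b
                r := c
                hlt := ?_, hsum := ?_, hαβ := ⟨i1, ?_⟩, hαγ := ⟨i1, ?_⟩, hβγ := ⟨i2, ?_⟩,
                pβ := ?_, pγ := ?_ }, ?_, ?_, ?_, ?_⟩
      · intro i
        by_cases e0 : i = i0
        · subst e0; simp [*]
        · by_cases e1 : i = i1
          · subst e1; simp [*]
          · simp only [e0, e1, if_false]
            by_cases e2 : i = i2
            · subst e2; simp [*]
            · simp only [e2, if_false]; split_ifs <;> omega
      all_goals simp [Finset.sum_add_distrib, *] <;> omega
    · refine ⟨{ α := fun i => (if i = i0 then 1 else 0) + if i = i1 then 1 else 0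
                β := fun i => (if i = i0 then 1 else 0) + if i = i2 then 1 else 0
                γ := fun i => if i = i0 then a else 0
                κ := fun i => 1 + if i = i0 then t else 0
                r' := b
                r := c
                hlt := ?_, hsum := ?_, hαβ := ⟨i1, ?_⟩, hαγ := ⟨i1, ?_⟩, hβγ := ⟨i2, ?_⟩,
                pβ := ?_, pγ := ?_ }, ?_, ?_, ?_, ?_⟩
      · intro i
        by_cases e0 : i = i0
        · subst e0; simp [*]
        · by_cases e1 : i = i1
          · subst e1; simp [*]
          · simp only [e0, e1, if_false]; split_ifs <;> omega
      all_goals simp [Finset.sum_add_distrib, *] <;> omega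
  · obtain ⟨b, hb⟩ := Int.eq_ofNat_of_zero_le (a := (d - 2 * w q - 1) / 2) (by omega)
    obtain ⟨c, hc⟩ := Int.eq_ofNat_of_zero_le (a := (d - 2 * w r - 1) / 2) (by omega)
    refine ⟨{ α := fun i => if i = i1 then 1 else 0
              β := fun i => if i = i2 then 1 else 0
              γ := fun i => if i = i0 then a else 0
              κ := fun i => 1 + if i = i0 then t else 0
              r' := b
              r := c
              hlt := ?_, hsum := ?_, hαβ := ⟨i1, ?_⟩, hαγ := ⟨i1, ?_⟩, hβγ := ⟨i2, ?_⟩,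
              pβ := ?_, pγ := ?_ }, ?_, ?_, ?_, ?_⟩
    · intro i
      by_cases e1 : i = i1
      · subst e1; simp [*]
      · simp only [e1, if_false]; split_ifs <;> omega
    all_goals simp [Finset.sum_add_distrib, *] <;> omega

end CBProof

namespace CBProof
open ConicBundleFormalization

theorem isBihom_iff_BD {K : Type} [Field K] {n : ℕ} {w : Fin 3 → ℤ} {d : ℤ} {k : ℕ}
    {g : MvPolynomial (Fin n ⊕ Fin 3) K} :
    IsBihom K n 3 w (fun _ => 1) d k g ↔ BD w d k g := by
  simp only [IsBihom, BD, mul_one]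

/-- The bigrading weights. -/
def wtf {n : ℕ} (w : Fin 3 → ℤ) : Fin n ⊕ Fin 3 → ℤ ×ₗ ℕ :=
  Sum.elim (fun _ => toLex (1, 0)) (fun j => toLex (w j, 1))

theorem weight_wtf {n : ℕ} (w : Fin 3 → ℤ) (e : Fin n ⊕ Fin 3 →₀ ℕ) :
    Finsupp.weight (wtf w) e = toLex ((∑ i : Fin n, (e (Sum.inl i) : ℤ)) +
      ∑ j : Fin 3, (e (Sum.inr j) : ℤ) * w j, ∑ j : Fin 3, e (Sum.inr j)) := by
  rw [Finsupp.weight_apply, Finsupp.sum_fintype _ _ (by intro i; exact zero_smul _ _),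
    Fintype.sum_sum_type]
  apply (ofLex (α := ℤ × ℕ)).injective
  have hadd : ∀ a b : ℤ ×ₗ ℕ, ofLex (a + b) = ofLex a + ofLex b := fun _ _ => rfl
  let om : ℤ ×ₗ ℕ →+ ℤ × ℕ := { toFun := fun a => ofLex a, map_zero' := rfl, map_add' := hadd }
  have hsum : ∀ {ι : Type} (s : Finset ι) (f : ι → ℤ ×ₗ ℕ),
      ofLex (∑ i ∈ s, f i) = ∑ i ∈ s, ofLex (f i) := fun s f =>
    map_sum om f s
  rw [hadd, hsum, hsum]
  have hs : ∀ (m : ℕ) (a : ℤ ×ₗ ℕ), ofLex (m • a) = m • ofLex a := fun m a =>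
    map_nsmul om m a
  simp only [hs, wtf, Sum.elim_inl, Sum.elim_inr, ofLex_toLex]
  ext
  · simp [Prod.fst_sum]
  · simp [Prod.snd_sum]

theorem BD_iff_wh {K : Type} [Field K] {n : ℕ} {w : Fin 3 → ℤ} {d : ℤ} {k : ℕ}
    {g : MvPolynomial (Fin n ⊕ Fin 3) K} :
    BD w d k g ↔ IsWeightedHomogeneous (wtf w) g (toLex (d, k)) := by
  simp only [BD, IsWeightedHomogeneous, mem_support_iff, weight_wtf, toLex_inj, Prod.mk.injEq]

theorem min_bihom {K : Type} [Field K] {n : ℕ} {w : Fin 3 → ℤ}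
    (s : Set (Cox K n 3)) (hs : ∀ f ∈ s, ∃ d k, BD w d k f) (Q : Ideal (Cox K n 3))
    (hQ : Q ∈ (Ideal.span s).minimalPrimes) : IsBihomIdeal K w (fun _ => 1) Q := by
  classical
  letI := weightedGradedAlgebra K (wtf (n := n) w)
  have hp : Q.IsPrime := hQ.1.1
  have hcp := Ideal.IsPrime.homogeneousCore (𝒜 := weightedHomogeneousSubmodule K (wtf (n := n) w)) hp
  have hle : (Q.homogeneousCore (weightedHomogeneousSubmodule K (wtf (n := n) w))).toIdeal ≤ Q :=
    Ideal.toIdeal_homogeneousCore_le _ Q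
  have h2 : Ideal.span s ≤
      (Q.homogeneousCore (weightedHomogeneousSubmodule K (wtf (n := n) w))).toIdeal := by
    rw [Ideal.span_le]
    intro f hf
    obtain ⟨d, k, hfd⟩ := hs f hf
    refine Ideal.mem_homogeneousCore_of_homogeneous_of_mem ⟨toLex (d, k), ?_⟩
      (hQ.1.2 (Ideal.subset_span hf))
    exact BD_iff_wh.1 hfd
  have h3 := hQ.2 ⟨hcp, h2⟩ hle
  intro f hf
  have hf' := h3 hf
  change f ∈ Ideal.span _ at hf'
  refine Ideal.span_mono ?_ hf'
  rintro _ ⟨⟨x, ⟨i, hx⟩⟩, hxQ, rfl⟩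
  refine ⟨hxQ, (ofLex i).1, (ofLex i).2, isBihom_iff_BD.2 (BD_iff_wh.2 ?_)⟩
  exact hx

theorem height_ge_two {A : Type*} [CommRing A] [IsDomain A] (Q : Ideal A) [Q.IsPrime] (g f : A)
    (hg0 : g ≠ 0) (hg : (Ideal.span {g}).IsPrime) (hgQ : g ∈ Q) (hfQ : f ∈ Q)
    (hf : f ∉ Ideal.span {g}) : 2 ≤ Q.height := by
  haveI := hg
  have h1 : (⊥ : Ideal A) < Ideal.span {g} := by
    rw [bot_lt_iff_ne_bot, Ne, Ideal.span_singleton_eq_bot]; exact hg0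
  have h2 : Ideal.span {g} < Q := by
    refine lt_of_le_of_ne ?_ ?_
    · rw [Ideal.span_singleton_le_iff_mem]; exact hgQ
    · intro h; rw [h] at hf; exact hf hfQ
  have h3 := Ideal.height_add_one_le_of_lt_of_isPrime h1
  have h4 := Ideal.height_add_one_le_of_lt_of_isPrime h2
  calc (2 : ℕ∞) = 1 + 1 := by norm_num
    _ ≤ (Ideal.span {g}).height + 1 := by gcongr; exact le_trans (by simp) h3
    _ ≤ Q.height := h4

theorem height_le_two {A : Type*} [CommRing A] [IsNoetherianRing A] (Q : Ideal A) (f g : A)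
    (h : Q ∈ (Ideal.span {f, g}).minimalPrimes) : Q.height ≤ 2 := by
  refine (Ideal.height_le_card_of_mem_minimalPrimes_span (by simp) h).trans ?_
  have := Set.ncard_insert_le f {g}
  rw [Set.ncard_singleton] at this
  exact_mod_cast this

theorem isPrimeDivisor_of {K : Type} [Field K] {n : ℕ} {w : Fin 3 → ℤ} {g : Cox K n 3}
    (Q : Ideal (Cox K n 3)) (hp : Q.IsPrime) (h1 : g ∈ Q) (h2 : RelevantPrime K Q)
    (h3 : IsBihomIdeal K w (fun _ => 1) Q) (h4 : 2 ≤ Q.height) (h5 : Q.height ≤ 2) :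
    IsPrimeDivisorOn K w (fun _ => 1) g ⟨Q, hp⟩ := by
  refine ⟨h1, h2, h3, ?_⟩
  rw [IsLocalization.AtPrime.ringKrullDim_eq_height Q]
  rw [le_antisymm h5 h4]
  rfl

end CBProof

namespace CBProof
open ConicBundleFormalization

section kil
open scoped Classical in
/-- Kill the variables in `J`. -/
noncomputable def kil {σ K : Type*} [Field K] (J : Finset σ) :
    MvPolynomial σ K →ₐ[K] MvPolynomial σ K :=
  aeval (fun v => if v ∈ J then 0 else X v)

variable {σ K : Type*} [Field K]

theorem kil_mem {J : Finset σ} {v : σ} (h : v ∈ J) : kil (K := K) J (X v) = 0 := by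
  simp [kil, h]

theorem kil_not_mem {J : Finset σ} {v : σ} (h : v ∉ J) : kil (K := K) J (X v) = X v := by
  simp [kil, h]

theorem kil_mono {J J' : Finset σ} (h : J ⊆ J') (f : MvPolynomial σ K) :
    kil J' (kil J f) = kil J' f := by
  have : (kil (K := K) J').comp (kil J) = kil J' := by
    apply MvPolynomial.algHom_ext
    intro v
    rw [AlgHom.comp_apply]
    by_cases hv : v ∈ J
    · rw [kil_mem hv, map_zero, kil_mem (h hv)]
    · rw [kil_not_mem hv]
  exact DFunLike.congr_fun this f

instance kil_prime (J : Finset σ) : (RingHom.ker (kil (K := K) J)).IsPrime :=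
  RingHom.ker_isPrime _

theorem kil_height (J : Finset σ) : (J.card : ℕ∞) ≤ (RingHom.ker (kil (K := K) J)).height := by
  classical
  induction J using Finset.induction_on with
  | empty => simp
  | insert a J ha ih =>
    have hlt : RingHom.ker (kil (K := K) J) < RingHom.ker (kil (K := K) (insert a J)) := by
      refine lt_of_le_of_ne ?_ ?_
      · intro f hf
        rw [RingHom.mem_ker] at hf ⊢
        rw [← kil_mono (Finset.subset_insert a J), hf, map_zero]
      · intro h
        have h1 : (X a : MvPolynomial σ K) ∈ RingHom.ker (kil (K := K) (insert a J)) := by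
          rw [RingHom.mem_ker]
          exact kil_mem (Finset.mem_insert_self _ _)
        rw [← h, RingHom.mem_ker, kil_not_mem ha] at h1
        exact X_ne_zero a h1
    have := Ideal.height_add_one_le_of_lt_of_isPrime hlt
    rw [Finset.card_insert_of_notMem ha]
    push_cast
    exact le_trans (by gcongr) this

end kil

section pic
variable {K : Type} [Field K] {n : ℕ}

open scoped Classical in
/-- Substitute `S` for the fibre variable `s`. -/
noncomputable def evs (s : Fin 3) (S : Cox K n 3) : Cox K n 3 →ₐ[K] Cox K n 3 :=
  aeval (fun v => if v = Sum.inr s then S else X v)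

theorem evs_self (s : Fin 3) (S : Cox K n 3) : evs s S (X (Sum.inr s)) = S := by simp [evs]

theorem evs_ne (s : Fin 3) (S : Cox K n 3) {v : Fin n ⊕ Fin 3} (h : v ≠ Sum.inr s) :
    evs s S (X v) = X v := by simp [evs, h]

theorem evs_u (s : Fin 3) (S : Cox K n 3) (f : MvPolynomial (Fin n) K) :
    evs s S (rename Sum.inl f) = rename Sum.inl f := by
  have : (evs s S).comp (rename Sum.inl) = rename (Sum.inl : Fin n → Fin n ⊕ Fin 3) := by
    apply MvPolynomial.algHom_ext
    intro v
    rw [AlgHom.comp_apply, rename_X, evs_ne _ _ (by simp)]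
  exact DFunLike.congr_fun this f

theorem evs_sub (s : Fin 3) (S : Cox K n 3) (f : Cox K n 3) :
    f - evs s S f ∈ Ideal.span {X (Sum.inr s) - S} := by
  rw [← Ideal.Quotient.eq]
  have : (Ideal.Quotient.mkₐ K (Ideal.span {X (Sum.inr s) - S})) =
      (Ideal.Quotient.mkₐ K (Ideal.span {X (Sum.inr s) - S})).comp (evs s S) := by
    apply MvPolynomial.algHom_ext
    intro v
    rw [AlgHom.comp_apply]
    by_cases h : v = Sum.inr s
    · subst h
      rw [evs_self]
      exact Ideal.Quotient.eq.2 (Ideal.mem_span_singleton_self _)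
    · rw [evs_ne _ _ h]
  exact DFunLike.congr_fun this f

theorem comap_evs (s : Fin 3) (S : Cox K n 3) (hS : ∀ R, evs s R S = S) (h : MvPolynomial (Fin n) K) :
    (Ideal.span {rename Sum.inl h}).comap (evs s S) =
      Ideal.span {rename Sum.inl h, X (Sum.inr s) - S} := by
  apply le_antisymm
  · intro f hf
    rw [Ideal.mem_comap] at hf
    have h1 := evs_sub s S f
    have : f = evs s S f + (f - evs s S f) := by ring
    rw [this]
    exact add_mem (Ideal.span_mono (by simp) hf) (Ideal.span_mono (by simp) h1)
  · rw [Ideal.span_le]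
    rintro f (rfl | rfl)
    · rw [SetLike.mem_coe, Ideal.mem_comap, evs_u]
      exact Ideal.mem_span_singleton_self _
    · rw [SetLike.mem_coe, Ideal.mem_comap, map_sub, evs_self, hS, sub_self]
      exact zero_mem _

theorem prime_rename_inl {h : MvPolynomial (Fin n) K} (hh : Prime h) :
    Prime (rename Sum.inl h : Cox K n 3) := by
  set E := (renameEquiv K (Equiv.sumComm (Fin n) (Fin 3))).trans (sumAlgEquiv K (Fin 3) (Fin n)) with hE
  have h1 : E (rename Sum.inl h) = C h := by
    have : (E : Cox K n 3 →ₐ[K] _).comp (rename Sum.inl) =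
        IsScalarTower.toAlgHom K (MvPolynomial (Fin n) K) (MvPolynomial (Fin 3) (MvPolynomial (Fin n) K)) := by
      apply MvPolynomial.algHom_ext
      intro v
      simp [hE]
    exact DFunLike.congr_fun this h
  rw [← MulEquiv.prime_iff E, h1]
  exact (prime_C_iff (Fin 3)).2 hh

theorem divisor_of (hn : 2 ≤ n) {w : Fin 3 → ℤ} {g : Cox K n 3} (s : Fin 3) (S : Cox K n 3)
    (hS : ∀ R, evs s R S = S) (BS : BD w (w s) 1 S) (h : MvPolynomial (Fin n) K) (hh : Prime h)
    (hb : IsBihomIdeal K w (fun _ => 1) (Ideal.span {(rename Sum.inl h : Cox K n 3)}))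
    (hg : g ∈ Ideal.span {rename Sum.inl h, X (Sum.inr s) - S}) :
    ∃ hp : (Ideal.span {rename Sum.inl h, X (Sum.inr s) - S}).IsPrime,
    IsPrimeDivisorOn K w (fun _ => 1) g ⟨Ideal.span {rename Sum.inl h, X (Sum.inr s) - S}, hp⟩ := by
  have hH : Prime (rename Sum.inl h : Cox K n 3) := prime_rename_inl hh
  haveI hHp : (Ideal.span {(rename Sum.inl h : Cox K n 3)}).IsPrime :=
    (Ideal.span_singleton_prime hH.ne_zero).2 hH
  haveI hp : (Ideal.span {rename Sum.inl h, X (Sum.inr s) - S}).IsPrime := by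
    rw [← comap_evs s S hS]
    exact Ideal.comap_isPrime _ _
  refine ⟨hp, isPrimeDivisor_of _ hp hg ⟨?_, ?_⟩ ?_ ?_ ?_⟩
  · by_contra hcon
    push Not at hcon
    have hd : ∀ i, Associated (rename Sum.inl h : Cox K n 3) (X (Sum.inl i)) := by
      intro i
      have := hcon i
      rw [← comap_evs s S hS, Ideal.mem_comap, evs_ne _ _ (by simp), Ideal.mem_span_singleton] at this
      exact (hH.dvd_prime_iff_associated X_prime).1 this
    have := ((hd ⟨0, by omega⟩).symm.trans (hd ⟨1, by omega⟩)).dvd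
    rw [X_dvd_X] at this
    simp at this
  · obtain ⟨j, hj⟩ : ∃ j : Fin 3, j ≠ s := exists_ne s
    refine ⟨j, fun hcon => ?_⟩
    rw [← comap_evs s S hS, Ideal.mem_comap, evs_ne _ _ (by simpa using hj), Ideal.mem_span_singleton,
      hH.dvd_prime_iff_associated X_prime] at hcon
    have := map_dvd (aeval (Sum.elim X (fun _ => 0)) : Cox K n 3 →ₐ[K] MvPolynomial (Fin n) K)
      hcon.symm.dvd
    rw [aeval_X, aeval_rename, Sum.elim_inr, zero_dvd_iff] at this
    have e : (Sum.elim X (fun _ => 0) : Fin n ⊕ Fin 3 → MvPolynomial (Fin n) K) ∘ Sum.inl = X := rfl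
    rw [e, aeval_X_left_apply] at this
    exact hh.ne_zero this
  · rw [IsBihomIdeal, Ideal.span_le]
    rintro f (rfl | rfl)
    · refine Ideal.span_mono ?_ (hb (Ideal.mem_span_singleton_self _))
      rintro x ⟨hx, h'⟩
      exact ⟨Ideal.span_mono (by simp) hx, h'⟩
    · refine Ideal.subset_span ⟨Ideal.subset_span (by simp), w s, 1, isBihom_iff_BD.2 ?_⟩
      rw [sub_eq_add_neg, ← neg_one_mul]
      refine (BD.xr s).add ?_
      have := (BD.C (n := n) (w := w) (-1 : K)).mul BS
      rw [map_neg, map_one] at this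
      exact this.congr (zero_add _) (zero_add _)
  · refine height_ge_two _ (rename Sum.inl h) (X (Sum.inr s) - S) hH.ne_zero hHp
      (Ideal.subset_span (by simp)) (Ideal.subset_span (by simp)) ?_
    rw [Ideal.mem_span_singleton]
    intro hd
    have := map_dvd (evs s (S + 1)) hd
    rw [evs_u, map_sub, evs_self, hS, add_sub_cancel_left] at this
    exact hH.not_unit (isUnit_of_dvd_one this)
  · apply height_le_two _ (rename Sum.inl h) (X (Sum.inr s) - S)
    rw [Ideal.minimalPrimes_eq_subsingleton_self]
    rfl

theorem exists_h0 (hn : 2 ≤ n) {w : Fin 3 → ℤ} (b : MvPolynomial (Fin n) K) (δ : ℤ) (hδ : 0 < δ)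
    (hb : IsHomogZ K n δ b) : ∃ h : MvPolynomial (Fin n) K, Prime h ∧ h ∣ b ∧
      IsBihomIdeal K w (fun _ => 1) (Ideal.span {(rename Sum.inl h : Cox K n 3)}) := by
  by_cases hb0 : b = 0
  · refine ⟨X ⟨0, by omega⟩, X_prime, by simp [hb0], ?_⟩
    rw [IsBihomIdeal, Ideal.span_le]
    rintro f rfl
    refine Ideal.subset_span ⟨Ideal.subset_span rfl, 1, 0, isBihom_iff_BD.2 ?_⟩
    rw [rename_X]
    exact BD.xl _
  · have hbu : ¬ IsUnit b := by
      intro hu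
      rw [MvPolynomial.isUnit_iff_eq_C_of_isReduced] at hu
      obtain ⟨c, hc, rfl⟩ := hu
      have := hb 0 (by rw [mem_support_iff, coeff_zero_C]; exact hc.ne_zero)
      simp at this
      omega
    obtain ⟨h, hi, hd⟩ := WfDvdMonoid.exists_irreducible_factor hbu hb0
    have hh := hi.prime
    have hH : Prime (rename Sum.inl h : Cox K n 3) := prime_rename_inl hh
    haveI hHp : (Ideal.span {(rename Sum.inl h : Cox K n 3)}).IsPrime :=
      (Ideal.span_singleton_prime hH.ne_zero).2 hH
    refine ⟨h, hh, hd, min_bihom {rename Sum.inl b} ?_ _ ⟨⟨hHp, ?_⟩, ?_⟩⟩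
    · rintro f rfl
      refine ⟨δ, 0, ?_⟩
      intro e he
      classical
      rw [support_rename_of_injective Sum.inl_injective, Finset.mem_image] at he
      obtain ⟨e', he', rfl⟩ := he
      have hr : ∀ j : Fin 3, (Finsupp.mapDomain (Sum.inl : Fin n → Fin n ⊕ Fin 3) e') (Sum.inr j) = 0 :=
        fun j => Finsupp.mapDomain_notin_range _ _ (by simp)
      have hl : ∀ i, (Finsupp.mapDomain (Sum.inl : Fin n → Fin n ⊕ Fin 3) e') (Sum.inl i) = e' i :=
        fun i => Finsupp.mapDomain_apply Sum.inl_injective _ _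
      simp only [hr, hl]
      simpa using hb e' he'
    · rw [Ideal.span_singleton_le_iff_mem, Ideal.mem_span_singleton]
      exact map_dvd (rename (Sum.inl : Fin n → Fin n ⊕ Fin 3)) hd
    · rintro q ⟨hq, hbq⟩ hle
      haveI := hq
      by_contra hlt
      have hlt' : q < Ideal.span {(rename Sum.inl h : Cox K n 3)} := lt_of_le_not_ge hle hlt
      have h0 : (⊥ : Ideal (Cox K n 3)) < q := by
        rw [bot_lt_iff_ne_bot]
        rintro rfl
        rw [Ideal.span_singleton_le_iff_mem, Ideal.mem_bot] at hbq
        exact hb0 (rename_injective _ Sum.inl_injective (by rw [hbq, map_zero]))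
      have h1 := Ideal.height_add_one_le_of_lt_of_isPrime h0
      have h2 := Ideal.height_add_one_le_of_lt_of_isPrime hlt'
      have h3 : (Ideal.span {(rename Sum.inl h : Cox K n 3)}).height ≤ 1 := by
        have := Ideal.height_le_card_of_mem_minimalPrimes_span (p := Ideal.span {(rename Sum.inl h : Cox K n 3)})
          (s := {(rename Sum.inl h : Cox K n 3)}) (by simp)
          (by rw [Ideal.minimalPrimes_eq_subsingleton_self]; rfl)
        simpa using this
      have h4 : (1 : ℕ∞) ≤ q.height := le_trans (by simp) h1
      have h5 : (1 : ℕ∞) + 1 ≤ 1 := le_trans (by gcongr) (h2.trans h3)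
      exact absurd h5 (by decide)

end pic

end CBProof

namespace CBProof
open ConicBundleFormalization

section pic
variable {K : Type} [Field K] {n : ℕ}

theorem BD_rename {w : Fin 3 → ℤ} {δ : ℤ} {b : MvPolynomial (Fin n) K} (hb : IsHomogZ K n δ b) :
    BD w δ 0 (rename Sum.inl b : Cox K n 3) := by
  intro e he
  classical
  rw [support_rename_of_injective Sum.inl_injective, Finset.mem_image] at he
  obtain ⟨e', he', rfl⟩ := he
  have hr : ∀ j : Fin 3, (Finsupp.mapDomain (Sum.inl : Fin n → Fin n ⊕ Fin 3) e') (Sum.inr j) = 0 :=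
    fun j => Finsupp.mapDomain_notin_range _ _ (by simp)
  have hl : ∀ i, (Finsupp.mapDomain (Sum.inl : Fin n → Fin n ⊕ Fin 3) e') (Sum.inl i) = e' i :=
    fun i => Finsupp.mapDomain_apply Sum.inl_injective _ _
  simp only [hr, hl]
  simpa using hb e' he'

theorem BD_zero_rename {w : Fin 3 → ℤ} {δ : ℤ} {f : Cox K n 3} (hf : BD w δ 0 f) :
    ∃ f0 : MvPolynomial (Fin n) K, f = rename Sum.inl f0 := by
  have : ∃ q : MvPolynomial (Fin n) K, rename Sum.inl q = f := by
    apply exists_rename_eq_of_vars_subset_range f Sum.inl Sum.inl_injective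
    intro v hv
    rw [Finset.mem_coe, mem_vars] at hv
    obtain ⟨e, he, hv⟩ := hv
    rcases v with i | j
    · exact ⟨i, rfl⟩
    · exfalso
      have := (hf e he).2
      rw [Finset.sum_eq_zero_iff] at this
      exact (Finsupp.mem_support_iff.1 hv) (this j (Finset.mem_univ _))
  obtain ⟨q, hq⟩ := this
  exact ⟨q, hq.symm⟩

/-- The set of fibre variables. -/
def fibJ (n : ℕ) : Finset (Fin n ⊕ Fin 3) := Finset.univ.map ⟨Sum.inr, Sum.inr_injective⟩

theorem mem_kil_of_BD {w : Fin 3 → ℤ} {δ : ℤ} {k : ℕ} {f : Cox K n 3} (hf : BD w δ k f)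
    (hk : 0 < k) : f ∈ RingHom.ker (kil (K := K) (fibJ n)) := by
  rw [RingHom.mem_ker, f.as_sum, map_sum]
  refine Finset.sum_eq_zero fun e he => ?_
  have := (hf e he).2
  have : ∃ j : Fin 3, e (Sum.inr j) ≠ 0 := by
    by_contra hcon
    push Not at hcon
    simp [hcon] at this
    omega
  obtain ⟨j, hj⟩ := this
  rw [monomial_eq, map_mul, Finsupp.prod, map_prod]
  rw [Finset.prod_eq_zero (i := Sum.inr j) (Finsupp.mem_support_iff.2 hj), mul_zero]
  rw [map_pow, kil_mem (by simp [fibJ]), zero_pow hj]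

theorem pic_contra (hn : 2 ≤ n) {w : Fin 3 → ℤ} {d : ℤ} {g : Cox K n 3} (hg : BD w d 2 g) (hg0 : g ≠ 0)
    (hgp : (Ideal.span {g}).IsPrime) (hpic : ClassGroupSpannedByFD K w (fun _ => 1) g)
    (s s' : Fin 3) (S S' T : Cox K n 3) (c : K) (b : MvPolynomial (Fin n) K)
    (hgeq : g = C c * (X (Sum.inr s) - S) * (X (Sum.inr s') - S') + rename Sum.inl b * T)
    (hS : ∀ R, evs s R S = S) (hS' : ∀ R, evs s' R S' = S')
    (BS : BD w (w s) 1 S) (BS' : BD w (w s') 1 S')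
    (δ : ℤ) (hδ : 0 < δ) (hb : IsHomogZ K n δ b)
    (v : Fin 3 → MvPolynomial (Fin n) K) (c0 : K) (hc0 : c0 ≠ 0)
    (hv : aeval (Sum.elim X v) (X (Sum.inr s) - S) = 0)
    (hv' : aeval (Sum.elim X v) (X (Sum.inr s') - S') = C c0) : False := by
  obtain ⟨h, hh, hd, hbi⟩ := exists_h0 (w := w) hn b δ hδ hb
  have hdR : (rename Sum.inl h : Cox K n 3) ∣ rename Sum.inl b :=
    map_dvd (rename (Sum.inl : Fin n → Fin n ⊕ Fin 3)) hd
  have hgP : g ∈ Ideal.span {rename Sum.inl h, X (Sum.inr s) - S} := by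
    rw [hgeq]
    refine add_mem (Ideal.mul_mem_right _ _ (Ideal.mul_mem_left _ _ (Ideal.subset_span (by simp))))
      (Ideal.mul_mem_right _ _ ?_)
    obtain ⟨t, ht⟩ := hdR
    rw [ht]
    exact Ideal.mul_mem_right _ _ (Ideal.subset_span (by simp))
  have hgP' : g ∈ Ideal.span {rename Sum.inl h, X (Sum.inr s') - S'} := by
    rw [hgeq]
    refine add_mem (Ideal.mul_mem_left _ _ (Ideal.subset_span (by simp)))
      (Ideal.mul_mem_right _ _ ?_)
    obtain ⟨t, ht⟩ := hdR
    rw [ht]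
    exact Ideal.mul_mem_right _ _ (Ideal.subset_span (by simp))
  obtain ⟨hp, hdiv⟩ := divisor_of hn s S hS BS h hh hbi hgP
  obtain ⟨hp', hdiv'⟩ := divisor_of hn s' S' hS' BS' h hh hbi hgP'
  have hel : (Sum.elim X v : Fin n ⊕ Fin 3 → MvPolynomial (Fin n) K) ∘ Sum.inl = X := rfl
  have hne : Ideal.span {rename Sum.inl h, X (Sum.inr s') - S'} ≠
      Ideal.span {rename Sum.inl h, X (Sum.inr s) - S} := by
    intro heq
    have h1 : X (Sum.inr s') - S' ∈ Ideal.span {rename Sum.inl h, X (Sum.inr s) - S} := by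
      rw [← heq]; exact Ideal.subset_span (by simp)
    rw [Ideal.mem_span_pair] at h1
    obtain ⟨a1, a2, h1⟩ := h1
    have h2 := congrArg (aeval (Sum.elim X v : Fin n ⊕ Fin 3 → MvPolynomial (Fin n) K)) h1
    rw [hv', map_add, map_mul, map_mul, hv, mul_zero, add_zero, aeval_rename, hel,
      aeval_X_left_apply] at h2
    have h3 : h ∣ C c0 := ⟨_, by rw [← h2, mul_comm]⟩
    exact hh.not_unit (isUnit_of_dvd_unit h3 ((isUnit_iff_ne_zero.2 hc0).map C))
  obtain ⟨α, β, f, hf0, hf1, hf2, hf3⟩ := hpic _ hdiv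
  rw [isBihom_iff_BD] at hf1
  rcases Nat.eq_zero_or_pos β with rfl | hβ
  · obtain ⟨f0, rfl⟩ := BD_zero_rename hf1
    refine hf3 _ hdiv' (fun h => hne (congrArg PrimeSpectrum.asIdeal h)) ?_
    have hf2' : rename Sum.inl f0 ∈ Ideal.span {rename Sum.inl h, X (Sum.inr s) - S} := hf2
    rw [← comap_evs s S hS, Ideal.mem_comap, evs_u] at hf2'
    exact Ideal.span_mono (by simp) hf2'
  · have hfX := mem_kil_of_BD hf1 hβ
    have hgX := mem_kil_of_BD hg (by norm_num)
    obtain ⟨Q, hQ, hQle⟩ := Ideal.exists_minimalPrimes_le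
      (I := Ideal.span {f, g}) (J := RingHom.ker (kil (K := K) (fibJ n)))
      (by rw [Ideal.span_le]; rintro x (rfl | rfl) <;> assumption)
    have hQp : Q.IsPrime := hQ.1.1
    have hfQ : f ∈ Q := hQ.1.2 (Ideal.subset_span (by simp))
    have hgQ : g ∈ Q := hQ.1.2 (Ideal.subset_span (by simp))
    have hQ2 := height_le_two Q f g hQ
    have hQdiv : IsPrimeDivisorOn K w (fun _ => 1) g ⟨Q, hQp⟩ := by
      refine isPrimeDivisor_of Q hQp hgQ ⟨⟨⟨0, by omega⟩, fun hx => ?_⟩, ?_⟩ ?_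
        (height_ge_two Q g f hg0 hgp hgQ hfQ hf0) hQ2
      · have := hQle hx
        rw [RingHom.mem_ker, kil_not_mem (by simp [fibJ])] at this
        exact X_ne_zero _ this
      · by_contra hcon
        push Not at hcon
        have hle : RingHom.ker (kil (K := K) (fibJ n)) ≤ Q := by
          intro x hx
          have h1 : x - kil (K := K) (fibJ n) x ∈ Q := by
            rw [← Ideal.Quotient.eq]
            have : (Ideal.Quotient.mkₐ K Q) = (Ideal.Quotient.mkₐ K Q).comp (kil (K := K) (fibJ n)) := by
              apply MvPolynomial.algHom_ext
              intro v
              rw [AlgHom.comp_apply]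
              rcases v with i | j
              · rw [kil_not_mem (by simp [fibJ])]
              · rw [kil_mem (by simp [fibJ]), map_zero]
                exact Ideal.Quotient.eq_zero_iff_mem.2 (hcon j)
            exact DFunLike.congr_fun this x
          rw [RingHom.mem_ker] at hx
          rwa [hx, sub_zero] at h1
        have h3 := kil_height (K := K) (fibJ n)
        have h4 := (Ideal.height_mono hle).trans hQ2
        have h5 := h3.trans h4
        simp only [fibJ, Finset.card_map, Finset.card_univ, Fintype.card_fin] at h5
        exact absurd h5 (by decide)
      · refine min_bihom {f, g} ?_ Q hQ
        rintro x (rfl | rfl)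
        · exact ⟨_, _, hf1⟩
        · exact ⟨_, _, hg⟩
    refine hf3 _ hQdiv (fun heq => ?_) hfQ
    have heq' : Q = _ := congrArg PrimeSpectrum.asIdeal heq
    have hhQ : rename Sum.inl h ∈ Q := by rw [heq']; exact Ideal.subset_span (by simp)
    have := hQle hhQ
    rw [RingHom.mem_ker] at this
    have h6 := congrArg (aeval (Sum.elim X v : Fin n ⊕ Fin 3 → MvPolynomial (Fin n) K)) this
    have h7 : kil (K := K) (fibJ n) (rename Sum.inl h) = rename Sum.inl h := by
      have : (kil (K := K) (fibJ n)).comp (rename Sum.inl) = rename (Sum.inl : Fin n → Fin n ⊕ Fin 3) := by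
        apply MvPolynomial.algHom_ext
        intro v
        rw [AlgHom.comp_apply, rename_X, kil_not_mem (by simp [fibJ])]
      exact DFunLike.congr_fun this h
    rw [h7, aeval_rename, hel, aeval_X_left_apply, map_zero] at h6
    exact hh.ne_zero h6

end pic
end CBProof

namespace CBProof
open ConicBundleFormalization

section dec
variable {K : Type} [Field K] {n : ℕ}

/-- The isomorphism used to define the fibre coefficients. -/
noncomputable def EE (K : Type) [Field K] (n : ℕ) :
    Cox K n 3 →ₐ[K] MvPolynomial (Fin 3) (MvPolynomial (Fin n) K) :=
  ((sumAlgEquiv K (Fin 3) (Fin n)) : _ →ₐ[K] _).comp (rename Sum.swap)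

theorem EE_l (i : Fin n) : EE K n (X (Sum.inl i)) = C (X i) := by simp [EE]
theorem EE_r (j : Fin 3) : EE K n (X (Sum.inr j)) = X j := by simp [EE]
theorem EE_C (c : K) : EE K n (C c) = C (C c) := by simp [EE]

theorem fibreCoeff_EE (g : Cox K n 3) (ε : Fin 3 →₀ ℕ) : fibreCoeff K g ε = (EE K n g).coeff ε := rfl

theorem EE_inj : Function.Injective (EE K n) := by
  intro a b h
  have h1 : rename Sum.swap a = rename Sum.swap b := (sumAlgEquiv K (Fin 3) (Fin n)).injective h
  exact rename_injective _ (Equiv.sumComm (Fin n) (Fin 3)).injective h1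

theorem EE_rename (f : MvPolynomial (Fin n) K) : EE K n (rename Sum.inl f) = C f := by
  have : (EE K n).comp (rename Sum.inl) =
      IsScalarTower.toAlgHom K (MvPolynomial (Fin n) K) (MvPolynomial (Fin 3) (MvPolynomial (Fin n) K)) := by
    apply MvPolynomial.algHom_ext
    intro v
    rw [AlgHom.comp_apply, rename_X, EE_l]
    rfl
  exact DFunLike.congr_fun this f

theorem EE_monomial (a : Fin n →₀ ℕ) (ε : Fin 3 →₀ ℕ) (c : K) :
    EE K n (monomial (Finsupp.sumElim a ε) c) = monomial ε (monomial a c) := by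
  rw [monomial_eq, monomial_eq, monomial_eq, Finsupp.prod_fintype _ _ (by simp),
    Finsupp.prod_fintype _ _ (by simp), Finsupp.prod_fintype _ _ (by simp), Fintype.prod_sum_type]
  simp only [map_mul, map_prod, map_pow, EE_l, EE_r, EE_C, Finsupp.sumElim_inl, Finsupp.sumElim_inr]
  ring

theorem exists_sumElim (e : Fin n ⊕ Fin 3 →₀ ℕ) : ∃ a ε, e = Finsupp.sumElim a ε :=
  ⟨e.comapDomain Sum.inl Sum.inl_injective.injOn, e.comapDomain Sum.inr Sum.inr_injective.injOn, by
    ext (i | j) <;> simp⟩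

theorem coeff_EE (g : Cox K n 3) (ε : Fin 3 →₀ ℕ) (a : Fin n →₀ ℕ) :
    ((EE K n g).coeff ε).coeff a = g.coeff (Finsupp.sumElim a ε) := by
  classical
  induction g using MvPolynomial.induction_on' with
  | monomial e c =>
    obtain ⟨a', ε', rfl⟩ := exists_sumElim e
    rw [EE_monomial, coeff_monomial, coeff_monomial]
    by_cases h1 : ε' = ε
    · subst h1
      rw [if_pos rfl, coeff_monomial]
      by_cases h2 : a' = a
      · subst h2; simp
      · rw [if_neg h2, if_neg]
        intro h
        apply h2
        ext i
        simpa using DFunLike.congr_fun h (Sum.inl i)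
    · rw [if_neg h1, if_neg, coeff_zero]
      intro h
      apply h1
      ext i
      simpa using DFunLike.congr_fun h (Sum.inr i)
  | add p q hp hq => rw [map_add, coeff_add, coeff_add, coeff_add, hp, hq]

theorem fibre_homog {w : Fin 3 → ℤ} {d : ℤ} {k : ℕ} {g : Cox K n 3} (hg : BD w d k g) (ε : Fin 3 →₀ ℕ) :
    IsHomogZ K n (d - ∑ j, (ε j : ℤ) * w j) (fibreCoeff K g ε) := by
  intro a ha
  rw [mem_support_iff, fibreCoeff_EE, coeff_EE] at ha
  have := (hg _ (mem_support_iff.2 ha)).1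
  simp only [Finsupp.sumElim_inl, Finsupp.sumElim_inr] at this
  linarith

theorem fibre_zero {w : Fin 3 → ℤ} {d : ℤ} {k : ℕ} {g : Cox K n 3} (hg : BD w d k g) (ε : Fin 3 →₀ ℕ)
    (hε : ∑ j, ε j ≠ k) : fibreCoeff K g ε = 0 := by
  ext a
  rw [fibreCoeff_EE, coeff_EE, coeff_zero]
  by_contra h
  have := (hg _ (mem_support_iff.2 h)).2
  simp only [Finsupp.sumElim_inr] at this
  exact hε this

/-- notation for the coefficient of `X_i X_j` -/
noncomputable def fc (g : Cox K n 3) (i j : Fin 3) : MvPolynomial (Fin n) K :=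
  fibreCoeff K g (Finsupp.single i 1 + Finsupp.single j 1)

theorem fc_homog {w : Fin 3 → ℤ} {d : ℤ} {g : Cox K n 3} (hg : BD w d 2 g) (i j : Fin 3) :
    IsHomogZ K n (d - w i - w j) (fc g i j) := by
  have := fibre_homog hg (Finsupp.single i 1 + Finsupp.single j 1)
  have e : ∑ k, (((Finsupp.single i 1 + Finsupp.single j 1 : Fin 3 →₀ ℕ) k : ℕ) : ℤ) * w k = w i + w j := by
    simp [Finsupp.single_apply, add_mul, Finset.sum_add_distrib]
  rw [e, ← sub_sub] at this
  exact this

theorem fc_coeff0 (g : Cox K n 3) (i j : Fin 3) :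
    (fc g i j).coeff 0 = g.coeff (Finsupp.single (Sum.inr i) 1 + Finsupp.single (Sum.inr j) 1) := by
  rw [fc, fibreCoeff_EE, coeff_EE]
  congr 1
  ext (k | k) <;> simp [Finsupp.single_apply]

theorem fc_comm (g : Cox K n 3) (i j : Fin 3) : fc g i j = fc g j i := by
  rw [fc, fc, add_comm]

theorem quadratic_expand {R : Type*} [CommRing R] (G : MvPolynomial (Fin 3) R)
    (hG : ∀ ε : Fin 3 →₀ ℕ, ∑ j, ε j ≠ 2 → G.coeff ε = 0) :
    G = C (G.coeff (Finsupp.single 0 1 + Finsupp.single 0 1)) * (X 0 * X 0) +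
      C (G.coeff (Finsupp.single 1 1 + Finsupp.single 1 1)) * (X 1 * X 1) +
      C (G.coeff (Finsupp.single 2 1 + Finsupp.single 2 1)) * (X 2 * X 2) +
      C (G.coeff (Finsupp.single 0 1 + Finsupp.single 1 1)) * (X 0 * X 1) +
      C (G.coeff (Finsupp.single 0 1 + Finsupp.single 2 1)) * (X 0 * X 2) +
      C (G.coeff (Finsupp.single 1 1 + Finsupp.single 2 1)) * (X 1 * X 2) := by
  classical
  have hX : ∀ (c : R) (i j : Fin 3), C c * (X i * X j) =
      monomial (Finsupp.single i 1 + Finsupp.single j 1) c := by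
    intro c i j
    rw [X, X, monomial_mul, C_mul_monomial, one_mul, mul_one]
  simp only [hX]
  ext ε
  simp only [coeff_add, coeff_monomial, Finsupp.ext_iff, Fin.forall_fin_succ, Finsupp.coe_add, Pi.add_apply,
    Finsupp.single_apply]
  by_cases hs : ∑ j, ε j = 2
  · have hs' := hs
    rw [Fin.sum_univ_three] at hs'
    have key : ∀ i j : Fin 3, (∀ k, ε k = (Finsupp.single i 1 + Finsupp.single j 1 : Fin 3 →₀ ℕ) k) →
       ε = Finsupp.single i 1 + Finsupp.single j 1 := fun i j h => Finsupp.ext h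
    have h0 : ε 0 ≤ 2 := by omega
    have h1 : ε 1 ≤ 2 := by omega
    have hcases : (ε 0 = 2 ∧ ε 1 = 0 ∧ ε 2 = 0) ∨ (ε 0 = 0 ∧ ε 1 = 2 ∧ ε 2 = 0) ∨ (ε 0 = 0 ∧ ε 1 = 0 ∧ ε 2 = 2)
      ∨ (ε 0 = 1 ∧ ε 1 = 1 ∧ ε 2 = 0) ∨ (ε 0 = 1 ∧ ε 1 = 0 ∧ ε 2 = 1) ∨ (ε 0 = 0 ∧ ε 1 = 1 ∧ ε 2 = 1) := by
      omega
    rcases hcases with ⟨a, b, c⟩ | ⟨a, b, c⟩ | ⟨a, b, c⟩ | ⟨a, b, c⟩ | ⟨a, b, c⟩ | ⟨a, b, c⟩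
    · rw [key 0 0 (by simp [Fin.forall_fin_succ, a, b, c])]; simp
    · rw [key 1 1 (by simp [Fin.forall_fin_succ, a, b, c])]; simp
    · rw [key 2 2 (by simp [Fin.forall_fin_succ, a, b, c])]; simp
    · rw [key 0 1 (by simp [Fin.forall_fin_succ, a, b, c])]; simp
    · rw [key 0 2 (by simp [Fin.forall_fin_succ, a, b, c])]; simp
    · rw [key 1 2 (by simp [Fin.forall_fin_succ, a, b, c])]; simp
  · rw [hG ε hs]
    rw [Fin.sum_univ_three] at hs
    symm
    have : ∀ (P : Prop) [Decidable P] (c : R), ¬ P → (if P then c else 0) = 0 := fun P _ c h => if_neg h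
    simp only [Fin.succ_zero_eq_one, Fin.succ_one_eq_two] at *
    rw [this, this, this, this, this, this]
    · simp
    all_goals
      simp
      omega

theorem dec012 {w : Fin 3 → ℤ} {d : ℤ} {g : Cox K n 3} (hg : BD w d 2 g) :
    g = rename Sum.inl (fc g 0 0) * (X (Sum.inr 0) * X (Sum.inr 0)) +
      rename Sum.inl (fc g 1 1) * (X (Sum.inr 1) * X (Sum.inr 1)) +
      rename Sum.inl (fc g 2 2) * (X (Sum.inr 2) * X (Sum.inr 2)) +
      rename Sum.inl (fc g 0 1) * (X (Sum.inr 0) * X (Sum.inr 1)) +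
      rename Sum.inl (fc g 0 2) * (X (Sum.inr 0) * X (Sum.inr 2)) +
      rename Sum.inl (fc g 1 2) * (X (Sum.inr 1) * X (Sum.inr 2)) := by
  apply EE_inj
  simp only [map_add, map_mul, EE_rename, EE_r]
  exact quadratic_expand (EE K n g) (fun ε h => fibre_zero hg ε h)

theorem perm3 {p q r : Fin 3} (hqp : q ≠ p) (hrp : r ≠ p) (hqr : q ≠ r) :
    (p = 0 ∧ q = 1 ∧ r = 2) ∨ (p = 0 ∧ q = 2 ∧ r = 1) ∨ (p = 1 ∧ q = 0 ∧ r = 2) ∨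
    (p = 1 ∧ q = 2 ∧ r = 0) ∨ (p = 2 ∧ q = 0 ∧ r = 1) ∨ (p = 2 ∧ q = 1 ∧ r = 0) := by
  have : ∀ p q r : Fin 3, q ≠ p → r ≠ p → q ≠ r →
    (p = 0 ∧ q = 1 ∧ r = 2) ∨ (p = 0 ∧ q = 2 ∧ r = 1) ∨ (p = 1 ∧ q = 0 ∧ r = 2) ∨
    (p = 1 ∧ q = 2 ∧ r = 0) ∨ (p = 2 ∧ q = 0 ∧ r = 1) ∨ (p = 2 ∧ q = 1 ∧ r = 0) := by
    intro p q r; fin_cases p <;> fin_cases q <;> fin_cases r <;> simp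
  exact this p q r hqp hrp hqr

theorem dec {w : Fin 3 → ℤ} {d : ℤ} {g : Cox K n 3} (hg : BD w d 2 g) {p q r : Fin 3}
    (hqp : q ≠ p) (hrp : r ≠ p) (hqr : q ≠ r) :
    g = rename Sum.inl (fc g p p) * X (Sum.inr p) ^ 2 +
      rename Sum.inl (fc g q q) * X (Sum.inr q) ^ 2 +
      rename Sum.inl (fc g r r) * X (Sum.inr r) ^ 2 +
      rename Sum.inl (fc g p q) * (X (Sum.inr p) * X (Sum.inr q)) +
      rename Sum.inl (fc g p r) * (X (Sum.inr p) * X (Sum.inr r)) +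
      rename Sum.inl (fc g q r) * (X (Sum.inr q) * X (Sum.inr r)) := by
  have h := dec012 hg
  have c1 := fc_comm g 1 0
  have c2 := fc_comm g 2 0
  have c3 := fc_comm g 2 1
  rcases perm3 hqp hrp hqr with ⟨rfl, rfl, rfl⟩ | ⟨rfl, rfl, rfl⟩ | ⟨rfl, rfl, rfl⟩ | ⟨rfl, rfl, rfl⟩ |
    ⟨rfl, rfl, rfl⟩ | ⟨rfl, rfl, rfl⟩ <;> (try simp only [c1, c2, c3]) <;> linear_combination h

theorem disc_eq (h2 : (2 : K) ≠ 0) (g : Cox K n 3) {p q r : Fin 3}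
    (hqp : q ≠ p) (hrp : r ≠ p) (hqr : q ≠ r) :
    4 * discriminantPoly K g = 4 * (fc g p p * fc g q q * fc g r r) + fc g p q * fc g p r * fc g q r
      - fc g p p * fc g q r ^ 2 - fc g q q * fc g p r ^ 2 - fc g r r * fc g p q ^ 2 := by
  have hd : ∀ i, fibreCoeff K g (Finsupp.single i 2) = fc g i i := by
    intro i
    rw [fc, ← Finsupp.single_add]
  have h : (2 : MvPolynomial (Fin n) K) * C ((2 : K)⁻¹) = 1 := by
    rw [show (2 : MvPolynomial (Fin n) K) = C 2 from (map_ofNat C 2).symm, ← C_mul, mul_inv_cancel₀ h2, C_1]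
  have c1 := fc_comm g 1 0
  have c2 := fc_comm g 2 0
  have c3 := fc_comm g 2 1
  have base : 4 * discriminantPoly K g = 4 * (fc g 0 0 * fc g 1 1 * fc g 2 2) + fc g 0 1 * fc g 0 2 * fc g 1 2
      - fc g 0 0 * fc g 1 2 ^ 2 - fc g 1 1 * fc g 0 2 ^ 2 - fc g 2 2 * fc g 0 1 ^ 2 := by
    have hoff : ∀ i j : Fin 3, i ≠ j → quadraticMatrix K g i j = C ((2 : K)⁻¹) * fc g i j := by
      intro i j hij; rw [quadraticMatrix, if_neg hij]; rfl
    have hdg : ∀ i : Fin 3, quadraticMatrix K g i i = fc g i i := by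
      intro i; rw [quadraticMatrix, if_pos rfl, hd]
    rw [discriminantPoly, Matrix.det_fin_three]
    rw [hdg, hdg, hdg, hoff 0 1 (by decide), hoff 0 2 (by decide), hoff 1 2 (by decide), hoff 1 0 (by decide),
      hoff 2 0 (by decide), hoff 2 1 (by decide), c1, c2, c3]
    generalize C ((2 : K)⁻¹) = t at h
    have ht2 : 4 * t ^ 2 = 1 := by linear_combination (2 * t + 1) * h
    have ht3 : 8 * t ^ 3 = 1 := by linear_combination (4 * t ^ 2 + 2 * t + 1) * h
    linear_combination (fc g 0 1 * fc g 0 2 * fc g 1 2) * ht3 - (fc g 0 0 * fc g 1 2 ^ 2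
      + fc g 1 1 * fc g 0 2 ^ 2 + fc g 2 2 * fc g 0 1 ^ 2) * ht2
  rcases perm3 hqp hrp hqr with ⟨rfl, rfl, rfl⟩ | ⟨rfl, rfl, rfl⟩ | ⟨rfl, rfl, rfl⟩ | ⟨rfl, rfl, rfl⟩ |
    ⟨rfl, rfl, rfl⟩ | ⟨rfl, rfl, rfl⟩ <;> (try simp only [c1, c2, c3]) <;> linear_combination base

end dec
end CBProof

namespace CBProof
open ConicBundleFormalization

section hz
variable {K : Type} [Field K] {n : ℕ} {a b : ℤ} {f h : MvPolynomial (Fin n) K}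

theorem HZ.add (hf : IsHomogZ K n a f) (hh : IsHomogZ K n a h) : IsHomogZ K n a (f + h) := by
  classical
  intro e he
  rcases Finset.mem_union.1 (support_add he) with h' | h'
  · exact hf e h'
  · exact hh e h'

theorem HZ.mul (hf : IsHomogZ K n a f) (hh : IsHomogZ K n b h) : IsHomogZ K n (a + b) (f * h) := by
  classical
  intro e he
  obtain ⟨x, hx, y, hy, rfl⟩ := Finset.mem_add.1 (support_mul f h he)
  rw [← hf x hx, ← hh y hy]
  simp [Finset.sum_add_distrib]

theorem HZ.C (c : K) : IsHomogZ K n 0 (MvPolynomial.C c : MvPolynomial (Fin n) K) := by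
  classical
  intro e he
  rw [mem_support_iff, coeff_C] at he
  have : 0 = e := by by_contra h; simp [h] at he
  subst this
  simp

theorem HZ.congr (hf : IsHomogZ K n a f) (h : a = b) : IsHomogZ K n b f := h ▸ hf

theorem HZ.Cmul (c : K) (hf : IsHomogZ K n a f) : IsHomogZ K n a (MvPolynomial.C c * f) :=
  HZ.congr (HZ.mul (HZ.C c) hf) (zero_add _)

theorem HZ.neg (hf : IsHomogZ K n a f) : IsHomogZ K n a (-f) := by
  intro e he
  rw [support_neg] at he
  exact hf e he

theorem HZ.sub (hf : IsHomogZ K n a f) (hh : IsHomogZ K n a h) : IsHomogZ K n a (f - h) := by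
  rw [sub_eq_add_neg]
  exact HZ.add hf (HZ.neg hh)

theorem HZ.sq (hf : IsHomogZ K n a f) : IsHomogZ K n (2 * a) (f ^ 2) := by
  rw [_root_.sq]
  exact HZ.congr (HZ.mul hf hf) (by ring)

theorem HZ.eq_zero (hf : IsHomogZ K n a f) (ha : a < 0) : f = 0 := by
  by_contra h0
  obtain ⟨e, he⟩ := Finset.nonempty_iff_ne_empty.2 (mt support_eq_empty.1 h0)
  have := hf e he
  have h1 : (0 : ℤ) ≤ ∑ i, (e i : ℤ) := Finset.sum_nonneg (fun _ _ => by positivity)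
  omega

theorem HZ.eq_C (hf : IsHomogZ K n 0 f) : f = MvPolynomial.C (f.coeff 0) := by
  classical
  ext e
  rw [coeff_C]
  split_ifs with h
  · rw [h]
  · by_contra h0
    have := hf e (mem_support_iff.2 h0)
    rw [Finset.sum_eq_zero_iff_of_nonneg (fun _ _ => by positivity)] at this
    apply h
    ext i
    have := this i (Finset.mem_univ _)
    simp only [Finsupp.coe_zero, Pi.zero_apply]
    omega

theorem HZ.totalDegree_le (hf : IsHomogZ K n a f) (h0 : f ≠ 0) : (f.totalDegree : ℤ) ≤ a := by
  have ha : 0 ≤ a := by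
    by_contra h
    exact h0 (HZ.eq_zero hf (by omega))
  lift a to ℕ using ha
  norm_cast
  rw [totalDegree]
  refine Finset.sup_le fun e he => ?_
  have := hf e he
  rw [Finsupp.sum_fintype _ _ (by simp)]
  exact_mod_cast this.le

theorem disc_homog (h2 : (2 : K) ≠ 0) {w : Fin 3 → ℤ} {d : ℤ} {g : Cox K n 3} (hg : BD w d 2 g)
    {p q r : Fin 3} (hqp : q ≠ p) (hrp : r ≠ p) (hqr : q ≠ r) :
    IsHomogZ K n (3 * d - 2 * (w p + w q + w r)) (discriminantPoly K g) := by
  have h := disc_eq h2 g hqp hrp hqr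
  have e : discriminantPoly K g = MvPolynomial.C ((4 : K)⁻¹) * (4 * discriminantPoly K g) := by
    have h4 : (4 : K) ≠ 0 := by
      have : (4 : K) = 2 * 2 := by norm_num
      rw [this]; exact mul_ne_zero h2 h2
    rw [← mul_assoc, show (4 : MvPolynomial (Fin n) K) = MvPolynomial.C 4 from (map_ofNat MvPolynomial.C 4).symm,
      ← C_mul, inv_mul_cancel₀ h4, C_1, one_mul]
  rw [e, h]
  refine HZ.Cmul _ ?_
  have H := fc_homog hg
  refine HZ.sub (HZ.sub (HZ.sub (HZ.add ?_ ?_) ?_) ?_) ?_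
  · rw [show (4 : MvPolynomial (Fin n) K) = MvPolynomial.C 4 from (map_ofNat MvPolynomial.C 4).symm]
    exact HZ.Cmul _ (HZ.congr (HZ.mul (HZ.mul (H p p) (H q q)) (H r r)) (by ring))
  · exact HZ.congr (HZ.mul (HZ.mul (H p q) (H p r)) (H q r)) (by ring)
  · exact HZ.congr (HZ.mul (H p p) (HZ.sq (H q r))) (by ring)
  · exact HZ.congr (HZ.mul (H q q) (HZ.sq (H p r))) (by ring)
  · exact HZ.congr (HZ.mul (H r r) (HZ.sq (H p q))) (by ring)

theorem disc_deg (h2 : (2 : K) ≠ 0) {w : Fin 3 → ℤ} {d : ℤ} {g : Cox K n 3} (hg : BD w d 2 g)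
    {p q r : Fin 3} (hqp : q ≠ p) (hrp : r ≠ p) (hqr : q ≠ r)
    (hk : KMultipleplusDiscriminantEffective K g 3) :
    3 * (n : ℤ) ≤ 3 * d - 2 * (w p + w q + w r) := by
  obtain ⟨h0, h, hh0, hh⟩ := hk
  have h1 := HZ.totalDegree_le (disc_homog h2 hg hqp hrp hqr) h0
  have h3 := HZ.totalDegree_le hh hh0
  push_cast at h3
  omega

theorem kil_le {σ : Type*} (J : Finset σ) (Q : Ideal (MvPolynomial σ K)) (h : ∀ j ∈ J, X j ∈ Q) :
    RingHom.ker (kil (K := K) J) ≤ Q := by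
  intro x hx
  have h1 : x - kil (K := K) J x ∈ Q := by
    rw [← Ideal.Quotient.eq]
    have : (Ideal.Quotient.mkₐ K Q) = (Ideal.Quotient.mkₐ K Q).comp (kil (K := K) J) := by
      apply MvPolynomial.algHom_ext
      intro v
      rw [AlgHom.comp_apply]
      by_cases hv : v ∈ J
      · rw [kil_mem hv, map_zero]
        exact Ideal.Quotient.eq_zero_iff_mem.2 (h v hv)
      · rw [kil_not_mem hv]
    exact DFunLike.congr_fun this x
  rw [RingHom.mem_ker] at hx
  rwa [hx, sub_zero] at h1

theorem HZ.mem_kil (hf : IsHomogZ K n a f) (ha : 0 < a) : f ∈ RingHom.ker (kil (K := K) (Finset.univ : Finset (Fin n))) := by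
  rw [RingHom.mem_ker, f.as_sum, map_sum]
  refine Finset.sum_eq_zero fun e he => ?_
  have := hf e he
  have : ∃ j : Fin n, e j ≠ 0 := by
    by_contra hcon
    push Not at hcon
    simp [hcon] at this
    omega
  obtain ⟨j, hj⟩ := this
  rw [monomial_eq, map_mul, Finsupp.prod, map_prod]
  rw [Finset.prod_eq_zero (i := j) (Finsupp.mem_support_iff.2 hj), mul_zero]
  rw [map_pow, kil_mem (by simp), zero_pow hj]

theorem common_zero [IsAlgClosed K] (hn : 3 ≤ n) (ha : 0 < a) (hb : 0 < b)
    (hf : IsHomogZ K n a f) (hh : IsHomogZ K n b h) : ∃ x : Fin n → K, x ≠ 0 ∧ eval x f = 0 ∧ eval x h = 0 := by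
  by_contra hcon
  push Not at hcon
  have hX : ∀ j, (X j : MvPolynomial (Fin n) K) ∈ (Ideal.span {f, h}).radical := by
    intro j
    rw [← MvPolynomial.vanishingIdeal_zeroLocus_eq_radical (K := K), mem_vanishingIdeal_iff]
    intro x hx
    rw [mem_zeroLocus_iff] at hx
    have h1 := hx f (Ideal.subset_span (by simp))
    have h2 := hx h (Ideal.subset_span (by simp))
    have : x = 0 := by
      by_contra h0
      exact hcon x h0 (by simpa using h1) (by simpa using h2)
    simp [this]
  obtain ⟨Q, hQ, hQle⟩ := Ideal.exists_minimalPrimes_le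
    (I := Ideal.span {f, h}) (J := RingHom.ker (kil (K := K) (Finset.univ : Finset (Fin n))))
    (by rw [Ideal.span_le]; rintro x (rfl | rfl); exacts [HZ.mem_kil hf ha, HZ.mem_kil hh hb])
  have hQp : Q.IsPrime := hQ.1.1
  have hle := kil_le (K := K) (Finset.univ : Finset (Fin n)) Q
    (fun j _ => (hQp.radical_le_iff.2 hQ.1.2) (hX j))
  have h3 := (kil_height (K := K) (Finset.univ : Finset (Fin n))).trans
    ((Ideal.height_mono hle).trans (height_le_two Q f h hQ))
  simp only [Finset.card_univ, Fintype.card_fin] at h3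
  have h4 : n ≤ 2 := by exact_mod_cast h3
  omega

theorem smooth_contra {g : Cox K n 3} {w : Fin 3 → ℤ} {d : ℤ} (hg : BD w d 2 g) {p q r : Fin 3}
    (hqp : q ≠ p) (hrp : r ≠ p) (hqr : q ≠ r)
    (hsm : IsSmoothModel K g) (hpp : fc g p p = 0) (x : Fin n → K) (hx : x ≠ 0)
    (h1 : eval x (fc g p q) = 0) (h2 : eval x (fc g p r) = 0) : False := by
  classical
  have hdec := dec hg hqp hrp hqr
  set pt : Pt K n 3 := (x, Pi.single p 1) with hpt
  set A : Cox K n 3 := rename Sum.inl (fc g q q) * X (Sum.inr q) + rename Sum.inl (fc g p q) * X (Sum.inr p) +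
    rename Sum.inl (fc g q r) * X (Sum.inr r)
  set B : Cox K n 3 := rename Sum.inl (fc g r r) * X (Sum.inr r) + rename Sum.inl (fc g p r) * X (Sum.inr p)
  have hgAB : g = X (Sum.inr q) * A + X (Sum.inr r) * B := by
    rw [hpp, map_zero] at hdec
    linear_combination hdec
  have eR : ∀ f : MvPolynomial (Fin n) K, evalPt K pt (rename Sum.inl f) = eval x f := by
    intro f
    rw [evalPt, eval_rename]
    rfl
  have ex : evalPt K pt (X (Sum.inr q)) = 0 := by simp [evalPt, hpt, hqp]
  have ey : evalPt K pt (X (Sum.inr r)) = 0 := by simp [evalPt, hpt, hrp]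
  have eadd : ∀ u v : Cox K n 3, evalPt K pt (u + v) = evalPt K pt u + evalPt K pt v := fun u v => map_add _ u v
  have emul : ∀ u v : Cox K n 3, evalPt K pt (u * v) = evalPt K pt u * evalPt K pt v := fun u v => map_mul _ u v
  have eA : evalPt K pt A = 0 := by
    simp only [A, eadd, emul, eR, ex, ey, h1]; ring
  have eB : evalPt K pt B = 0 := by
    simp only [B, eadd, emul, eR, ex, ey, h2]; ring
  obtain ⟨v, hv⟩ := hsm pt ⟨hx, by
    intro h
    have := congrFun h p
    simp [hpt] at this⟩ (by rw [hgAB, eadd, emul, emul, ex, ey]; ring)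
  apply hv
  rw [hgAB, map_add, Derivation.leibniz, Derivation.leibniz]
  simp only [smul_eq_mul, eadd, emul, ex, ey, eA, eB]
  ring

end hz
end CBProof

namespace CBProof
open ConicBundleFormalization

section deg
variable {n : ℕ} {w : Fin 3 → ℤ} {d : ℤ} {g : Cox ℂ n 3}

theorem BD_ux {f : MvPolynomial (Fin n) ℂ} {a e : ℤ} (hf : IsHomogZ ℂ n a f) (j : Fin 3) (h : a + w j = e) :
    BD w e 1 (rename Sum.inl f * X (Sum.inr j) : Cox ℂ n 3) :=
  ((BD_rename hf).mul (BD.xr j)).congr h rfl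

theorem evs_lin {p q r : Fin 3} (hqp : q ≠ p) (hrp : r ≠ p) (a b : MvPolynomial (Fin n) ℂ) (R : Cox ℂ n 3) :
    evs p R (rename Sum.inl a * X (Sum.inr q) + rename Sum.inl b * X (Sum.inr r)) =
      rename Sum.inl a * X (Sum.inr q) + rename Sum.inl b * X (Sum.inr r) := by
  have h1 : evs p R (X (Sum.inr q)) = X (Sum.inr q) := evs_ne _ _ (by simpa using hqp)
  have h2 : evs p R (X (Sum.inr r)) = X (Sum.inr r) := evs_ne _ _ (by simpa using hrp)
  simp only [map_add, map_mul, h1, h2, evs_u]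

theorem g_ne_zero (hd : discriminantPoly ℂ g ≠ 0) : g ≠ 0 := by
  rintro rfl
  apply hd
  have hfc : ∀ i j, fc (0 : Cox ℂ n 3) i j = 0 := by
    intro i j
    rw [fc, fibreCoeff_EE, map_zero, coeff_zero]
  have := disc_eq (p := 0) (q := 1) (r := 2) two_ne_zero (0 : Cox ℂ n 3) (by decide) (by decide) (by decide)
  simp only [hfc] at this
  simpa using this

theorem caseB1 (hn : 3 ≤ n) (hg : BD w d 2 g) (hgp : (Ideal.span {g}).IsPrime)
    (hpic : ClassGroupSpannedByFD ℂ w (fun _ => 1) g) (hsm : IsSmoothModel ℂ g)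
    (hd : discriminantPoly ℂ g ≠ 0) {p q r : Fin 3} (hqp : q ≠ p) (hrp : r ≠ p) (hqr : q ≠ r)
    (hδ : 3 * (n : ℤ) ≤ 3 * d - 2 * (w p + w q + w r))
    (hpq : w q ≤ w p) (hqr' : w r ≤ w q) (h0 : d - 2 * w p < 0)
    (hgen : d = w p + w q →
      g.coeff (Finsupp.single (Sum.inr p) 1 + Finsupp.single (Sum.inr q) 1) ≠ 0) : False := by
  have H := fc_homog hg
  have hg0 := g_ne_zero hd
  have hpp : fc g p p = 0 := HZ.eq_zero (H p p) (by omega)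
  have hdec := dec hg hqp hrp hqr
  have hdisc := disc_eq two_ne_zero g hqp hrp hqr
  have h4 : 4 * discriminantPoly ℂ g ≠ 0 := mul_ne_zero (by norm_num) hd
  rw [hpp] at hdisc
  rw [hpp, map_zero, zero_mul, zero_add] at hdec
  rcases lt_trichotomy (d - w p - w q) 0 with h1 | h1 | h1
  · have hfpq : fc g p q = 0 := HZ.eq_zero (H p q) h1
    rw [hfpq] at hdisc hdec
    rcases lt_trichotomy (d - w p - w r) 0 with h2 | h2 | h2
    · have hfpr : fc g p r = 0 := HZ.eq_zero (H p r) h2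
      rw [hfpr] at hdisc
      apply h4
      rw [hdisc]; ring
    · have hfpr := HZ.eq_C (HZ.congr (H p r) h2)
      set c := (fc g p r).coeff 0 with hc
      have hc0 : c ≠ 0 := by
        intro hc0
        rw [hc0, C_0] at hfpr
        rw [hfpr] at hdisc
        apply h4
        rw [hdisc]; ring
      have hci : (C c⁻¹ : Cox ℂ n 3) * C c = 1 := by rw [← C_mul, inv_mul_cancel₀ hc0, C_1]
      rw [hfpr, rename_C, map_zero] at hdec
      refine pic_contra (by omega) hg hg0 hgp hpic r p 0
        (rename Sum.inl (C (-c⁻¹) * fc g q r) * X (Sum.inr q) +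
          rename Sum.inl (C (-c⁻¹) * fc g r r) * X (Sum.inr r)) (X (Sum.inr q) ^ 2) c (fc g q q) ?_ ?_ ?_
          BD.zero ?_ (d - w q - w q) (by omega) (H q q) (Pi.single p 1) 1 one_ne_zero ?_ ?_
      · simp only [map_mul, map_neg, rename_C, C_neg]
        linear_combination hdec - (X (Sum.inr r)) * (rename Sum.inl (fc g q r) * X (Sum.inr q)
          + rename Sum.inl (fc g r r) * X (Sum.inr r)) * hci
      · simp
      · intro R
        exact evs_lin hqp hrp _ _ R
      · exact (BD_ux (HZ.Cmul _ (H q r)) q (by omega)).add (BD_ux (HZ.Cmul _ (H r r)) r (by omega))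
      · simp [hrp]
      · simp [hrp, hqp]
    · obtain ⟨x, hx, hx1, hx2⟩ := common_zero hn h2 h2 (H p r) (H p r)
      exact smooth_contra hg hqp hrp hqr hsm hpp x hx (by rw [hfpq, map_zero]) hx1
  · have hfpq := HZ.eq_C (HZ.congr (H p q) h1)
    have hc0 : (fc g p q).coeff 0 ≠ 0 := by
      rw [fc_coeff0]
      exact hgen (by omega)
    set c := (fc g p q).coeff 0 with hc
    have hci : (C c⁻¹ : Cox ℂ n 3) * C c = 1 := by rw [← C_mul, inv_mul_cancel₀ hc0, C_1]
    rw [hfpq, rename_C] at hdec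
    set t := C c⁻¹ * fc g p r with ht
    have Ht : IsHomogZ ℂ n (w q - w r) t := HZ.Cmul _ (HZ.congr (H p r) (by omega))
    refine pic_contra (by omega) hg hg0 hgp hpic q p (rename Sum.inl (-t) * X (Sum.inr r))
        (rename Sum.inl (C (-c⁻¹) * fc g q q) * X (Sum.inr q) +
          rename Sum.inl (C (-c⁻¹) * (fc g q r - t * fc g q q)) * X (Sum.inr r)) (X (Sum.inr r) ^ 2) c
          (fc g r r - t * fc g q r + t ^ 2 * fc g q q) ?_ ?_ ?_
          ?_ ?_ (d - w r - w r) (by omega) ?_ (Pi.single p 1) 1 one_ne_zero ?_ ?_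
    · have htc : C c * rename Sum.inl t = (rename Sum.inl (fc g p r) : Cox ℂ n 3) := by
        rw [ht, map_mul, rename_C, ← mul_assoc, mul_comm (C c), hci, one_mul]
      simp only [map_mul, map_sub, map_add, map_pow, map_neg, rename_C, C_neg]
      linear_combination hdec - (X (Sum.inr q) + rename Sum.inl t * X (Sum.inr r)) *
        (rename Sum.inl (fc g q q) * X (Sum.inr q) + (rename Sum.inl (fc g q r) -
        rename Sum.inl t * rename Sum.inl (fc g q q)) * X (Sum.inr r)) * hci
        - X (Sum.inr p) * X (Sum.inr r) * htc
    · intro R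
      rw [map_mul, evs_u, evs_ne _ _ (by simpa using hqr.symm)]
    · intro R
      exact evs_lin hqp hrp _ _ R
    · exact BD_ux (HZ.neg Ht) r (by omega)
    · exact (BD_ux (HZ.Cmul _ (H q q)) q (by omega)).add (BD_ux (HZ.Cmul _
        (HZ.sub (H q r) (HZ.congr (HZ.mul Ht (H q q)) (by omega)))) r (by omega))
    · exact HZ.add (HZ.sub (H r r) (HZ.congr (HZ.mul Ht (H q r)) (by omega)))
        (HZ.congr (HZ.mul (HZ.sq Ht) (H q q)) (by omega))
    · simp [hrp, hqp]
    · simp [hrp, hqp]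
  · obtain ⟨x, hx, hx1, hx2⟩ := common_zero hn h1 (show 0 < d - w p - w r by omega) (H p q) (H p r)
    exact smooth_contra hg hqp hrp hqr hsm hpp x hx hx1 hx2

theorem quad_roots (A B D : ℂ) (hA : A ≠ 0) (hD : 4 * A * D - B ^ 2 ≠ 0) :
    ∃ r1 r2 : ℂ, r1 ≠ r2 ∧ B = -A * (r1 + r2) ∧ D = A * (r1 * r2) := by
  obtain ⟨s, hs⟩ := IsSquare.exists_sq (B ^ 2 - 4 * A * D) (IsAlgClosed.exists_eq_mul_self _)
  have hs0 : s ≠ 0 := by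
    rintro rfl
    apply hD
    linear_combination -hs
  refine ⟨(-B + s) / (2 * A), (-B - s) / (2 * A), ?_, ?_, ?_⟩
  · intro h
    rw [div_left_inj' (by simpa using hA)] at h
    apply hs0
    linear_combination h / 2
  · field_simp; ring
  · field_simp
    linear_combination -hs

theorem caseB2 (hn : 3 ≤ n) (hg : BD w d 2 g) (hgp : (Ideal.span {g}).IsPrime)
    (hpic : ClassGroupSpannedByFD ℂ w (fun _ => 1) g)
    (hd : discriminantPoly ℂ g ≠ 0) {p q r : Fin 3} (hqp : q ≠ p) (hrp : r ≠ p) (hqr : q ≠ r)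
    (hδ : 3 * (n : ℤ) ≤ 3 * d - 2 * (w p + w q + w r))
    (h0 : d = 2 * w p) (h1 : w q = w p)
    (hgen1 : g.coeff (Finsupp.single (Sum.inr p) 1 + Finsupp.single (Sum.inr p) 1) ≠ 0)
    (hgen2 : 4 * g.coeff (Finsupp.single (Sum.inr p) 1 + Finsupp.single (Sum.inr p) 1) *
      g.coeff (Finsupp.single (Sum.inr q) 1 + Finsupp.single (Sum.inr q) 1) -
      g.coeff (Finsupp.single (Sum.inr p) 1 + Finsupp.single (Sum.inr q) 1) ^ 2 ≠ 0) : False := by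
  have H := fc_homog hg
  have hg0 := g_ne_zero hd
  have hdec := dec hg hqp hrp hqr
  rw [← fc_coeff0] at hgen1
  simp only [← fc_coeff0] at hgen2
  have e1 := HZ.eq_C (HZ.congr (H p p) (show _ = 0 by omega))
  have e2 := HZ.eq_C (HZ.congr (H q q) (show _ = 0 by omega))
  have e3 := HZ.eq_C (HZ.congr (H p q) (show _ = 0 by omega))
  obtain ⟨r1, r2, hr, hB, hD⟩ := quad_roots _ _ _ hgen1 hgen2
  set A := (fc g p p).coeff 0
  rw [e1, e2, e3, hB, hD, rename_C, rename_C, rename_C] at hdec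
  set t : MvPolynomial (Fin n) ℂ := C (-(A * (r2 - r1))⁻¹) * (fc g q r + C r1 * fc g p r) with ht
  have Ht : IsHomogZ ℂ n (w p - w r) t :=
    HZ.Cmul _ (HZ.add (HZ.congr (H q r) (by omega)) (HZ.Cmul _ (HZ.congr (H p r) (by omega))))
  set t' : MvPolynomial (Fin n) ℂ := C A⁻¹ * fc g p r - t with ht'
  have Ht' : IsHomogZ ℂ n (w p - w r) t' := HZ.sub (HZ.Cmul _ (HZ.congr (H p r) (by omega))) Ht
  have hr' : r2 - r1 ≠ 0 := sub_ne_zero.2 hr.symm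
  have E1 : C A * (t + t') = fc g p r := by
    rw [ht', add_sub_cancel, ← mul_assoc, ← C_mul, mul_inv_cancel₀ hgen1, C_1, one_mul]
  have E2 : C A * (C r2 * t + C r1 * t') = - fc g q r := by
    have : C A * (C r2 - C r1) * t = -(fc g q r + C r1 * fc g p r) := by
      rw [ht, ← mul_assoc, ← C_sub, ← C_mul, ← C_mul, mul_neg, mul_inv_cancel₀ (mul_ne_zero hgen1 hr')]
      simp
    linear_combination this + C r1 * E1
  have E1' := congrArg (rename Sum.inl : _ →ₐ[ℂ] Cox ℂ n 3) E1
  have E2' := congrArg (rename Sum.inl : _ →ₐ[ℂ] Cox ℂ n 3) E2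
  simp only [map_mul, map_add, map_neg, rename_C] at E1' E2'
  refine pic_contra (by omega) hg hg0 hgp hpic p p
      (rename Sum.inl (C r1) * X (Sum.inr q) + rename Sum.inl (-t) * X (Sum.inr r))
      (rename Sum.inl (C r2) * X (Sum.inr q) + rename Sum.inl (-t') * X (Sum.inr r)) (X (Sum.inr r) ^ 2) A
      (fc g r r - C A * (t * t')) ?_ ?_ ?_
      ?_ ?_ (d - w r - w r) (by omega) ?_ (Pi.single p (C r1) + Pi.single q 1) (r1 - r2) (sub_ne_zero.2 hr) ?_ ?_
  · simp only [map_mul, map_sub, map_add, map_neg, rename_C]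
    simp only [map_mul, map_add, map_neg] at hdec
    linear_combination hdec - X (Sum.inr p) * X (Sum.inr r) * E1' + X (Sum.inr q) * X (Sum.inr r) * E2'
  · intro R
    exact evs_lin hqp hrp _ _ R
  · intro R
    exact evs_lin hqp hrp _ _ R
  · exact (BD_ux (HZ.C _) q (by omega)).add (BD_ux (HZ.neg Ht) r (by omega))
  · exact (BD_ux (HZ.C _) q (by omega)).add (BD_ux (HZ.neg Ht') r (by omega))
  · exact HZ.sub (H r r) (HZ.Cmul _ (HZ.congr (HZ.mul Ht Ht') (by omega)))
  · simp [hrp, hqp, hqp.symm, hqr.symm, aeval_rename, algebraMap_eq]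
  · simp [hrp, hqp, hqp.symm, hqr.symm, aeval_rename, algebraMap_eq]

end deg
end CBProof

namespace CBProof
open ConicBundleFormalization

theorem vgh_mono {n : ℕ} {w : Fin 3 → ℤ} {d : ℤ} {P Q : Cox ℂ n 3 → Prop}
    (h : VeryGenerallyHolds ℂ n 3 w (fun _ => 1) d 2 P)
    (hPQ : ∀ g, BD w d 2 g → P g → Q g) : VeryGenerallyHolds ℂ n 3 w (fun _ => 1) d 2 Q := by
  obtain ⟨D, h1, h2⟩ := h
  exact ⟨D, h1, fun p hp hD => hPQ p (isBihom_iff_BD.1 hp) (h2 p hp hD)⟩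

theorem vgh_all {n : ℕ} {w : Fin 3 → ℤ} {d : ℤ} {Q : Cox ℂ n 3 → Prop}
    (hQ : ∀ g, BD w d 2 g → Q g) : VeryGenerallyHolds ℂ n 3 w (fun _ => 1) d 2 Q := by
  refine ⟨fun _ => 1, fun _ => ⟨0, isBihom_iff_BD.2 BD.zero, ?_⟩, fun p hp _ => hQ p (isBihom_iff_BD.1 hp)⟩
  simp [evalCoeff]

theorem vgh_one {n : ℕ} {w : Fin 3 → ℤ} {d : ℤ} {Q : Cox ℂ n 3 → Prop}
    (D : MvPolynomial ((Fin n ⊕ Fin 3) →₀ ℕ) ℂ) (p₀ : Cox ℂ n 3) (hp : BD w d 2 p₀)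
    (hD : evalCoeff ℂ p₀ D ≠ 0)
    (hQ : ∀ g, BD w d 2 g → evalCoeff ℂ g D ≠ 0 → Q g) : VeryGenerallyHolds ℂ n 3 w (fun _ => 1) d 2 Q :=
  ⟨fun _ => D, fun _ => ⟨p₀, isBihom_iff_BD.2 hp, hD⟩, fun p hp h => hQ p (isBihom_iff_BD.1 hp) (h 0)⟩

theorem coeff_XX {n : ℕ} (i j k l : Fin 3) : (X (Sum.inr i) * X (Sum.inr j) : Cox ℂ n 3).coeff
    (Finsupp.single (Sum.inr k) 1 + Finsupp.single (Sum.inr l) 1) =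
      if (i = k ∧ j = l) ∨ (i = l ∧ j = k) then 1 else 0 := by
  classical
  rw [X, X, monomial_mul, coeff_monomial, one_mul]
  congr 1
  rw [eq_iff_iff]
  constructor
  · intro h
    have h1 : ∀ m : Fin 3, (Finsupp.single i 1 + Finsupp.single j 1 : Fin 3 →₀ ℕ) m =
        (Finsupp.single k 1 + Finsupp.single l 1 : Fin 3 →₀ ℕ) m := by
      intro m
      have := DFunLike.congr_fun h (Sum.inr m)
      simpa [Finsupp.single_apply] using this
    have := h1 0
    have h2 := h1 1
    have h3 := h1 2
    clear h h1
    revert this h2 h3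
    fin_cases i <;> fin_cases j <;> fin_cases k <;> fin_cases l <;> simp [Finsupp.single_apply]
  · rintro (⟨rfl, rfl⟩ | ⟨rfl, rfl⟩)
    · rfl
    · rw [add_comm]

theorem sorted_case (n : ℕ) (hn : 3 ≤ n) (d : ℤ) (w : Fin 3 → ℤ) {p q r : Fin 3}
    (hqp : q ≠ p) (hrp : r ≠ p) (hqr : q ≠ r) (hpq : w q ≤ w p) (hqr' : w r ≤ w q) :
    VeryGenerallyHolds ℂ n 3 w (fun _ => 1) d 2 (fun g =>
      IsConicBundleModel ℂ n w d g →
      IsSmoothModel ℂ g →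
      KMultipleplusDiscriminantEffective ℂ g 3 →
      ¬ IsStablyRationalModel ℂ w (fun _ => 1) g) := by
  by_cases hδ : 3 * (n : ℤ) ≤ 3 * d - 2 * (w p + w q + w r)
  swap
  · exact vgh_all fun g hg _ _ hk => absurd (disc_deg two_ne_zero hg hqp hrp hqr hk) hδ
  by_cases h0 : 0 ≤ d - 2 * w p
  · by_cases h1 : 1 ≤ d - 2 * w q
    · obtain ⟨G, hα, hβ, hγ, hκ⟩ := good_num hn w d p q r hpq hqr' h0 h1 hδ
      exact vgh_mono (good_case (by omega) G p q r hqp hrp hqr hα hβ hγ hκ)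
        fun g hg h hc _ _ => h hc.integral
    · refine vgh_one (X (Finsupp.single (Sum.inr p) 1 + Finsupp.single (Sum.inr p) 1) *
        (C 4 * X (Finsupp.single (Sum.inr p) 1 + Finsupp.single (Sum.inr p) 1) *
          X (Finsupp.single (Sum.inr q) 1 + Finsupp.single (Sum.inr q) 1) -
          X (Finsupp.single (Sum.inr p) 1 + Finsupp.single (Sum.inr q) 1) ^ 2))
        (X (Sum.inr p) * X (Sum.inr p) + X (Sum.inr p) * X (Sum.inr q)) ?_ ?_ ?_
      · exact (((BD.xr p).mul (BD.xr p)).congr (by omega) rfl).add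
          (((BD.xr p).mul (BD.xr q)).congr (by omega) rfl)
      · simp [evalCoeff, coeff_XX, hqp, hqp.symm]
      · intro g hg hD hc _ hk _
        simp only [evalCoeff, map_mul, map_sub, map_pow, eval_X, eval_C] at hD
        exact caseB2 hn hg hc.integral hc.picardRankTwo hk.1 hqp hrp hqr hδ (by omega) (by omega)
          (left_ne_zero_of_mul hD) (right_ne_zero_of_mul hD)
  · by_cases h1 : d = w p + w q
    · refine vgh_one (X (Finsupp.single (Sum.inr p) 1 + Finsupp.single (Sum.inr q) 1))
        (X (Sum.inr p) * X (Sum.inr q)) (((BD.xr p).mul (BD.xr q)).congr (by omega) rfl) ?_ ?_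
      · simp [evalCoeff, coeff_XX]
      · intro g hg hD hc hs hk _
        simp only [evalCoeff, eval_X] at hD
        exact caseB1 hn hg hc.integral hc.picardRankTwo hs hk.1 hqp hrp hqr hδ hpq hqr' (by omega) (fun _ => hD)
    · exact vgh_all fun g hg hc hs hk _ =>
        caseB1 hn hg hc.integral hc.picardRankTwo hs hk.1 hqp hrp hqr hδ hpq hqr' (by omega)
          (fun h => absurd h h1)

theorem main_thm (n : ℕ) (hn : 3 ≤ n) (d : ℤ) (w : Fin 3 → ℤ) :
    VeryGenerallyHolds ℂ n 3 w (fun _ => 1) d 2 (fun g =>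
      IsConicBundleModel ℂ n w d g →
      IsSmoothModel ℂ g →
      KMultipleplusDiscriminantEffective ℂ g 3 →
      ¬ IsStablyRationalModel ℂ w (fun _ => 1) g) := by
  have key : ∃ p q r : Fin 3, q ≠ p ∧ r ≠ p ∧ q ≠ r ∧ w q ≤ w p ∧ w r ≤ w q := by
    rcases le_total (w 0) (w 1) with a | a <;> rcases le_total (w 1) (w 2) with b | b <;>
      rcases le_total (w 0) (w 2) with c | c
    · exact ⟨2, 1, 0, by decide, by decide, by decide, b, a⟩
    · exact ⟨2, 1, 0, by decide, by decide, by decide, b, a⟩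
    · exact ⟨1, 2, 0, by decide, by decide, by decide, b, c⟩
    · exact ⟨1, 0, 2, by decide, by decide, by decide, a, c⟩
    · exact ⟨2, 0, 1, by decide, by decide, by decide, c, a⟩
    · exact ⟨0, 2, 1, by decide, by decide, by decide, c, b⟩
    · exact ⟨0, 1, 2, by decide, by decide, by decide, a, b⟩
    · exact ⟨0, 1, 2, by decide, by decide, by decide, a, b⟩
  obtain ⟨p, q, r, h1, h2, h3, h4, h5⟩ := key
  exact sorted_case n hn d w h1 h2 h3 h4 h5

end CBProof

namespace ConicBundleFormalization

open MvPolynomial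

/-- **Corollary 1.5 (1).**  With `X` a very general nonsingular member of
`|2D + dF|` such that `π : X → ℙ^{n-1}` is a conic bundle with discriminant
divisor `Δ`: if `|3K_{ℙ^{n-1}} + Δ| ≠ ∅` then `X` is not stably rational. -/
theorem cor_discriminant_3K
    (n : ℕ) (hn : 3 ≤ n) (d : ℤ) (w : Fin 3 → ℤ) :
    VeryGenerallyHolds ℂ n 3 w (fun _ => 1) d 2 (fun g =>
      IsConicBundleModel ℂ n w d g →
      IsSmoothModel ℂ g →
      KMultipleplusDiscriminantEffective ℂ g 3 →
      ¬ IsStablyRationalModel ℂ w (fun _ => 1) g) := by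
  exact CBProof.main_thm n hn d w

end ConicBundleFormalization
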